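/- There exists an integer r₀ such that the following holds for every integer r ≥ r₀: if A is an integer matrix with r rows, rank r, and every r×r submatrix of A has determinant of absolute value at most 3, then A has at most binom(r+1,2) + 2(r−1) pairwise non-parallel columns; that is, the number of equivalence classes of nonzero columns of A under the relation of being parallel is at most binom(r+1,2) + 2(r−1). -/

import Mathlib

/-- Two integer vectors are parallel if they are linearly dependent over `ℚ`. -/
def IntParallel {r : ℕ} (u v : Fin r → ℤ) : Prop :=
  ¬ LinearIndependent ℚ ![(fun i => (u i : ℚ)), (fun i => (v i : ℚ))]

/-- A matrix with `r` rows is `Δ`-modular if every `r × r` submatrix has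
determinant of absolute value at most `Δ`. -/
def DeltaModular {r n : ℕ} (A : Matrix (Fin r) (Fin n) ℤ) (Δ : ℤ) : Prop :=
  ∀ f : Fin r → Fin n, Function.Injective f → |(A.submatrix id f).det| ≤ Δ

section

open Module

/-- A finite symmetric set of nonzero vectors spanning `V`, containing at most two vectors on
each line, together with a nonzero volume form taking integer values of absolute value at most
`3` on it. -/
structure ThreeModular {V : Type*} [AddCommGroup V] [Module ℚ V] (S : Finset V) : Prop where
  ne_zero : ∀ v ∈ S, v ≠ 0
  neg_mem : ∀ v ∈ S, -v ∈ S
  eq_or : ∀ v ∈ S, ∀ c : ℚ, c • v ∈ S → c = 1 ∨ c = -1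
  span_eq : Submodule.span ℚ (S : Set V) = ⊤
  form : ∃ D : V [⋀^Fin (finrank ℚ V)]→ₗ[ℚ] ℚ, D ≠ 0 ∧
    ∀ v, (∀ i, v i ∈ S) → ∃ k : ℤ, D v = k ∧ |k| ≤ 3

section AlternatingForms

variable {V ι : Type*} [AddCommGroup V] [Module ℚ V]

theorem AlternatingMap.map_update_mem_span [DecidableEq ι] (D : V [⋀^ι]→ₗ[ℚ] ℚ) (v : ι → V)
    (P : Set ι) (a : ι) (ha : a ∉ P) (x : V) (hx : x ∈ Submodule.span ℚ (v '' P)) :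
    D (Function.update v a x) = 0 := by
  induction hx using Submodule.span_induction with
  | mem x h =>
    obtain ⟨p, hp, rfl⟩ := h
    have hne : a ≠ p := fun h => ha (h ▸ hp)
    exact D.map_update_self v hne
  | zero => exact D.map_update_zero v a
  | add x y _ _ hx hy => rw [D.map_update_add, hx, hy, add_zero]
  | smul c x _ hx => rw [D.map_update_smul, hx, smul_zero]

theorem AlternatingMap.map_add_shift [Fintype ι] (D : V [⋀^ι]→ₗ[ℚ] ℚ) (v w : ι → V)
    (P : Set ι) (h0 : ∀ i ∈ P, w i = 0) (h1 : ∀ i, i ∉ P → w i ∈ Submodule.span ℚ (v '' P)) :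
    D (v + w) = D v := by
  classical
  have key : ∀ s : Finset ι, D (fun i => if i ∈ s then v i + w i else v i) = D v := by
    intro s
    induction s using Finset.induction_on with
    | empty => simp
    | insert a s ha ih =>
      set o : ι → V := fun i => if i ∈ s then v i + w i else v i with ho
      have hn : (fun i => if i ∈ insert a s then v i + w i else v i)
          = Function.update o a (o a + w a) := by
        funext i
        by_cases hi : i = a
        · subst hi; simp [ho, ha]
        · simp [ho, hi]
      rw [hn, D.map_update_add, Function.update_eq_self, ih]
      by_cases haP : a ∈ P
      · rw [h0 a haP, D.map_update_zero, add_zero]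
      · have himg : o '' P = v '' P := by
          apply Set.image_congr
          intro p hp
          simp [ho, h0 p hp]
        rw [D.map_update_mem_span o P a haP (w a) (himg ▸ h1 a haP), add_zero]
  have := key Finset.univ
  simpa [Pi.add_def] using this

theorem AlternatingMap.map_update_sum_smul [Fintype ι] [DecidableEq ι] (D : V [⋀^ι]→ₗ[ℚ] ℚ)
    (v : ι → V) (c : ι → ℚ) (i : ι) :
    D (Function.update v i (∑ j, c j • v j)) = c i * D v := by
  have := D.toMultilinearMap.map_update_sum Finset.univ i (fun j => c j • v j) v
  simp only [AlternatingMap.coe_multilinearMap] at this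
  rw [this, Finset.sum_eq_single i]
  · rw [D.map_update_smul, Function.update_eq_self, smul_eq_mul]
  · intro j _ hj
    rw [D.map_update_smul, D.map_update_self v hj.symm, smul_zero]
  · simp

end AlternatingForms

namespace ThreeModular

variable {V : Type*} [AddCommGroup V] [Module ℚ V] [FiniteDimensional ℚ V] {S : Finset V}

theorem exists_form (hS : ThreeModular S) {ι : Type*} [Fintype ι]
    (hι : Fintype.card ι = finrank ℚ V) :
    ∃ D : V [⋀^ι]→ₗ[ℚ] ℚ, (∀ v : ι → V, LinearIndependent ℚ v → D v ≠ 0) ∧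
      ∀ v, (∀ i, v i ∈ S) → ∃ k : ℤ, D v = k ∧ |k| ≤ 3 := by
  classical
  obtain ⟨D, hD, hD3⟩ := hS.form
  let e : Fin (finrank ℚ V) ≃ ι := Fintype.equivOfCardEq (by simp [hι])
  refine ⟨D.domDomCongr e, fun v hv => ?_, fun v hv => ?_⟩
  · have hli : LinearIndependent ℚ (fun i => v (e i)) := hv.comp e e.injective
    let b := basisOfLinearIndependentOfCardEqFinrank' (K := ℚ) (b := fun i => v (e i)) hli
      (by simp)
    have := (AlternatingMap.map_basis_ne_zero_iff (f := D) b).2 hD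
    simpa [b, Function.comp_def] using this
  · simpa [Function.comp_def] using hD3 (fun i => v (e i)) (fun i => hv _)

/-- An independent subset of `S` extends to a basis contained in `S`. -/
theorem exists_basis_extension {V : Type*} [AddCommGroup V] [Module ℚ V]
    {S : Finset V} (hS : ThreeModular S) {B : Finset V} (hB : B ⊆ S)
    (hi : LinearIndepOn ℚ id (B : Set V)) :
    ∃ B' : Finset V, B ⊆ B' ∧ B' ⊆ S ∧ LinearIndepOn ℚ id (B' : Set V) ∧
      Submodule.span ℚ (B' : Set V) = ⊤ ∧ B'.card = finrank ℚ V := by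
  classical
  obtain ⟨b, hbS, hBb, hSb, hb⟩ := exists_linearIndepOn_extension hi
    (show (B : Set V) ⊆ (S : Set V) by exact_mod_cast hB)
  have hfin : b.Finite := S.finite_toSet.subset hbS
  refine ⟨hfin.toFinset, ?_, ?_, by simpa using hb, ?_, ?_⟩
  · intro x hx; simpa using hBb hx
  · intro x hx; simpa using hbS (by simpa using hx)
  · rw [eq_top_iff, ← hS.span_eq, Submodule.span_le]
    simpa using hSb
  · have htop : Submodule.span ℚ b = ⊤ := by
      rw [eq_top_iff, ← hS.span_eq, Submodule.span_le]
      simpa using hSb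
    have := finrank_span_finset_eq_card (R := ℚ) (s := hfin.toFinset)
      (show LinearIndepOn ℚ id (hfin.toFinset : Set V) by simpa using hb)
    rw [hfin.coe_toFinset] at this
    rw [htop, finrank_top] at this
    exact this.symm

/-- Coordinates of elements of `S` in (shifted) bases contained in `S` are integral multiples of
the inverse of a common determinant. -/
theorem exists_det (hS : ThreeModular S) {B : Finset V} (hB : B ⊆ S)
    (hi : LinearIndepOn ℚ id (B : Set V)) :
    ∃ d : ℚ, d ≠ 0 ∧ ∀ Y ⊆ B, ∀ z ∈ B, ∀ σ : V → V, (∀ t ∈ Y, σ t = t) →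
      (∀ t ∈ B, σ t - t ∈ Submodule.span ℚ (Y : Set V)) → (∀ t ∈ B, σ t ∈ S) →
      ∀ y ∈ S, ∀ c : V → ℚ, y = ∑ t ∈ B, c t • σ t → ∃ k : ℤ, c z * d = k ∧ |k| ≤ 3 := by
  classical
  obtain ⟨B', hBB, hBS, hBi, -, hcard⟩ := hS.exists_basis_extension hB hi
  obtain ⟨D, hD0, hD⟩ := hS.exists_form (ι := B') (by simpa using hcard)
  refine ⟨D (fun t => t.1), hD0 _ hBi, ?_⟩
  intro Y hY z hz σ hσY hσ hσS y hy c hc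
  let v : B' → V := fun t => t.1
  let w : B' → V := fun t => if t.1 ∈ B then σ t.1 - t.1 else 0
  have himg : v '' {t : B' | t.1 ∈ Y} = (Y : Set V) := by
    ext x
    constructor
    · rintro ⟨t, ht, rfl⟩; exact ht
    · intro hx; exact ⟨⟨x, hBB (hY hx)⟩, hx, rfl⟩
  have hshift : D (v + w) = D v := by
    apply D.map_add_shift v w {t : B' | t.1 ∈ Y}
    · intro i hi
      have hi' : i.1 ∈ Y := hi
      simp [w, hσY _ hi']
    · intro i _
      rw [himg]
      by_cases h : i.1 ∈ B
      · simpa [w, h] using hσ _ h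
      · simp [w, h]
  have hvw : ∀ i : B', (v + w) i = if i.1 ∈ B then σ i.1 else i.1 := by
    intro i
    by_cases h : i.1 ∈ B <;> simp [v, w, h]
  have hy' : y = ∑ j : B', (if j.1 ∈ B then c j.1 else 0) • (v + w) j := by
    rw [hc, Finset.sum_coe_sort B' (fun t => (if t ∈ B then c t else 0) •
      (if t ∈ B then σ t else t)) |>.symm.trans
      (Finset.sum_congr rfl fun j _ => by rw [hvw j]) |>.symm]
    rw [← Finset.sum_subset hBB]
    · exact Finset.sum_congr rfl fun t ht => by simp [ht]
    · intro x _ hx; simp [hx]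
  have hup := D.map_update_sum_smul (v + w) (fun j : B' => if j.1 ∈ B then c j.1 else 0)
    ⟨z, hBB hz⟩
  rw [← hy', hshift] at hup
  simp only [hz, if_true] at hup
  rw [← hup]
  apply hD
  intro i
  by_cases h : i = ⟨z, hBB hz⟩
  · subst h; simpa using hy
  · rw [Function.update_of_ne h, hvw]
    split_ifs with h'
    · exact hσS _ h'
    · exact hBS i.2

end ThreeModular

end

section

open Module

/-- Contracting an element of `S` cannot lose fewer elements than prescribed by the
recursion of the extremal function. -/
def NoGain {V : Type*} [AddCommGroup V] [Module ℚ V] (S : Finset V) : Prop :=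
  ∀ z ∈ S, ∀ R ⊆ S, (∀ u ∈ R, -u ∈ R) → (∀ u ∈ R, u ∉ Submodule.span ℚ {z}) →
    (∀ u ∈ R, ∀ v ∈ R, ∀ c : ℚ, v - c • u ∈ Submodule.span ℚ {z} → v = u ∨ v = -u) →
    R.card + 2 * (finrank ℚ V + 2) ≤ S.card

/-- A maximal system of pairwise non-parallel (modulo `W`) elements of a symmetric set. -/
theorem exists_maximal_nonparallel {V : Type*} [AddCommGroup V] [Module ℚ V] (W : Submodule ℚ V)
    {O R : Finset V} (hO : ∀ u ∈ O, -u ∈ O) (hfree : ∀ u ∈ O, u ∉ W)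
    (hR : R ⊆ O) (hneg : ∀ u ∈ R, -u ∈ R)
    (hpar : ∀ u ∈ R, ∀ v ∈ R, ∀ c : ℚ, v - c • u ∈ W → v = u ∨ v = -u) :
    ∃ M ⊆ O, R.card ≤ M.card ∧ (∀ u ∈ M, -u ∈ M) ∧
      (∀ u ∈ M, ∀ v ∈ M, ∀ c : ℚ, v - c • u ∈ W → v = u ∨ v = -u) ∧
      ∀ s ∈ O, ∃ u ∈ M, ∃ c : ℚ, s - c • u ∈ W := by
  classical
  let P : Finset V → Prop := fun R => (∀ u ∈ R, -u ∈ R) ∧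
    (∀ u ∈ R, ∀ v ∈ R, ∀ c : ℚ, v - c • u ∈ W → v = u ∨ v = -u)
  obtain ⟨M, hM, hmax⟩ := Finset.exists_max_image (O.powerset.filter P) Finset.card
    ⟨R, by simp [P, hR]; exact ⟨hneg, hpar⟩⟩
  simp only [Finset.mem_filter, Finset.mem_powerset] at hM hmax
  obtain ⟨hMS, hMneg, hMpar⟩ := hM
  refine ⟨M, hMS, hmax R ⟨hR, hneg, hpar⟩, hMneg, hMpar, ?_⟩
  intro s hs
  have hsW := hfree s hs
  by_contra! hcon
  have hcon' : ∀ u ∈ M, ∀ c : ℚ, u - c • s ∉ W := by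
    intro u hu c hc
    by_cases h0 : c = 0
    · subst h0; simp at hc; exact hfree u (hMS hu) hc
    · apply hcon u hu c⁻¹
      have := W.smul_mem (-c⁻¹) hc
      rw [smul_sub, smul_smul, neg_mul, inv_mul_cancel₀ h0] at this
      convert this using 1
      module
  have hsM : s ∉ M := fun h => hcon s h 1 (by simp)
  have hP : P (insert s (insert (-s) M)) := by
    refine ⟨?_, ?_⟩
    · intro u hu
      simp only [Finset.mem_insert] at hu ⊢
      rcases hu with rfl | rfl | hu
      · simp
      · simp
      · right; right; exact hMneg u hu
    · intro u hu v hv c hc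
      simp only [Finset.mem_insert] at hu hv
      rcases hu with rfl | rfl | hu
      · rcases hv with rfl | rfl | hv
        · simp
        · simp
        · exact absurd hc (hcon' v hv c)
      · rcases hv with rfl | rfl | hv
        · simp
        · simp
        · exact absurd (show v - (-c) • s ∈ W by simpa using hc) (hcon' v hv (-c))
      · rcases hv with rfl | rfl | hv
        · exact absurd hc (hcon u hu c)
        · refine absurd (show s - (-c) • u ∈ W from ?_) (hcon u hu (-c))
          have := W.neg_mem hc
          convert this using 1
          module
        · exact hMpar u hu v hv c hc
  have hle := hmax _ ⟨by
    intro x hx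
    simp only [Finset.mem_insert] at hx
    rcases hx with rfl | rfl | hx
    · exact hs
    · exact hO _ hs
    · exact hMS hx, hP⟩
  have : M.card < (insert s (insert (-s) M)).card := by
    apply Finset.card_lt_card
    rw [Finset.ssubset_iff_of_subset]
    · exact ⟨s, by simp, hsM⟩
    · intro x hx; simp [hx]
  omega

namespace ThreeModular

variable {V : Type*} [AddCommGroup V] [Module ℚ V] [FiniteDimensional ℚ V] {S : Finset V}

theorem exists_det_coord (hS : ThreeModular S) {B : Finset V} (hB : B ⊆ S)
    (hi : LinearIndepOn ℚ id (B : Set V)) :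
    ∃ d : ℚ, d ≠ 0 ∧ ∀ z ∈ B, ∀ y ∈ S, ∀ c : V → ℚ, y = ∑ t ∈ B, c t • t →
      ∃ k : ℤ, c z * d = k ∧ |k| ≤ 3 := by
  obtain ⟨d, hd, h⟩ := hS.exists_det hB hi
  exact ⟨d, hd, fun z hz y hy c hc => h ∅ (by simp) z hz id (by simp) (by simp)
    (fun t ht => hB ht) y hy c hc⟩

theorem card_le_of_subset_span (hS : ThreeModular S) {B : Finset V} (hB : B ⊆ S)
    (hi : LinearIndepOn ℚ id (B : Set V)) {W : Finset V} (hW : W ⊆ S)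
    (hWB : ∀ w ∈ W, w ∈ Submodule.span ℚ (B : Set V)) : W.card ≤ 7 ^ B.card := by
  classical
  obtain ⟨d, hd, h⟩ := hS.exists_det_coord hB hi
  have hc : ∀ w : V, ∃ c : V → ℚ, w ∈ W → w = ∑ t ∈ B, c t • t := by
    intro w
    by_cases hw : w ∈ W
    · obtain ⟨c, -, hc⟩ := Submodule.mem_span_finset.1 (hWB w hw)
      exact ⟨c, fun _ => hc.symm⟩
    · exact ⟨0, fun h => absurd h hw⟩
  choose c hc using hc
  have hk : ∀ (w : V) (t : B), ∃ k : ℤ, w ∈ W → c w t * d = k ∧ |k| ≤ 3 := by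
    intro w t
    by_cases hw : w ∈ W
    · obtain ⟨k, hk⟩ := h t t.2 w (hW hw) (c w) (hc w hw)
      exact ⟨k, fun _ => hk⟩
    · exact ⟨0, fun h => absurd h hw⟩
  choose k hk using hk
  have : W.card ≤ (Fintype.piFinset (fun _ : B => Finset.Icc (-3 : ℤ) 3)).card := by
    apply Finset.card_le_card_of_injOn k
    · intro w hw
      simp only [Finset.mem_coe, Fintype.mem_piFinset, Finset.mem_Icc]
      intro t
      exact abs_le.1 (hk w t hw).2
    · intro w hw w' hw' hww
      rw [hc w hw, hc w' hw']
      refine Finset.sum_congr rfl fun t ht => ?_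
      have h1 := (hk w ⟨t, ht⟩ hw).1
      have h2 := (hk w' ⟨t, ht⟩ hw').1
      rw [hww, ← h2] at h1
      rw [mul_right_cancel₀ hd h1]
  simpa [Fintype.card_piFinset] using this

theorem card_le (hS : ThreeModular S) : S.card ≤ 7 ^ finrank ℚ V := by
  obtain ⟨B, -, hB, hi, hs, hc⟩ := hS.exists_basis_extension (B := ∅) (by simp)
    (by simp)
  rw [← hc]
  exact hS.card_le_of_subset_span hB hi subset_rfl (by simp [hs])

/-- The contraction of `S` by one of its elements contains a simplification of the image of any
system of pairwise non-parallel (modulo `z`) elements. -/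
theorem exists_contraction (hS : ThreeModular S) {z : V} (hz : z ∈ S) {R : Finset V}
    (hR : R ⊆ S) (hneg : ∀ u ∈ R, -u ∈ R) (hfree : ∀ u ∈ R, u ∉ Submodule.span ℚ {z})
    (hpar : ∀ u ∈ R, ∀ v ∈ R, ∀ c : ℚ, v - c • u ∈ Submodule.span ℚ {z} → v = u ∨ v = -u) :
    ∃ S' : Finset (V ⧸ Submodule.span ℚ {z}), ThreeModular S' ∧ R.card ≤ S'.card := by
  classical
  set W := Submodule.span ℚ {z} with hW
  have hzW : z ∈ W := Submodule.mem_span_singleton_self z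
  have hz0 := hS.ne_zero z hz
  obtain ⟨M, hMO, hcard, hMneg, hMpar, hcov⟩ := exists_maximal_nonparallel W
    (O := S.filter (· ∉ W)) (R := R)
    (fun u hu => by
      simp only [Finset.mem_filter, neg_mem_iff] at hu ⊢
      exact ⟨hS.neg_mem u hu.1, hu.2⟩)
    (fun u hu => (Finset.mem_filter.1 hu).2)
    (fun u hu => Finset.mem_filter.2 ⟨hR hu, hfree u hu⟩) hneg hpar
  have hMS : M ⊆ S := fun u hu => (Finset.mem_filter.1 (hMO hu)).1
  have hMfree : ∀ u ∈ M, u ∉ W := fun u hu => (Finset.mem_filter.1 (hMO hu)).2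
  have hcover : ∀ s ∈ S, s ∉ W → ∃ u ∈ M, ∃ c : ℚ, s - c • u ∈ W :=
    fun s hs hsW => hcov s (Finset.mem_filter.2 ⟨hs, hsW⟩)
  have hinj : Set.InjOn W.mkQ (M : Set V) := by
    intro u hu v hv huv
    have huv' : v - (1 : ℚ) • u ∈ W := by
      rw [one_smul]; exact (Submodule.Quotient.eq W).1 huv.symm
    rcases hMpar u hu v hv 1 huv' with h | h
    · exact h.symm
    · exfalso
      rw [h, one_smul] at huv'
      apply hMfree u hu
      have := W.smul_mem (-1/2 : ℚ) huv'
      have e : (-1/2 : ℚ) • (-u - u) = u := by module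
      rwa [e] at this
  refine ⟨M.image W.mkQ, ?_, ?_⟩
  swap
  · rw [Finset.card_image_of_injOn hinj]
    exact hcard
  constructor
  · intro v hv h0
    obtain ⟨u, hu, rfl⟩ := Finset.mem_image.1 hv
    exact hMfree u hu (by simpa using h0)
  · intro v hv
    obtain ⟨u, hu, rfl⟩ := Finset.mem_image.1 hv
    exact Finset.mem_image.2 ⟨-u, hMneg u hu, by simp⟩
  · intro v hv c hc
    obtain ⟨u, hu, rfl⟩ := Finset.mem_image.1 hv
    obtain ⟨w, hw, hwc⟩ := Finset.mem_image.1 hc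
    have hu0 : W.mkQ u ≠ 0 := fun h0 => hMfree u hu (by simpa using h0)
    have hmem : w - c • u ∈ W := by
      rw [← map_smul] at hwc
      exact (Submodule.Quotient.eq W).1 hwc
    rcases hMpar u hu w hw c hmem with rfl | rfl
    · left
      have : (c - 1) • W.mkQ w = 0 := by rw [sub_smul, ← hwc]; simp
      rcases smul_eq_zero.1 this with h | h
      · linarith
      · exact absurd h hu0
    · right
      have : (c + 1) • W.mkQ u = 0 := by rw [add_smul, ← hwc]; simp
      rcases smul_eq_zero.1 this with h | h
      · linarith
      · exact absurd h hu0
  · have h1 : Submodule.map W.mkQ (Submodule.span ℚ (S : Set V)) = ⊤ := by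
      rw [hS.span_eq, Submodule.map_top, Submodule.range_mkQ]
    rw [eq_top_iff, ← h1, Submodule.map_span, Submodule.span_le]
    rintro _ ⟨s, hs, rfl⟩
    by_cases hsW : s ∈ W
    · have : W.mkQ s = 0 := by simpa using hsW
      rw [this]; exact Submodule.zero_mem _
    · obtain ⟨u, hu, c, hc⟩ := hcover s hs hsW
      have : W.mkQ s = c • W.mkQ u := by
        rw [← map_smul]; exact (Submodule.Quotient.eq W).2 hc
      rw [this]
      exact Submodule.smul_mem _ _ (Submodule.subset_span (by
        simpa using ⟨u, hu, rfl⟩))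
  · have hrank : finrank ℚ (V ⧸ W) + 1 = finrank ℚ V := by
      have := Submodule.finrank_quotient_add_finrank W
      rwa [hW, finrank_span_singleton hz0] at this
    obtain ⟨D, hD0, hD⟩ := hS.exists_form (ι := Fin (finrank ℚ (V ⧸ W) + 1)) (by simpa using hrank)
    obtain ⟨s, hs⟩ := W.mkQ.exists_rightInverse_of_surjective (by simp)
    have hs' : ∀ x, W.mkQ (s x) = x := fun x => by
      have := LinearMap.congr_fun hs x
      simpa using this
    refine ⟨(D.curryLeft z).compLinearMap s, ?_, ?_⟩
    · intro h0
      let b := finBasis ℚ (V ⧸ W)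
      have h1 : LinearIndependent ℚ (Fin.cons z (fun i => s (b i)) : Fin (_ + 1) → V) := by
        rw [linearIndependent_finCons]
        refine ⟨?_, ?_⟩
        · have : LinearIndependent ℚ (W.mkQ ∘ fun i => s (b i)) := by
            have : (W.mkQ ∘ fun i => s (b i)) = b := by funext i; exact hs' _
            rw [this]; exact b.linearIndependent
          exact LinearIndependent.of_comp _ this
        · intro hmem
          have hr : Set.range (fun i => s (b i)) ⊆ LinearMap.range s := by
            rintro _ ⟨i, rfl⟩; exact ⟨_, rfl⟩
          obtain ⟨x, hx⟩ := Submodule.span_le.2 hr hmem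
          have : W.mkQ z = x := by rw [← hx]; exact hs' x
          have hz : W.mkQ z = 0 := by simpa using hzW
          rw [← this, hz, map_zero] at hx
          exact hz0 hx.symm
      apply hD0 _ h1
      have := congrArg (fun f => f b) h0
      simpa [Matrix.vecCons] using this
    · intro v hv
      have hv' : ∀ i, ∃ u ∈ M, W.mkQ u = v i := fun i => Finset.mem_image.1 (hv i)
      choose u hu huv using hv'
      obtain ⟨k, hk, hk3⟩ := hD (Fin.cons z u) (by
        intro i
        refine Fin.cases ?_ (fun i => ?_) i
        · exact hz
        · exact hMS (hu i))
      refine ⟨k, ?_, hk3⟩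
      rw [← hk]
      have := D.map_add_shift (Fin.cons z u) (Fin.cons 0 (fun i => s (v i) - u i)) {0}
        (by simp) (by
          intro i hi
          obtain ⟨j, rfl⟩ := Fin.exists_succ_eq.2 (by simpa using hi)
          simp only [Set.image_singleton, Fin.cons_zero, Fin.cons_succ]
          have : W.mkQ (s (v j)) = W.mkQ (u j) := by rw [hs', huv]
          exact (Submodule.Quotient.eq W).1 this)
      rw [← this]
      simp only [AlternatingMap.compLinearMap_apply, AlternatingMap.curryLeft_apply_apply]
      congr 1
      funext i
      refine Fin.cases ?_ (fun i => ?_) i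
      · simp
      · simp [Matrix.vecCons]

end ThreeModular

/-- It suffices to prove the bound for sets without gain. -/
theorem card_le_of_noGain_bound {r₁ : ℕ} (hr₁ : 1 ≤ r₁)
    (hZ : ∀ (V : Type) [AddCommGroup V] [Module ℚ V] [FiniteDimensional ℚ V] (S : Finset V),
      ThreeModular S → NoGain S → r₁ ≤ finrank ℚ V →
      S.card ≤ finrank ℚ V * (finrank ℚ V + 1) + 4 * (finrank ℚ V - 1))
    (V : Type) [AddCommGroup V] [Module ℚ V] [FiniteDimensional ℚ V] (S : Finset V)
    (hS : ThreeModular S) (hr : r₁ + 7 ^ r₁ ≤ finrank ℚ V) :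
    S.card ≤ finrank ℚ V * (finrank ℚ V + 1) + 4 * (finrank ℚ V - 1) := by
  have key : ∀ s : ℕ, ∀ (V : Type) [AddCommGroup V] [Module ℚ V] [FiniteDimensional ℚ V]
      (S : Finset V), ThreeModular S → finrank ℚ V = r₁ + s →
      S.card ≤ finrank ℚ V * (finrank ℚ V + 1) + 4 * (finrank ℚ V - 1) + (7 ^ r₁ - s) := by
    intro s
    induction s with
    | zero =>
      intro V _ _ _ S hS h
      have := hS.card_le
      rw [h] at this ⊢
      simp only [Nat.add_zero, Nat.sub_zero] at this ⊢
      omega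
    | succ s ih =>
      intro V _ _ _ S hS h
      by_cases hN : NoGain S
      · have := hZ V S hS hN (by omega)
        omega
      · simp only [NoGain] at hN
        push Not at hN
        obtain ⟨z, hz, R, hR, hneg, hfree, hpar, hlt⟩ := hN
        obtain ⟨S', hS', hcard⟩ := hS.exists_contraction hz hR hneg hfree hpar
        have hrank : finrank ℚ (V ⧸ Submodule.span ℚ {z}) + 1 = finrank ℚ V := by
          have := Submodule.finrank_quotient_add_finrank (Submodule.span ℚ {z})
          rwa [finrank_span_singleton (hS.ne_zero z hz)] at this
        have hq : finrank ℚ (V ⧸ Submodule.span ℚ {z}) = r₁ + s := by omega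
        have := ih _ S' hS' hq
        rw [hq] at this
        rw [h] at hlt ⊢
        obtain ⟨m, rfl⟩ : ∃ m, r₁ = m + 1 := ⟨r₁ - 1, by omega⟩
        have e1 : m + 1 + s - 1 = m + s := by omega
        have e2 : m + 1 + (s + 1) - 1 = m + s + 1 := by omega
        rw [e1] at this
        rw [e2]
        have e3 : (m + 1 + (s + 1)) * (m + 1 + (s + 1) + 1)
          = (m + 1 + s) * (m + 1 + s + 1) + 2 * (m + 1 + s + 1) := by ring
        rw [e3]
        omega
  obtain ⟨s, hs⟩ : ∃ s, finrank ℚ V = r₁ + s :=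
    ⟨finrank ℚ V - r₁, by have := Nat.le_of_add_right_le hr; omega⟩
  have := key s V S hS hs
  have h0 : 7 ^ r₁ - s = 0 := by omega
  rwa [h0, Nat.add_zero] at this

/-- In the absence of gain, every element of `S` lies in many triangles. The sets `O` and `E` are
the elements lying in large parallel classes modulo `z`, and the others. -/
theorem exists_triangles {V : Type*} [AddCommGroup V] [Module ℚ V] {S : Finset V}
    (hN : NoGain S) {z : V} (hz : z ∈ S) (hz0 : z ≠ 0) {O E : Finset V} (hO : O ⊆ S) (hE : E ⊆ S)
    (hOneg : ∀ u ∈ O, -u ∈ O) (hEneg : ∀ u ∈ E, -u ∈ E)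
    (hOfree : ∀ u ∈ O, u ∉ Submodule.span ℚ {z}) (hEfree : ∀ u ∈ E, u ∉ Submodule.span ℚ {z})
    (hOpar : ∀ u ∈ O, ∀ v ∈ O, ∀ c : ℚ, v - c • u ∈ Submodule.span ℚ {z} →
      v = u ∨ v = -u ∨ v = u + z ∨ v = u - z ∨ v = -u + z ∨ v = -u - z)
    (hEpar : ∀ u ∈ E, ∀ v ∈ E, ∀ c : ℚ, v - c • u ∈ Submodule.span ℚ {z} → v = u ∨ v = -u)
    (hcross : ∀ u ∈ O, ∀ v ∈ E, ∀ c : ℚ, v - c • u ∉ Submodule.span ℚ {z}) {e : ℕ}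
    (hcard : S.card ≤ O.card + E.card + e) :
    ∃ T ⊆ O, (∀ t ∈ T, t - z ∈ O) ∧
      (∀ t ∈ T, ∀ t' ∈ T, ∀ c : ℚ, t' - c • t ∈ Submodule.span ℚ {z} → t' = t) ∧
      2 * (finrank ℚ V + 2) ≤ 2 * T.card + e := by
  classical
  set W := Submodule.span ℚ {z} with hW
  have hzW : z ∈ W := Submodule.mem_span_singleton_self z
  have half : ∀ x : V, x + x ∈ W → x ∈ W := by
    intro x hx
    have := W.smul_mem (1 / 2 : ℚ) hx
    have e : (1 / 2 : ℚ) • (x + x) = x := by module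
    rwa [e] at this
  have half0 : ∀ x : V, x + x = 0 → x = 0 := by
    intro x hx
    have e : x = (1 / 2 : ℚ) • (x + x) := by module
    rw [e, hx, smul_zero]
  obtain ⟨R, hRO, -, hRneg, hRpar, hcov⟩ := exists_maximal_nonparallel W
    (O := O) (R := ∅) hOneg hOfree (by simp) (by simp) (by simp)
  have hno2 : ∀ w, w - z ∈ R → w + z ∈ R → False := by
    intro w h1 h2
    rcases hRpar _ h1 _ h2 1 (by
      have : w + z - (1 : ℚ) • (w - z) = (2 : ℚ) • z := by module
      rw [this]; exact W.smul_mem _ hzW) with h | h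
    · apply hz0; apply half0
      have : z + z = (w + z) - (w - z) := by abel
      rw [this, h, sub_self]
    · apply hOfree _ (hRO h1)
      have h0 : w = 0 := by
        apply half0
        have : w + w = (w + z) + (w - z) := by abel
        rw [this, h]; simp
      rw [h0, zero_sub]; exact W.neg_mem hzW
  have hN1 : ∀ w ∈ O, w ∉ R → w - z ∈ R ∨ w + z ∈ R := by
    intro w hw hwR
    obtain ⟨u, hu, c, hc⟩ := hcov w hw
    rcases hOpar u (hRO hu) w hw c hc with rfl | rfl | rfl | rfl | rfl | rfl
    · exact absurd hu hwR
    · exact absurd (hRneg _ hu) hwR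
    · left; simpa using hu
    · right; simpa using hu
    · left; simpa using hRneg _ hu
    · right; simpa using hRneg _ hu
  refine ⟨(O \ R).filter (fun w => w - z ∈ R), ?_, ?_, ?_, ?_⟩
  · intro w hw
    simp only [Finset.mem_filter, Finset.mem_sdiff] at hw
    exact hw.1.1
  · intro w hw
    exact hRO (Finset.mem_filter.1 hw).2
  · intro t ht t' ht' c hc
    simp only [Finset.mem_filter, Finset.mem_sdiff] at ht ht'
    rcases hRpar _ ht.2 _ ht'.2 c (by
      have : t' - z - c • (t - z) = (t' - c • t) + (c - 1) • z := by module
      rw [this]; exact W.add_mem hc (W.smul_mem _ hzW)) with h | h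
    · exact sub_left_injective h
    · exfalso
      have ht2 : t' = -t + (z + z) := by
        have : t' = (t' - z) + z := by abel
        rw [this, h]; abel
      have htW : ∀ x ∈ W, t + t = x → False := fun x hx h =>
        hOfree t ht.1.1 (half t (h ▸ hx))
      have hzz : z + z ∈ W := W.add_mem hzW hzW
      rcases hOpar t ht.1.1 t' ht'.1.1 c hc with h | h | h | h | h | h <;> rw [ht2] at h
      · exact htW (z + z) hzz (by linear_combination (norm := module) -h)
      · exact hz0 (half0 z (by linear_combination (norm := module) h))
      · exact htW z hzW (by linear_combination (norm := module) -h)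
      · exact htW (z + z + z) (W.add_mem hzz hzW) (by linear_combination (norm := module) -h)
      · exact hz0 (by linear_combination (norm := module) h)
      · exact hz0 (half0 z (half0 _ (by
          have : z + z + z = 0 := by linear_combination (norm := module) h
          exact absurd (by
            have e : z = (1 / 3 : ℚ) • (z + z + z) := by module
            rw [e, this, smul_zero]) hz0)))
  · set T := (O \ R).filter (fun w => w - z ∈ R) with hT
    have h1 : (O \ R).card ≤ 2 * T.card := by
      have : O \ R ⊆ T ∪ T.image (fun x => -x) := by
        intro w hw
        simp only [Finset.mem_sdiff] at hw
        simp only [hT, Finset.mem_union, Finset.mem_image, Finset.mem_filter, Finset.mem_sdiff]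
        rcases hN1 w hw.1 hw.2 with h | h
        · exact Or.inl ⟨hw, h⟩
        · refine Or.inr ⟨-w, ⟨⟨hOneg _ hw.1, fun h' => hw.2 (by simpa using hRneg _ h')⟩, ?_⟩,
            by simp⟩
          have := hRneg _ h
          rwa [neg_add'] at this
      have h2 := (Finset.card_le_card this).trans (Finset.card_union_le _ _)
      have h3 : (T.image (fun x => -x)).card ≤ T.card := Finset.card_image_le
      omega
    have h2 : O.card = R.card + (O \ R).card := by
      have := Finset.card_sdiff_add_card_eq_card hRO
      omega
    have hdisj : Disjoint R E := by
      rw [Finset.disjoint_left]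
      intro u hu huE
      exact hcross u (hRO hu) u huE 1 (by simp)
    have h3 := hN z hz (R ∪ E) (Finset.union_subset (hRO.trans hO) hE)
      (by
        intro u hu
        rcases Finset.mem_union.1 hu with h | h
        · exact Finset.mem_union_left _ (hRneg u h)
        · exact Finset.mem_union_right _ (hEneg u h))
      (by
        intro u hu
        rcases Finset.mem_union.1 hu with h | h
        · exact hOfree u (hRO h)
        · exact hEfree u h)
      (by
        intro u hu v hv c hc
        rcases Finset.mem_union.1 hu with hu | hu <;> rcases Finset.mem_union.1 hv with hv | hv
        · exact hRpar u hu v hv c hc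
        · exact absurd hc (hcross u (hRO hu) v hv c)
        · by_cases h0 : c = 0
          · subst h0
            exact absurd (by simpa using hc) (hOfree v (hRO hv))
          · refine absurd ?_ (hcross v (hRO hv) u hu c⁻¹)
            have := W.smul_mem (-c⁻¹) hc
            rw [smul_sub, smul_smul, neg_mul, inv_mul_cancel₀ h0] at this
            convert this using 1
            module
        · exact hEpar u hu v hv c hc)
    rw [Finset.card_union_of_disjoint hdisj] at h3
    omega

end

section

open Module

section IndepMod

variable {V ι : Type*} [AddCommGroup V] [Module ℚ V]

/-- The vectors `σ t`, `t ∈ T`, are linearly independent modulo the subspace `F`. -/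
def IndepMod (F : Submodule ℚ V) (T : Finset ι) (σ : ι → V) : Prop :=
  ∀ c : ι → ℚ, ∑ t ∈ T, c t • σ t ∈ F → ∀ t ∈ T, c t = 0

theorem IndepMod.mono {F : Submodule ℚ V} {T T' : Finset ι} {σ : ι → V} (h : IndepMod F T σ)
    (hT : T' ⊆ T) : IndepMod F T' σ := by
  classical
  intro c hc t ht
  have := h (fun t => if t ∈ T' then c t else 0) (by
    have e : ∑ t ∈ T, (if t ∈ T' then c t else 0) • σ t = ∑ t ∈ T', c t • σ t := by
      rw [← Finset.sum_subset hT]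
      · exact Finset.sum_congr rfl fun t ht => by simp [ht]
      · intro x _ hx; simp [hx]
    rwa [e]) t (hT ht)
  simpa [ht] using this

theorem IndepMod.shift {F : Submodule ℚ V} {T : Finset ι} {σ τ : ι → V} (h : IndepMod F T σ)
    (hτ : ∀ t ∈ T, τ t - σ t ∈ F) : IndepMod F T τ := by
  intro c hc
  refine h c ?_
  have e : ∑ t ∈ T, c t • σ t = ∑ t ∈ T, c t • τ t - ∑ t ∈ T, c t • (τ t - σ t) := by
    rw [← Finset.sum_sub_distrib]
    exact Finset.sum_congr rfl fun t _ => by module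
  rw [e]
  exact F.sub_mem hc (F.sum_mem fun t ht => F.smul_mem _ (hτ t ht))

theorem IndepMod.notMem {F : Submodule ℚ V} {T : Finset ι} {σ : ι → V} (h : IndepMod F T σ)
    {t : ι} (ht : t ∈ T) : σ t ∉ F := by
  classical
  intro hF
  have := h (Pi.single t 1) (by
    rw [Finset.sum_eq_single t]
    · simpa using hF
    · intro b _ hb; simp [hb]
    · exact fun h => absurd ht h) t ht
  simp at this

theorem IndepMod.injOn {F : Submodule ℚ V} {T : Finset ι} {σ : ι → V} (h : IndepMod F T σ) :
    Set.InjOn σ T := by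
  classical
  intro s hs t ht hst
  by_contra hne
  have := h (Pi.single s 1 - Pi.single t 1) (by
    rw [← Finset.sum_subset (s₁ := {s, t})]
    · rw [Finset.sum_pair hne]
      simp [hne, Ne.symm hne, hst]
    · intro x hx
      rcases Finset.mem_insert.1 hx with rfl | hx
      · exact hs
      · rw [Finset.mem_singleton.1 hx]; exact ht
    · intro x _ hx
      simp only [Finset.mem_insert, Finset.mem_singleton, not_or] at hx
      simp [hx.1, hx.2]) s hs
  simp [hne] at this

theorem IndepMod.image [DecidableEq V] {F : Submodule ℚ V} {T : Finset ι} {σ : ι → V}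
    (h : IndepMod F T σ) : IndepMod F (T.image σ) id := by
  intro c hc t ht
  obtain ⟨s, hs, rfl⟩ := Finset.mem_image.1 ht
  rw [Finset.sum_image h.injOn] at hc
  exact h (fun s => c (σ s)) hc s hs

theorem IndepMod.insert [DecidableEq ι] {F : Submodule ℚ V} {T : Finset ι} {σ : ι → V}
    (h : IndepMod F T σ) {s : ι} (hs : σ s ∉ F ⊔ Submodule.span ℚ (σ '' (T : Set ι))) :
    IndepMod F (insert s T) σ := by
  have hsT : s ∉ T := fun hsT =>
    hs (Submodule.mem_sup_right (Submodule.subset_span ⟨s, hsT, rfl⟩))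
  intro c hc
  rw [Finset.sum_insert hsT] at hc
  have hsum : ∑ t ∈ T, c t • σ t ∈ Submodule.span ℚ (σ '' (T : Set ι)) :=
    Submodule.sum_mem _ fun t ht =>
      Submodule.smul_mem _ _ (Submodule.subset_span ⟨t, ht, rfl⟩)
  have h0 : c s = 0 := by
    by_contra h0
    apply hs
    have : c s • σ s ∈ F ⊔ Submodule.span ℚ (σ '' (T : Set ι)) := by
      have := Submodule.sub_mem _ (Submodule.mem_sup_left hc :
        _ ∈ F ⊔ Submodule.span ℚ (σ '' (T : Set ι))) (Submodule.mem_sup_right hsum)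
      simpa using this
    exact (Submodule.smul_mem_iff _ h0).1 this
  rw [h0, zero_smul, zero_add] at hc
  intro t ht
  rcases Finset.mem_insert.1 ht with rfl | ht
  · exact h0
  · exact h c hc t ht

theorem LinearIndepOn.union_indepMod [DecidableEq V] {Y T : Finset V}
    (hY : LinearIndepOn ℚ id (Y : Set V))
    (hT : IndepMod (Submodule.span ℚ (Y : Set V)) T id) :
    Disjoint Y T ∧ LinearIndepOn ℚ id ((Y ∪ T : Finset V) : Set V) := by
  have hd : Disjoint Y T := Finset.disjoint_left.2 fun x hx hxT =>
    hT.notMem hxT (Submodule.subset_span hx)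
  refine ⟨hd, ?_⟩
  rw [linearIndepOn_finset_iff] at hY ⊢
  intro c hc
  rw [Finset.sum_union hd] at hc
  have hYm : ∑ t ∈ Y, c t • id t ∈ Submodule.span ℚ (Y : Set V) :=
    Submodule.sum_mem _ fun t ht => Submodule.smul_mem _ _ (Submodule.subset_span ht)
  have h1 : ∀ t ∈ T, c t = 0 := by
    apply hT c
    rw [eq_neg_of_add_eq_zero_right hc]
    exact Submodule.neg_mem _ hYm
  have h2 : ∑ t ∈ T, c t • id t = 0 := Finset.sum_eq_zero fun t ht => by simp [h1 t ht]
  rw [h2, add_zero] at hc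
  intro t ht
  rcases Finset.mem_union.1 ht with h | h
  · exact hY c hc t h
  · exact h1 t h

theorem LinearIndepOn.indepMod_of_union [DecidableEq V] {Y T : Finset V} (hd : Disjoint Y T)
    (h : LinearIndepOn ℚ id ((Y ∪ T : Finset V) : Set V)) :
    IndepMod (Submodule.span ℚ (Y : Set V)) T id := by
  intro c hc t ht
  rw [linearIndepOn_finset_iff] at h
  obtain ⟨a, -, ha⟩ := Submodule.mem_span_finset.1 hc
  have := h (fun t => if t ∈ Y then -a t else c t) (by
    rw [Finset.sum_union hd]
    have e1 : ∑ i ∈ Y, (if i ∈ Y then -a i else c i) • id i = -∑ i ∈ Y, a i • i := by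
      rw [← Finset.sum_neg_distrib]
      exact Finset.sum_congr rfl fun t ht => by simp [ht]
    have e2 : ∑ i ∈ T, (if i ∈ Y then -a i else c i) • id i = ∑ i ∈ T, c i • id i :=
      Finset.sum_congr rfl fun t ht => by simp [Finset.disjoint_right.1 hd ht]
    rw [e1, e2, ha]; simp) t (Finset.mem_union_right _ ht)
  simpa [Finset.disjoint_right.1 hd ht] using this

/-- Extension of a family independent modulo `F` inside a finite set. -/
theorem IndepMod.exists_extension [DecidableEq ι] {F : Submodule ℚ V} {T C : Finset ι} {σ : ι → V}
    (h : IndepMod F T σ) (hC : T ⊆ C) :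
    ∃ B, T ⊆ B ∧ B ⊆ C ∧ IndepMod F B σ ∧
      ∀ x ∈ C, σ x ∈ F ⊔ Submodule.span ℚ (σ '' (B : Set ι)) := by
  classical
  obtain ⟨B, hB, hmax⟩ := Finset.exists_max_image
    (C.powerset.filter fun B => T ⊆ B ∧ IndepMod F B σ) Finset.card
    ⟨T, by simp [hC]; exact h⟩
  simp only [Finset.mem_filter, Finset.mem_powerset] at hB hmax
  refine ⟨B, hB.2.1, hB.1, hB.2.2, fun x hx => ?_⟩
  by_contra hcon
  have hxB : x ∉ B := fun hxB =>
    hcon (Submodule.mem_sup_right (Submodule.subset_span ⟨x, hxB, rfl⟩))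
  have := hmax (Insert.insert x B) ⟨Finset.insert_subset hx hB.1,
    hB.2.1.trans (Finset.subset_insert _ _), hB.2.2.insert hcon⟩
  rw [Finset.card_insert_of_notMem hxB] at this
  omega

theorem mem_sup_span_finset {F : Submodule ℚ V} {B : Finset ι} {σ : ι → V} {x : V}
    (hx : x ∈ F ⊔ Submodule.span ℚ (σ '' (B : Set ι))) :
    ∃ c : ι → ℚ, x - ∑ t ∈ B, c t • σ t ∈ F := by
  obtain ⟨f, hf, g, hg, rfl⟩ := Submodule.mem_sup.1 hx
  obtain ⟨c, rfl⟩ := (Submodule.mem_span_image_finset_iff_exists_fun' ℚ).1 hg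
  exact ⟨c, by simpa using hf⟩

end IndepMod

namespace ThreeModular

variable {V : Type*} [AddCommGroup V] [Module ℚ V] [FiniteDimensional ℚ V] {S : Finset V}

/-- Coordinates with respect to a basis of the form `Y ∪ σ T`, where `σ` shifts the elements of
`T` by elements of the span of `Y`, have a common denominator. -/
theorem exists_detMod (hS : ThreeModular S) {Y T : Finset V} (hYS : Y ⊆ S) (hTS : T ⊆ S)
    (hY : LinearIndepOn ℚ id (Y : Set V)) (hT : IndepMod (Submodule.span ℚ (Y : Set V)) T id) :
    ∃ d : ℚ, d ≠ 0 ∧ ∀ σ : V → V, (∀ t ∈ T, σ t ∈ S) →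
      (∀ t ∈ T, σ t - t ∈ Submodule.span ℚ (Y : Set V)) → ∀ y ∈ S, ∀ a b : V → ℚ,
      y = ∑ t ∈ T, a t • σ t + ∑ s ∈ Y, b s • s →
      (∀ t ∈ T, ∃ k : ℤ, a t * d = k ∧ |k| ≤ 3) ∧ ∀ s ∈ Y, ∃ k : ℤ, b s * d = k ∧ |k| ≤ 3 := by
  classical
  obtain ⟨hdis, hi⟩ := LinearIndepOn.union_indepMod hY hT
  obtain ⟨d, hd, h⟩ := hS.exists_det (Finset.union_subset hYS hTS) hi
  refine ⟨d, hd, fun σ hσS hσ y hy a b hab => ?_⟩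
  have hnT : ∀ t ∈ T, t ∉ Y := fun t ht => Finset.disjoint_right.1 hdis ht
  have key := fun z hz => h Y Finset.subset_union_left z hz (fun t => if t ∈ Y then t else σ t)
    (fun t ht => by simp [ht])
    (fun t ht => by
      by_cases htY : t ∈ Y
      · simp [htY]
      · simpa [htY] using hσ t ((Finset.mem_union.1 ht).resolve_left htY))
    (fun t ht => by
      by_cases htY : t ∈ Y
      · simpa [htY] using hYS htY
      · simpa [htY] using hσS t ((Finset.mem_union.1 ht).resolve_left htY))
    y hy (fun t => if t ∈ Y then b t else a t) (by
      rw [Finset.sum_union hdis, hab, add_comm]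
      congr 1
      · exact Finset.sum_congr rfl fun t ht => by simp [ht]
      · exact Finset.sum_congr rfl fun t ht => by simp [hnT t ht])
  constructor
  · intro t ht
    simpa [hnT t ht] using key t (Finset.mem_union_right _ ht)
  · intro t ht
    simpa [ht] using key t (Finset.mem_union_left _ ht)

end ThreeModular

/-- Some element of `S` has a coordinate other than `0, 1, -1` with respect to `Y`. -/
def HasBadCoord {V : Type*} [AddCommGroup V] [Module ℚ V] (S Y : Finset V) : Prop :=
  ∃ y ∈ S, ∃ c : V → ℚ, y = ∑ t ∈ Y, c t • t ∧ ∃ t ∈ Y, c t ≠ 0 ∧ c t ≠ 1 ∧ c t ≠ -1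

/-- Modulo `F`, all coordinates of elements of `S` with respect to independent families in `S`
are `0, 1, -1`. -/
def UniMod {V : Type*} [AddCommGroup V] [Module ℚ V] (S : Finset V) (F : Submodule ℚ V) : Prop :=
  ∀ (T : Finset V) (σ : V → V), (∀ t ∈ T, σ t ∈ S) → IndepMod F T σ → ∀ z ∈ S, ∀ a : V → ℚ,
    z - ∑ t ∈ T, a t • σ t ∈ F → ∀ t ∈ T, a t = 0 ∨ a t = 1 ∨ a t = -1

theorem int_rank_one_minor {p q r s : ℤ} (hp : |p| ≤ 3) (hq : |q| ≤ 3) (hr : |r| ≤ 3)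
    (hs : |s| ≤ 3) (hp0 : p ≠ 0) (hq0 : q ≠ 0) (h : p * s = q * r) (hqp : q ≠ p) (hqp' : q ≠ -p) :
    r = 0 ∨ r = p ∨ r = -p := by
  rw [abs_le] at hp hq hr hs
  obtain ⟨hp1, hp2⟩ := hp
  obtain ⟨hq1, hq2⟩ := hq
  obtain ⟨hr1, hr2⟩ := hr
  obtain ⟨hs1, hs2⟩ := hs
  interval_cases p <;> interval_cases q <;> omega

theorem IndepMod.exists_image_coord {V : Type*} [AddCommGroup V] [Module ℚ V] [DecidableEq V]
    {F : Submodule ℚ V} {T : Finset V} {σ : V → V} (hi : IndepMod F T σ) (a : V → ℚ) :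
    ∃ a' : V → ℚ, ∑ x ∈ T.image σ, a' x • x = ∑ t ∈ T, a t • σ t ∧ ∀ t ∈ T, a' (σ t) = a t := by
  have hinj := hi.injOn
  have hinv : ∀ t ∈ T, Function.invFunOn σ T (σ t) = t := fun t ht =>
    hinj (Function.invFunOn_mem ⟨t, ht, rfl⟩) ht (Function.invFunOn_apply_eq (f := σ) ht)
  refine ⟨fun x => a (Function.invFunOn σ T x), ?_, fun t ht => by simp [hinv t ht]⟩
  rw [Finset.sum_image hinj]
  exact Finset.sum_congr rfl fun t ht => by simp only [hinv t ht]

theorem uniMod_of_set {V : Type*} [AddCommGroup V] [Module ℚ V] {S : Finset V}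
    {F : Submodule ℚ V}
    (h : ∀ T : Finset V, T ⊆ S → IndepMod F T id → ∀ z ∈ S, ∀ a : V → ℚ,
      z - ∑ t ∈ T, a t • t ∈ F → ∀ t ∈ T, a t = 0 ∨ a t = 1 ∨ a t = -1) : UniMod S F := by
  classical
  intro T σ hσ hi z hz a ha t ht
  obtain ⟨a', ha', ha2⟩ := hi.exists_image_coord a
  have := h (T.image σ) (fun x hx => by
    obtain ⟨s, hs, rfl⟩ := Finset.mem_image.1 hx
    exact hσ s hs) hi.image z hz a' (by rwa [ha']) (σ t) (Finset.mem_image_of_mem _ ht)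
  rwa [ha2 t ht] at this

theorem ThreeModular.uniMod_of_hasBadCoord {V : Type*} [AddCommGroup V] [Module ℚ V]
    [FiniteDimensional ℚ V] {S : Finset V} (hS : ThreeModular S) {Y : Finset V} (hYS : Y ⊆ S)
    (hY : LinearIndepOn ℚ id (Y : Set V)) (hbad : HasBadCoord S Y) :
    UniMod S (Submodule.span ℚ (Y : Set V)) := by
  classical
  apply uniMod_of_set
  intro T hTS hT z hz a ha t ht
  obtain ⟨y, hy, c, hyc, s, hs, hc0, hc1, hc2⟩ := hbad
  obtain ⟨b, -, hb⟩ := Submodule.mem_span_finset.1 ha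
  obtain ⟨hdis, hi⟩ := LinearIndepOn.union_indepMod hY hT
  obtain ⟨B, hB, hBS, hBi, -, hcard⟩ :=
    hS.exists_basis_extension (Finset.union_subset hYS hTS) hi
  obtain ⟨D, hD0, hD⟩ := hS.exists_form (ι := B) (by simpa using hcard)
  let v : B → V := fun t => t.1
  have hvS : ∀ i, v i ∈ S := fun i => hBS i.2
  have hnT : ∀ t ∈ T, t ∉ Y := fun t ht => Finset.disjoint_right.1 hdis ht
  let t' : B := ⟨t, hB (Finset.mem_union_right _ ht)⟩
  let s' : B := ⟨s, hB (Finset.mem_union_left _ hs)⟩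
  have hst : s' ≠ t' := fun h => hnT t ht (by
    have : s = t := congrArg Subtype.val h
    exact this ▸ hs)
  have expand : ∀ (w : B → V) (A : Finset V) (hA : A ⊆ B) (g : V → ℚ),
      (∀ i : B, i.1 ∈ A → w i = i.1) →
      ∑ i ∈ A, g i • i = ∑ j : B, (if j.1 ∈ A then g j.1 else 0) • w j := by
    intro w A hA g hw
    have e1 : ∑ j : B, (if j.1 ∈ A then g j.1 else 0) • w j
        = ∑ j : B, (if j.1 ∈ A then g j.1 else 0) • j.1 := by
      refine Finset.sum_congr rfl fun j _ => ?_
      by_cases h : j.1 ∈ A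
      · rw [hw j h]
      · simp [h]
    rw [e1, Finset.sum_coe_sort B (fun j => (if j ∈ A then g j else 0) • j),
      ← Finset.sum_subset hA]
    · exact Finset.sum_congr rfl fun i hi => by simp [hi]
    · intro x _ hx; simp [hx]
  have hz1 : D (Function.update v t' z) = a t * D v := by
    have : z = ∑ i ∈ Y ∪ T, (if i ∈ Y then b i else a i) • i := by
      rw [Finset.sum_union hdis]
      have e1 : ∑ i ∈ Y, (if i ∈ Y then b i else a i) • i = ∑ i ∈ Y, b i • i :=
        Finset.sum_congr rfl fun i hi => by simp [hi]
      have e2 : ∑ i ∈ T, (if i ∈ Y then b i else a i) • i = ∑ i ∈ T, a i • i :=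
        Finset.sum_congr rfl fun i hi => by simp [hnT i hi]
      rw [e1, e2, hb]; abel
    rw [this, expand v (Y ∪ T) hB _ (fun i _ => rfl), D.map_update_sum_smul]
    simp [t', ht, hnT t ht]
  have hy1 : ∀ w : B → V, (∀ i : B, i.1 ∈ Y → w i = i.1) →
      D (Function.update w s' y) = c s * D w := by
    intro w hw
    rw [hyc, expand w Y (Finset.subset_union_left.trans hB) _ hw, D.map_update_sum_smul]
    simp [s', hs]
  have hupd : ∀ (w : B → V) (i : B) (x : V), (∀ j, w j ∈ S) → x ∈ S →
      ∀ j, Function.update w i x j ∈ S := by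
    intro w i x hw hx j
    by_cases h : j = i
    · subst h; simpa using hx
    · simpa [h] using hw j
  obtain ⟨p, hp, hp3⟩ := hD v hvS
  obtain ⟨q, hq, hq3⟩ := hD _ (hupd v s' y hvS hy)
  obtain ⟨r, hr, hr3⟩ := hD _ (hupd v t' z hvS hz)
  obtain ⟨u, hu, hu3⟩ := hD _ (hupd _ s' y (hupd v t' z hvS hz) hy)
  rw [hy1 v (fun _ _ => rfl), hp] at hq
  rw [hz1, hp] at hr
  rw [hy1 _ (fun i hi => by
    have : i ≠ t' := fun h => hnT t ht (by
      have h2 : i.1 = t := congrArg Subtype.val h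
      exact h2 ▸ hi)
    simp [this, v]), hz1, hp, hr] at hu
  have hp0 : (p : ℚ) ≠ 0 := by rw [← hp]; exact hD0 v hBi
  have hpz : p ≠ 0 := by exact_mod_cast hp0
  have hq0 : q ≠ 0 := by
    have : (q : ℚ) ≠ 0 := by rw [← hq]; exact mul_ne_zero hc0 hp0
    exact_mod_cast this
  have hpu : p * u = q * r := by
    have : (p : ℚ) * u = q * r := by rw [← hu, ← hq]; ring
    exact_mod_cast this
  have h1 : q ≠ p := by
    rintro rfl
    exact hc1 (mul_right_cancel₀ hp0 (by rw [hq, one_mul]))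
  have h2 : q ≠ -p := by
    rintro rfl
    exact hc2 (mul_right_cancel₀ hp0 (by rw [hq]; push_cast; ring))
  rcases int_rank_one_minor hp3 hq3 hr3 hu3 hpz hq0 hpu h1 h2 with rfl | rfl | rfl
  · left
    rcases mul_eq_zero.1 (hr.trans (by simp)) with h | h
    · exact h
    · exact absurd h hp0
  · right; left
    exact mul_right_cancel₀ hp0 (by rw [hr, one_mul])
  · right; right
    exact mul_right_cancel₀ hp0 (by rw [hr]; push_cast; ring)

end

section

open Module

theorem nonparallel_of_coord {V : Type*} [AddCommGroup V] [Module ℚ V] {z u v : V}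
    (hv : v ∉ Submodule.span ℚ {z})
    (h : ∀ c d : ℚ, v = c • u + d • z → (c = 0 ∨ c = 1 ∨ c = -1) ∧ (d = 0 ∨ d = 1 ∨ d = -1))
    {c : ℚ} (hc : v - c • u ∈ Submodule.span ℚ {z}) :
    v = u ∨ v = -u ∨ v = u + z ∨ v = u - z ∨ v = -u + z ∨ v = -u - z := by
  obtain ⟨d, hd⟩ := Submodule.mem_span_singleton.1 hc
  have hvc : v = c • u + d • z := by rw [hd]; abel
  obtain ⟨h1, h2⟩ := h c d hvc
  rcases h1 with rfl | rfl | rfl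
  · exact absurd (by simpa using hc) hv
  · rcases h2 with rfl | rfl | rfl <;> rw [hvc]
    · left; module
    · right; right; left; module
    · right; right; right; left; module
  · rcases h2 with rfl | rfl | rfl <;> rw [hvc]
    · right; left; module
    · right; right; right; right; left; module
    · right; right; right; right; right; module

namespace ThreeModular

variable {V : Type*} [AddCommGroup V] [Module ℚ V] [FiniteDimensional ℚ V] {S : Finset V}

theorem card_add_card_le {Y T : Finset V} (hY : LinearIndepOn ℚ id (Y : Set V))
    (hT : IndepMod (Submodule.span ℚ (Y : Set V)) T id) : Y.card + T.card ≤ finrank ℚ V := by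
  classical
  obtain ⟨hd, hi⟩ := LinearIndepOn.union_indepMod hY hT
  rw [← Finset.card_union_of_disjoint hd, ← finrank_span_finset_eq_card hi]
  exact Submodule.finrank_le _

theorem eq_or_eq_neg_of_mem_span {V : Type*} [AddCommGroup V] [Module ℚ V]
    {S : Finset V} (hS : ThreeModular S) {z v : V} (hz : z ∈ S) (hv : v ∈ S)
    (h : v ∈ Submodule.span ℚ {z}) : v = z ∨ v = -z := by
  obtain ⟨c, rfl⟩ := Submodule.mem_span_singleton.1 h
  rcases hS.eq_or z hz c hv with rfl | rfl
  · left; simp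
  · right; simp

theorem exists_int_det {z : V} (hz : z ∈ S) (hS : ThreeModular S) {I : Finset V} (hI : I ⊆ S)
    (hi : IndepMod (Submodule.span ℚ {z}) I id) (hIz : ∀ t ∈ I, t - z ∈ S) {y : V} (hy : y ∈ S)
    (hyz : y - z ∈ S) {a : V → ℚ} {g : ℚ} (hya : y = ∑ t ∈ I, a t • t + g • z) :
    ∃ d : ℚ, d ≠ 0 ∧ (∀ t ∈ I, ∃ k : ℤ, a t * d = k) ∧
      ∀ A ⊆ I, |(g + ∑ t ∈ A, a t) * d| ≤ 3 ∧ |(g - 1 + ∑ t ∈ A, a t) * d| ≤ 3 := by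
  classical
  obtain ⟨d, hd, h⟩ := hS.exists_detMod (Y := {z}) (by simpa using hz) hI
    (by simpa using hS.ne_zero z hz) (by simpa using hi)
  have habs : ∀ q : ℚ, (∃ k : ℤ, q = k ∧ |k| ≤ 3) → |q| ≤ 3 := by
    rintro q ⟨k, rfl, hk⟩; exact_mod_cast hk
  refine ⟨d, hd, fun t ht => ?_, fun A hA => ?_⟩
  · obtain ⟨k, hk, -⟩ := (h id hI (by simp) y hy a (fun _ => g) (by simpa using hya)).1 t ht
    exact ⟨k, hk⟩
  · have hsum : ∑ t ∈ I, a t • (if t ∈ A then t - z else t)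
        = ∑ t ∈ I, a t • t - (∑ t ∈ A, a t) • z := by
      have : ∀ t ∈ I, a t • (if t ∈ A then t - z else t)
          = a t • t - (if t ∈ A then a t • z else 0) := by
        intro t _
        split_ifs
        · module
        · simp
      rw [Finset.sum_congr rfl this, Finset.sum_sub_distrib, ← Finset.sum_filter,
        Finset.filter_mem_eq_inter, Finset.inter_eq_right.2 hA, Finset.sum_smul]
    have key := fun y hy g' hg' => (h (fun t => if t ∈ A then t - z else t)
      (fun t ht => by
        split_ifs
        · exact hIz t ht
        · exact hI ht)
      (fun t ht => by
        split_ifs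
        · simp [Submodule.mem_span_singleton_self]
        · simp) y hy a (fun _ => g') hg').2 z (by simp)
    constructor
    · refine habs _ (key y hy _ ?_)
      rw [hsum, hya]; simp; module
    · refine habs _ (key (y - z) hyz _ ?_)
      rw [hsum, hya]; simp; module

end ThreeModular

theorem sum_filter_pos_sub_neg {ι : Type*} (I : Finset ι) (a : ι → ℚ) :
    ∑ t ∈ I.filter (fun t => 0 < a t), a t - ∑ t ∈ I.filter (fun t => a t < 0), a t
      = ∑ t ∈ I, |a t| := by
  rw [Finset.sum_filter, Finset.sum_filter, ← Finset.sum_sub_distrib]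
  refine Finset.sum_congr rfl fun t _ => ?_
  rcases lt_trichotomy (a t) 0 with h | h | h
  · rw [if_neg (by linarith), if_pos h, abs_of_neg h]; ring
  · simp [h]
  · rw [if_pos h, if_neg (by linarith), abs_of_pos h]; ring

namespace ThreeModular

variable {V : Type*} [AddCommGroup V] [Module ℚ V] [FiniteDimensional ℚ V] {S : Finset V}

theorem exists_hasBadCoord (hS : ThreeModular S) (hN : NoGain S) (hr : 0 < finrank ℚ V) :
    ∃ Y ⊆ S, LinearIndepOn ℚ id (Y : Set V) ∧ Y.card ≤ 6 ∧ HasBadCoord S Y := by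
  classical
  by_contra! hno
  have hno' : ∀ Y ⊆ S, LinearIndepOn ℚ id (Y : Set V) → Y.card ≤ 6 → ∀ y ∈ S, ∀ c : V → ℚ,
      y = ∑ t ∈ Y, c t • t → ∀ t ∈ Y, c t = 0 ∨ c t = 1 ∨ c t = -1 := by
    intro Y h1 h2 h3 y hy c hc t ht
    by_contra! h
    exact hno Y h1 h2 h3 ⟨y, hy, c, hc, t, ht, h⟩
  obtain ⟨z, hz⟩ : S.Nonempty := by
    by_contra h
    rw [Finset.not_nonempty_iff_eq_empty] at h
    have h1 := hS.span_eq
    rw [h, Finset.coe_empty, Submodule.span_empty] at h1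
    have : finrank ℚ V = 0 := by rw [← finrank_top ℚ V, ← h1, finrank_bot]
    omega
  set W := Submodule.span ℚ {z} with hW
  have hz0 := hS.ne_zero z hz
  have hzi : LinearIndepOn ℚ id (({z} : Finset V) : Set V) := by simpa using hz0
  have hshiftcoord : ∀ I ⊆ S, IndepMod W I id → I.card ≤ 5 → ∀ σ : V → V, (∀ t ∈ I, σ t ∈ S) →
      (∀ t ∈ I, σ t - t ∈ W) → ∀ y ∈ S, ∀ (a : V → ℚ) (g : ℚ), y = ∑ t ∈ I, a t • σ t + g • z →
      (∀ t ∈ I, a t = 0 ∨ a t = 1 ∨ a t = -1) ∧ (g = 0 ∨ g = 1 ∨ g = -1) := by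
    intro I hI hi hcard σ hσ hσW y hy a g hya
    have hiσ : IndepMod W I σ := hi.shift (by simpa using hσW)
    obtain ⟨a', ha', ha2⟩ := hiσ.exists_image_coord a
    have him := hiσ.image
    obtain ⟨hd, hli⟩ := LinearIndepOn.union_indepMod hzi (by simpa using him)
    have hcoord := hno' ({z} ∪ I.image σ) (by
        intro x hx
        simp only [Finset.mem_union, Finset.mem_singleton, Finset.mem_image] at hx
        rcases hx with rfl | ⟨t, ht, rfl⟩
        · exact hz
        · exact hσ t ht) hli (by
        refine (Finset.card_union_le _ _).trans ?_
        have := Finset.card_image_le (s := I) (f := σ)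
        simp; omega) y hy (fun x => if x = z then g else a' x) (by
        rw [Finset.sum_union hd, hya, ← ha', add_comm]
        congr 1
        · simp
        · refine Finset.sum_congr rfl fun x hx => ?_
          have : x ≠ z := by rintro rfl; simp [hx] at hd
          simp [this])
    constructor
    · intro t ht
      have htz : σ t ≠ z := by
        intro h
        have := Finset.disjoint_right.1 hd (Finset.mem_image_of_mem σ ht)
        simp [h] at this
      have := hcoord (σ t) (Finset.mem_union_right _ (Finset.mem_image_of_mem _ ht))
      simpa [htz, ha2 t ht] using this
    · simpa using hcoord z (by simp)
  have hsingle : ∀ u ∈ S, u ∉ W → IndepMod W {u} id := by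
    intro u _ huW c hc t ht
    rw [Finset.mem_singleton.1 ht]
    by_contra h0
    simp only [Finset.sum_singleton, id] at hc
    exact huW ((Submodule.smul_mem_iff _ h0).1 hc)
  obtain ⟨T, hTO, hTz, hTpar, hTcard⟩ := exists_triangles hN hz hz0
    (O := S.filter (· ∉ W)) (E := ∅) (e := 2) (Finset.filter_subset _ _) (by simp)
    (fun u hu => by
      simp only [Finset.mem_filter, neg_mem_iff] at hu ⊢
      exact ⟨hS.neg_mem u hu.1, hu.2⟩) (by simp)
    (fun u hu => (Finset.mem_filter.1 hu).2) (by simp)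
    (fun u hu v hv c hc => by
      simp only [Finset.mem_filter] at hu hv
      refine nonparallel_of_coord hv.2 (fun c d hcd => ?_) hc
      have := hshiftcoord {u} (by simpa using hu.1) (hsingle u hu.1 hu.2) (by simp) id
        (by simpa using hu.1) (by simp) v hv.1 (fun _ => c) d (by simpa using hcd)
      simpa using this)
    (by simp) (by simp)
    (by
      have hsub : S ⊆ S.filter (· ∉ W) ∪ {z, -z} := by
        intro x hx
        by_cases hxW : x ∈ W
        · have := hS.eq_or_eq_neg_of_mem_span hz hx hxW
          simp only [Finset.mem_union, Finset.mem_insert, Finset.mem_singleton]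
          tauto
        · simp [hx, hxW]
      have h1 := (Finset.card_le_card hsub).trans (Finset.card_union_le _ _)
      have h2 : ({z, -z} : Finset V).card ≤ 2 := Finset.card_le_two
      simp only [Finset.card_empty]
      omega)
  have hTS : T ⊆ S := fun t ht => (Finset.mem_filter.1 (hTO ht)).1
  have hTW : ∀ t ∈ T, t ∉ W := fun t ht => (Finset.mem_filter.1 (hTO ht)).2
  obtain ⟨T0, -, hT0T, hT0, hspan⟩ := IndepMod.exists_extension (F := W) (T := ∅) (C := T)
    (σ := id) (fun _ _ => by simp) (by simp)
  have hT0card := card_add_card_le hzi (by simpa using hT0)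
  simp only [Finset.card_singleton] at hT0card
  obtain ⟨s, hsT, hsT0⟩ : ∃ s ∈ T, s ∉ T0 := by
    by_contra! hcon
    have := Finset.card_le_card (show T ⊆ T0 from hcon)
    omega
  obtain ⟨a, ha⟩ := mem_sup_span_finset (hspan s hsT)
  obtain ⟨g, hg⟩ := Submodule.mem_span_singleton.1 ha
  set I := T0.filter (fun t => a t ≠ 0) with hI
  have hIT0 : I ⊆ T0 := Finset.filter_subset _ _
  have hsI : s = ∑ t ∈ I, a t • t + g • z := by
    have : ∑ t ∈ I, a t • t = ∑ t ∈ T0, a t • t := by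
      apply Finset.sum_subset hIT0
      intro x hx hxI
      have : a x = 0 := by by_contra h; exact hxI (Finset.mem_filter.2 ⟨hx, h⟩)
      simp [this]
    rw [this, hg]; simp
  have hIne : ∀ t ∈ I, a t ≠ 0 := fun t ht => (Finset.mem_filter.1 ht).2
  have hzW : z ∈ W := Submodule.mem_span_singleton_self z
  have hI2 : 2 ≤ I.card := by
    by_contra! hlt
    interval_cases h : I.card
    · rw [Finset.card_eq_zero.1 h] at hsI
      apply hTW s hsT
      rw [hsI]; simpa using W.smul_mem g hzW
    · obtain ⟨t, ht⟩ := Finset.card_eq_one.1 h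
      have htI : t ∈ I := by simp [ht]
      have := hTpar t (hT0T (hIT0 htI)) s hsT (a t) (by
        rw [ht] at hsI
        simp only [Finset.sum_singleton] at hsI
        have e : s - a t • t = g • z := by rw [sub_eq_iff_eq_add, add_comm]; exact hsI
        rw [e]; exact W.smul_mem g hzW)
      exact hsT0 (this ▸ hIT0 htI)
  have hIi : IndepMod W I id := hT0.mono hIT0
  have hIS : I ⊆ S := hIT0.trans (hT0T.trans hTS)
  have hIz : ∀ t ∈ I, t - z ∈ S := fun t ht =>
    (Finset.mem_filter.1 (hTz t (hT0T (hIT0 ht)))).1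
  have hsz : s - z ∈ S := (Finset.mem_filter.1 (hTz s hsT)).1
  obtain ⟨d, hd, hdi, hA⟩ := exists_int_det hz hS hIS hIi hIz (hTS hsT) hsz hsI
  have hsumabs := sum_filter_pos_sub_neg I a
  set P := ∑ t ∈ I.filter (fun t => 0 < a t), a t
  set N := ∑ t ∈ I.filter (fun t => a t < 0), a t
  have hI5 : I.card ≤ 5 := by
    have h1 := (hA _ (Finset.filter_subset (fun t => 0 < a t) I)).1
    have h2 := (hA _ (Finset.filter_subset (fun t => a t < 0) I)).2
    have h3 : (I.card : ℚ) ≤ (∑ t ∈ I, |a t|) * |d| := by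
      rw [Finset.sum_mul]
      have : ∀ t ∈ I, (1 : ℚ) ≤ |a t| * |d| := by
        intro t ht
        obtain ⟨k, hk⟩ := hdi t ht
        rw [← abs_mul, hk]
        have : (k : ℚ) ≠ 0 := by rw [← hk]; exact mul_ne_zero (hIne t ht) hd
        have hk0 : k ≠ 0 := by exact_mod_cast this
        exact_mod_cast Int.one_le_abs hk0
      simpa using Finset.sum_le_sum this
    have h4 : (P - N + 1) * |d| ≤ 6 := by
      have : (P - N + 1) * d = (g + P) * d - (g - 1 + N) * d := by ring
      have h5 : |(P - N + 1) * d| ≤ 6 := by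
        rw [this]
        exact (abs_sub _ _).trans (by linarith)
      rw [abs_mul] at h5
      exact (mul_le_mul_of_nonneg_right (le_abs_self _) (abs_nonneg d)).trans h5
    rw [hsumabs] at h4
    have h6 : 0 < |d| := abs_pos.2 hd
    have : (I.card : ℚ) < 6 := by nlinarith
    have : I.card < 6 := by exact_mod_cast this
    omega
  have hcoord : ∀ A ⊆ I, ∀ y ∈ S, ∀ g' : ℚ, y - s = (g' - g) • z →
      (∀ t ∈ I, a t = 0 ∨ a t = 1 ∨ a t = -1) ∧ |g' + ∑ t ∈ A, a t| ≤ 1 := by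
    intro A hAI y hy g' hys
    have hsum : ∑ t ∈ I, a t • (if t ∈ A then t - z else t)
        = ∑ t ∈ I, a t • t - (∑ t ∈ A, a t) • z := by
      have : ∀ t ∈ I, a t • (if t ∈ A then t - z else t)
          = a t • t - (if t ∈ A then a t • z else 0) := by
        intro t _
        split_ifs
        · module
        · simp
      rw [Finset.sum_congr rfl this, Finset.sum_sub_distrib, ← Finset.sum_filter,
        Finset.filter_mem_eq_inter, Finset.inter_eq_right.2 hAI, Finset.sum_smul]
    have := hshiftcoord I hIS hIi hI5 (fun t => if t ∈ A then t - z else t)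
      (fun t ht => by
        split_ifs
        · exact hIz t ht
        · exact hIS ht)
      (fun t ht => by
        split_ifs
        · simpa using hzW
        · simp) y hy a (g' + ∑ t ∈ A, a t) (by
        rw [hsum, ← sub_add_cancel y s, hys, hsI]; module)
    refine ⟨this.1, ?_⟩
    rcases this.2 with h | h | h <;> rw [h] <;> norm_num
  have h1 := hcoord _ (Finset.filter_subset (fun t => 0 < a t) I) s (hTS hsT) g (by simp)
  have h2 := hcoord _ (Finset.filter_subset (fun t => a t < 0) I) (s - z) hsz (g - 1) (by module)
  have h3 : ∑ t ∈ I, |a t| = I.card := by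
    have : ∀ t ∈ I, |a t| = 1 := by
      intro t ht
      rcases h1.1 t ht with h | h | h
      · exact absurd h (hIne t ht)
      · simp [h]
      · simp [h]
    rw [Finset.sum_congr rfl this]; simp
  have h4 : (2 : ℚ) ≤ I.card := by exact_mod_cast hI2
  have h5 := (abs_le.1 h1.2).2
  have h6 := (abs_le.1 h2.2).1
  linarith

end ThreeModular

end

section

open Module

section

variable {V : Type*} [AddCommGroup V] [Module ℚ V]

theorem indepMod_singleton {F : Submodule ℚ V} {z : V} (hz : z ∉ F) :
    IndepMod F ({z} : Finset V) id := by
  intro c hc t ht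
  rw [Finset.mem_singleton.1 ht]
  by_contra h0
  simp only [Finset.sum_singleton, id] at hc
  exact hz ((Submodule.smul_mem_iff _ h0).1 hc)

theorem indepMod_pair [DecidableEq V] {F : Submodule ℚ V} {z u : V} (hz : z ∉ F)
    (hu : u ∉ F ⊔ Submodule.span ℚ {z}) : IndepMod F ({u, z} : Finset V) id :=
  (indepMod_singleton hz).insert (by simpa using hu)

theorem HasBadCoord.mono {S Y Y' : Finset V} (h : HasBadCoord S Y) (hY : Y ⊆ Y') :
    HasBadCoord S Y' := by
  classical
  obtain ⟨y, hy, c, hc, t, ht, hct⟩ := h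
  refine ⟨y, hy, fun x => if x ∈ Y then c x else 0, ?_, t, hY ht, by simpa [ht] using hct⟩
  rw [hc, ← Finset.sum_subset hY]
  · exact Finset.sum_congr rfl fun x hx => by simp [hx]
  · intro x _ hx; simp [hx]

theorem UniMod.coord_pair {S : Finset V} {F : Submodule ℚ V} (hU : UniMod S F) {u v z : V}
    (hu : u ∈ S) (hv : v ∈ S) (hz : z ∈ S) (hzF : z ∉ F)
    (huF : u ∉ F ⊔ Submodule.span ℚ {z}) {c d : ℚ} (h : v - (c • u + d • z) ∈ F) :
    (c = 0 ∨ c = 1 ∨ c = -1) ∧ (d = 0 ∨ d = 1 ∨ d = -1) := by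
  classical
  have huz : u ≠ z := by
    rintro rfl
    exact huF (Submodule.mem_sup_right (Submodule.mem_span_singleton_self u))
  have := hU {u, z} id (by simp [hu, hz]) (indepMod_pair hzF huF) v hv
    (fun x => if x = u then c else d) (by
      rw [Finset.sum_pair huz]; simpa [huz.symm] using h)
  exact ⟨by simpa using this u (by simp), by simpa [huz.symm] using this z (by simp)⟩

end

/-- A vector of `S` outside `F` whose class modulo `F` contains a further element of `S`. -/
def Long {V : Type*} [AddCommGroup V] [Module ℚ V] (S : Finset V) (F : Submodule ℚ V)
    (w : V) : Prop :=
  w ∈ S ∧ w ∉ F ∧ ∃ f ∈ F, f ≠ 0 ∧ w + f ∈ S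

open Classical in
/-- Either `z` satisfies `G`, or `z` is in at least `K` ways a sum of two elements of `S`
satisfying `G`. -/
def Closure (K : ℕ) {V : Type*} [AddCommGroup V] (S : Finset V) (G : V → Prop) (z : V) : Prop :=
  G z ∨ K ≤ (S.filter fun t => z - t ∈ S ∧ G t ∧ G (z - t)).card

namespace ThreeModular

variable {V : Type*} [AddCommGroup V] [Module ℚ V] [FiniteDimensional ℚ V] {S : Finset V}

open Classical in
theorem card_long_le (hS : ThreeModular S) {Y T : Finset V} (hYS : Y ⊆ S) (hTS : T ⊆ S)
    (hY : LinearIndepOn ℚ id (Y : Set V)) (hT : IndepMod (Submodule.span ℚ (Y : Set V)) T id)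
    {z : V} (hz : z ∈ S) (hzT : z - ∑ t ∈ T, t ∈ Submodule.span ℚ (Y : Set V)) :
    (T.filter (Long S (Submodule.span ℚ (Y : Set V)))).card ≤ 6 * Y.card := by
  set F := Submodule.span ℚ (Y : Set V) with hF
  set T' := T.filter (Long S F) with hT'
  obtain ⟨d, hd, h⟩ := hS.exists_detMod hYS hTS hY hT
  obtain ⟨b, -, hb⟩ := Submodule.mem_span_finset.1 hzT
  have hex : ∀ t : V, ∃ φ : V → ℚ, t ∈ T' →
      t + ∑ s ∈ Y, φ s • s ∈ S ∧ ∑ s ∈ Y, φ s • s ≠ 0 := by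
    intro t
    by_cases ht : t ∈ T'
    · obtain ⟨-, -, f, hfF, hf0, hfS⟩ := (Finset.mem_filter.1 ht).2
      obtain ⟨φ, -, rfl⟩ := Submodule.mem_span_finset.1 hfF
      exact ⟨φ, fun _ => ⟨hfS, hf0⟩⟩
    · exact ⟨0, fun h => absurd h ht⟩
  choose φ hφ using hex
  have hmem : ∀ t, ∑ s ∈ Y, φ t s • s ∈ F := fun t =>
    Submodule.sum_mem _ fun s hs => Submodule.smul_mem _ _ (Submodule.subset_span hs)
  have h_int : ∀ t ∈ T', ∀ s ∈ Y, ∃ k : ℤ, φ t s * d = k := by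
    intro t ht s hs
    obtain ⟨k, hk, -⟩ := (h id (fun t ht => hTS ht) (by simp) _ (hφ t ht).1 (Pi.single t 1) (φ t)
      (by
        congr 1
        rw [Finset.sum_eq_single t]
        · simp
        · intro x _ hx; simp [hx]
        · intro h; exact absurd (Finset.mem_filter.1 ht).1 h)).2 s hs
    exact ⟨k, hk⟩
  have hrange : ∀ A ⊆ T', ∀ s ∈ Y, |(b s - ∑ t ∈ A, φ t s) * d| ≤ 3 := by
    intro A hA s hs
    have hAT : A ⊆ T := hA.trans (Finset.filter_subset _ _)
    obtain ⟨k, hk, hk3⟩ := (h (fun t => if t ∈ A then t + ∑ s ∈ Y, φ t s • s else t)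
      (fun t ht => by
        split_ifs with hA'
        · exact (hφ t (hA hA')).1
        · exact hTS ht)
      (fun t ht => by
        split_ifs with hA'
        · simpa using hmem t
        · simp) z hz (fun _ => 1) (fun s => b s - ∑ t ∈ A, φ t s) (by
        have e1 : ∑ t ∈ T, (1 : ℚ) • (if t ∈ A then t + ∑ s ∈ Y, φ t s • s else t)
            = ∑ t ∈ T, t + ∑ t ∈ A, ∑ s ∈ Y, φ t s • s := by
          have : ∀ t ∈ T, (1 : ℚ) • (if t ∈ A then t + ∑ s ∈ Y, φ t s • s else t)
              = t + (if t ∈ A then ∑ s ∈ Y, φ t s • s else 0) := by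
            intro t _
            split_ifs <;> simp
          rw [Finset.sum_congr rfl this, Finset.sum_add_distrib, ← Finset.sum_filter,
            Finset.filter_mem_eq_inter, Finset.inter_eq_right.2 hAT]
        have e2 : ∑ s ∈ Y, (b s - ∑ t ∈ A, φ t s) • s
            = ∑ s ∈ Y, b s • s - ∑ t ∈ A, ∑ s ∈ Y, φ t s • s := by
          rw [Finset.sum_comm, ← Finset.sum_sub_distrib]
          exact Finset.sum_congr rfl fun s _ => by rw [sub_smul, Finset.sum_smul]
        rw [e1, e2, hb]; abel)).2 s hs
    rw [hk]; exact_mod_cast hk3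
  have hsum : ∀ s ∈ Y, ∑ t ∈ T', |φ t s * d| ≤ 6 := by
    intro s hs
    have e := sum_filter_pos_sub_neg T' (fun t => φ t s * d)
    rw [← e]
    have h1 := hrange _ (Finset.filter_subset (fun t => 0 < φ t s * d) T') s hs
    have h2 := hrange _ (Finset.filter_subset (fun t => φ t s * d < 0) T') s hs
    rw [sub_mul, Finset.sum_mul] at h1 h2
    have := (abs_le.1 h1).1
    have := (abs_le.1 h2).2
    linarith
  have hone : ∀ t ∈ T', (1 : ℚ) ≤ ∑ s ∈ Y, |φ t s * d| := by
    intro t ht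
    obtain ⟨s, hs, hs0⟩ : ∃ s ∈ Y, φ t s ≠ 0 := by
      by_contra! hcon
      exact (hφ t ht).2 (Finset.sum_eq_zero fun s hs => by simp [hcon s hs])
    refine le_trans ?_ (Finset.single_le_sum (f := fun s => |φ t s * d|)
      (fun s _ => abs_nonneg _) hs)
    obtain ⟨k, hk⟩ := h_int t ht s hs
    have hk0 : k ≠ 0 := by
      have : (k : ℚ) ≠ 0 := by rw [← hk]; exact mul_ne_zero hs0 hd
      exact_mod_cast this
    simp only [hk]
    exact_mod_cast Int.one_le_abs hk0
  have h1 : (T'.card : ℚ) ≤ 6 * Y.card := by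
    calc (T'.card : ℚ) = ∑ t ∈ T', (1 : ℚ) := by simp
      _ ≤ ∑ t ∈ T', ∑ s ∈ Y, |φ t s * d| := Finset.sum_le_sum hone
      _ = ∑ s ∈ Y, ∑ t ∈ T', |φ t s * d| := Finset.sum_comm
      _ ≤ ∑ s ∈ Y, (6 : ℚ) := Finset.sum_le_sum hsum
      _ = 6 * Y.card := by simp [mul_comm]
  exact_mod_cast h1

/-- Few elements of `S` lie in the span of `Y` and a family independent modulo the span of `Y`. -/
theorem card_le_of_subset_sup_span (hS : ThreeModular S) {Y T : Finset V} (hYS : Y ⊆ S)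
    (hTS : T ⊆ S) (hY : LinearIndepOn ℚ id (Y : Set V))
    (hT : IndepMod (Submodule.span ℚ (Y : Set V)) T id) {W : Finset V} (hW : W ⊆ S)
    (hWY : ∀ w ∈ W, w ∈ Submodule.span ℚ (Y : Set V) ⊔ Submodule.span ℚ (T : Set V)) :
    W.card ≤ 7 ^ (Y.card + T.card) := by
  classical
  obtain ⟨hd, hi⟩ := LinearIndepOn.union_indepMod hY hT
  rw [← Finset.card_union_of_disjoint hd]
  apply hS.card_le_of_subset_span (Finset.union_subset hYS hTS) hi hW
  intro w hw
  rw [Finset.coe_union, Submodule.span_union]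
  exact hWY w hw

theorem exists_triangles_mod (hS : ThreeModular S) (hN : NoGain S) {Y : Finset V} (hYS : Y ⊆ S)
    (hY : LinearIndepOn ℚ id (Y : Set V)) (hU : UniMod S (Submodule.span ℚ (Y : Set V))) {z : V}
    (hz : z ∈ S) (hzF : z ∉ Submodule.span ℚ (Y : Set V)) :
    ∃ T ⊆ S, (∀ t ∈ T, t ∉ Submodule.span ℚ (Y : Set V) ⊔ Submodule.span ℚ {z}) ∧
      (∀ t ∈ T, t - z ∈ S) ∧
      (∀ t ∈ T, ∀ t' ∈ T, ∀ c : ℚ, t' - c • t ∈ Submodule.span ℚ {z} → t' = t) ∧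
      2 * (finrank ℚ V + 2) ≤ 2 * T.card + 7 ^ (Y.card + 1) := by
  classical
  set F := Submodule.span ℚ (Y : Set V) with hF
  set O := S.filter (· ∉ F ⊔ Submodule.span ℚ {z}) with hO
  have hmem : ∀ u, u ∈ O ↔ u ∈ S ∧ u ∉ F ⊔ Submodule.span ℚ {z} := by simp [hO]
  obtain ⟨T, hTO, hTz, hTpar, hTcard⟩ := exists_triangles hN hz (hS.ne_zero z hz)
    (O := O) (E := ∅) (e := 7 ^ (Y.card + 1)) (Finset.filter_subset _ _) (by simp)
    (fun u hu => by
      rw [hmem] at hu ⊢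
      exact ⟨hS.neg_mem u hu.1, fun h => hu.2 (by simpa using Submodule.neg_mem _ h)⟩) (by simp)
    (fun u hu h => ((hmem u).1 hu).2 (Submodule.mem_sup_right h)) (by simp)
    (fun u hu v hv c hc => by
      rw [hmem] at hu hv
      refine nonparallel_of_coord (fun h => hv.2 (Submodule.mem_sup_right h))
        (fun c d hcd => hU.coord_pair hu.1 hv.1 hz hzF hu.2 (by simp [hcd])) hc)
    (by simp) (by simp)
    (by
      have hsub : S ⊆ O ∪ S.filter (· ∈ F ⊔ Submodule.span ℚ {z}) := by
        intro x hx
        by_cases hxW : x ∈ F ⊔ Submodule.span ℚ {z}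
        · simp [hx, hxW]
        · exact Finset.mem_union_left _ ((hmem x).2 ⟨hx, hxW⟩)
      have h1 := (Finset.card_le_card hsub).trans (Finset.card_union_le _ _)
      have h2 := hS.card_le_of_subset_sup_span hYS (T := {z}) (by simpa using hz) hY
        (indepMod_singleton hzF) (W := S.filter (· ∈ F ⊔ Submodule.span ℚ {z}))
        (Finset.filter_subset _ _) (fun w hw => by simpa using (Finset.mem_filter.1 hw).2)
      simp only [Finset.card_singleton] at h2
      simp only [Finset.card_empty]
      omega)
  exact ⟨T, fun t ht => ((hmem t).1 (hTO ht)).1, fun t ht => ((hmem t).1 (hTO ht)).2,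
    fun t ht => ((hmem _).1 (hTz t ht)).1, hTpar, hTcard⟩

/-- Replacing an element of a representation by a sum of two elements of `S`. -/
theorem exists_split (hS : ThreeModular S) {Y T : Finset V} (hYS : Y ⊆ S)
    (hTS : T ⊆ S) (hY : LinearIndepOn ℚ id (Y : Set V))
    (hT : IndepMod (Submodule.span ℚ (Y : Set V)) T id) {t₀ : V} (ht₀ : t₀ ∈ T) {X : Finset V}
    (hXS : X ⊆ S) (hX : 7 ^ (Y.card + T.card) < X.card) (hXt : ∀ s ∈ X, t₀ - s ∈ S) :
    ∃ s ∈ X, ∃ T' ⊆ S, IndepMod (Submodule.span ℚ (Y : Set V)) T' id ∧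
      ∑ t ∈ T', t = ∑ t ∈ T, t ∧ T'.card = T.card + 1 ∧
      ∀ t, t ∈ T' ↔ t = s ∨ t = t₀ - s ∨ (t ∈ T ∧ t ≠ t₀) := by
  classical
  set F := Submodule.span ℚ (Y : Set V) with hF
  obtain ⟨s, hs, hsT⟩ : ∃ s ∈ X, s ∉ F ⊔ Submodule.span ℚ (T : Set V) := by
    by_contra! hcon
    have := hS.card_le_of_subset_sup_span hYS hTS hY hT hXS hcon
    omega
  have hspan : ∀ x ∈ T, x ∈ F ⊔ Submodule.span ℚ (T : Set V) := fun x hx =>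
    Submodule.mem_sup_right (Submodule.subset_span hx)
  have hsT0 : s ∉ T := fun h => hsT (hspan s h)
  have h1 : IndepMod F (insert s T) id := hT.insert (by simpa using hsT)
  have hts : t₀ - s ≠ s := by
    intro h
    apply hsT
    have e : s = (1 / 2 : ℚ) • t₀ := by
      have : t₀ = s + s := by rw [← sub_eq_iff_eq_add]; exact h
      rw [this]; module
    rw [e]
    exact Submodule.smul_mem _ _ (hspan t₀ ht₀)
  have htsT : t₀ - s ∉ T := by
    intro h
    apply hsT
    have := Submodule.sub_mem _ (hspan t₀ ht₀) (hspan _ h)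
    simpa using this
  have hs0 : s ≠ t₀ := fun h => hsT0 (h ▸ ht₀)
  refine ⟨s, hs, insert s (insert (t₀ - s) (T.erase t₀)), ?_, ?_, ?_, ?_, ?_⟩
  · intro x hx
    simp only [Finset.mem_insert, Finset.mem_erase] at hx
    rcases hx with rfl | rfl | hx
    · exact hXS hs
    · exact hXt s hs
    · exact hTS hx.2
  · intro c hc
    have hn1 : s ∉ insert (t₀ - s) (T.erase t₀) := by
      simp [hts.symm, hsT0]
    have hn2 : t₀ - s ∉ T.erase t₀ := by simp [htsT]
    rw [Finset.sum_insert hn1, Finset.sum_insert hn2] at hc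
    have key := h1 (fun x => if x = s then c s - c (t₀ - s) else if x = t₀ then c (t₀ - s) else c x)
      (by
        rw [Finset.sum_insert hsT0, ← Finset.add_sum_erase T _ ht₀]
        have e : ∑ x ∈ T.erase t₀, (if x = s then c s - c (t₀ - s) else
            if x = t₀ then c (t₀ - s) else c x) • id x = ∑ x ∈ T.erase t₀, c x • id x := by
          refine Finset.sum_congr rfl fun x hx => ?_
          have h1 : x ≠ s := by rintro rfl; exact hsT0 (Finset.mem_of_mem_erase hx)
          have h2 : x ≠ t₀ := Finset.ne_of_mem_erase hx
          simp [h1, h2]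
        rw [e]
        simp only [if_true, hs0.symm, if_false, id]
        simp only [id] at hc
        convert hc using 1
        module)
    have k1 : c (t₀ - s) = 0 := by
      simpa [hs0.symm] using key t₀ (Finset.mem_insert_of_mem ht₀)
    have k2 : c s = 0 := by
      simpa [k1] using key s (Finset.mem_insert_self _ _)
    intro t ht
    simp only [Finset.mem_insert, Finset.mem_erase] at ht
    rcases ht with rfl | rfl | ht
    · exact k2
    · exact k1
    · have h1 : t ≠ s := by rintro rfl; exact hsT0 ht.2
      simpa [h1, ht.1] using key t (Finset.mem_insert_of_mem ht.2)
  · rw [Finset.sum_insert, Finset.sum_insert, ← Finset.add_sum_erase T _ ht₀]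
    · abel
    · simp [htsT]
    · simp [hts.symm, hsT0]
  · rw [Finset.card_insert_of_notMem, Finset.card_insert_of_notMem, Finset.card_erase_of_mem ht₀]
    · have := Finset.card_pos.2 ⟨t₀, ht₀⟩
      omega
    · simp [htsT]
    · simp [hts.symm, hsT0]
  · intro t
    simp only [Finset.mem_insert, Finset.mem_erase]
    tauto

open Classical in
theorem exists_expand (hS : ThreeModular S) {Y : Finset V} (hYS : Y ⊆ S)
    (hY : LinearIndepOn ℚ id (Y : Set V)) {K : ℕ} {G : V → Prop} (n : ℕ) :
    ∀ T ⊆ S, IndepMod (Submodule.span ℚ (Y : Set V)) T id → (∀ t ∈ T, Closure K S G t) →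
      (T.filter fun t => ¬ G t).card = n → 7 ^ (Y.card + (T.card + n)) < K →
      ∃ T' ⊆ S, IndepMod (Submodule.span ℚ (Y : Set V)) T' id ∧ ∑ t ∈ T', t = ∑ t ∈ T, t ∧
        T.card ≤ T'.card ∧ T'.card ≤ T.card + n ∧ ∀ t ∈ T', G t := by
  induction n with
  | zero =>
    intro T hTS hT hG h0 _
    refine ⟨T, hTS, hT, rfl, le_rfl, by omega, fun t ht => ?_⟩
    by_contra hGt
    have : t ∈ T.filter fun t => ¬ G t := Finset.mem_filter.2 ⟨ht, hGt⟩
    rw [Finset.card_eq_zero.1 h0] at this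
    simp at this
  | succ n ih =>
    intro T hTS hT hG hn hK
    obtain ⟨t₀, ht₀⟩ := Finset.card_pos.1 (by omega : 0 < (T.filter fun t => ¬ G t).card)
    obtain ⟨ht₀T, ht₀G⟩ := Finset.mem_filter.1 ht₀
    have hmany := (hG t₀ ht₀T).resolve_left ht₀G
    have hpow : 7 ^ (Y.card + T.card) ≤ 7 ^ (Y.card + (T.card + (n + 1))) :=
      Nat.pow_le_pow_right (by norm_num) (by omega)
    obtain ⟨s, hs, T', hT'S, hT', hsum, hcard, hmem⟩ := hS.exists_split hYS hTS hY hT ht₀T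
      (Finset.filter_subset _ _) (lt_of_lt_of_le (lt_of_le_of_lt hpow hK) hmany)
      (fun s hs => (Finset.mem_filter.1 hs).2.1)
    obtain ⟨-, -, hGs, hGs'⟩ := Finset.mem_filter.1 hs
    have hfilter : T'.filter (fun t => ¬ G t) = (T.filter fun t => ¬ G t).erase t₀ := by
      ext t
      simp only [Finset.mem_filter, Finset.mem_erase, hmem]
      constructor
      · rintro ⟨rfl | rfl | h, hGt⟩
        · exact absurd hGs hGt
        · exact absurd hGs' hGt
        · exact ⟨h.2, h.1, hGt⟩
      · rintro ⟨h1, h2, h3⟩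
        exact ⟨Or.inr (Or.inr ⟨h2, h1⟩), h3⟩
    obtain ⟨T'', h1, h2, h3, h4, h5, h6⟩ := ih T' hT'S hT'
      (fun t ht => by
        rcases (hmem t).1 ht with rfl | rfl | h
        · exact Or.inl hGs
        · exact Or.inl hGs'
        · exact hG t h.1)
      (by rw [hfilter, Finset.card_erase_of_mem ht₀, hn]; simp)
      (by rw [hcard]; convert hK using 3; omega)
    exact ⟨T'', h1, h2, h3.trans hsum, by omega, by omega, h6⟩

/-- If the rank is large then some element of `S` outside the span of `Y` is not obtained from long
elements by iterated closure. -/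
theorem exists_not_closure (k : ℕ) : ∃ K₀ : ℕ, ∀ K, K₀ ≤ K → ∃ R : ℕ, ∀ {V : Type*}
    [AddCommGroup V] [Module ℚ V] [FiniteDimensional ℚ V] {S : Finset V}, ThreeModular S →
    NoGain S → ∀ Y ⊆ S, LinearIndepOn ℚ id (Y : Set V) → Y.card = k →
    UniMod S (Submodule.span ℚ (Y : Set V)) → R ≤ finrank ℚ V →
    ∃ z ∈ S, z ∉ Submodule.span ℚ (Y : Set V) ∧
      ¬ Closure K S (Closure K S (Long S (Submodule.span ℚ (Y : Set V)))) z := by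
  classical
  refine ⟨7 ^ (k + 8 * (6 * k + 1)) + 1, fun K hK => ⟨7 ^ (k + (6 * k + 1)) + 7 ^ (k + 1) + k + 1,
    ?_⟩⟩
  intro V _ _ _ S hS hN Y hYS hY hYk hU hR
  set F := Submodule.span ℚ (Y : Set V) with hF
  by_contra! hcon
  obtain ⟨z, hz, hzF⟩ : ∃ z ∈ S, z ∉ F := by
    by_contra! h
    have h1 : F = ⊤ := by
      rw [eq_top_iff, ← hS.span_eq, Submodule.span_le]; exact h
    have h2 := finrank_span_finset_eq_card (R := ℚ) (s := Y) hY
    rw [← hF, h1, finrank_top] at h2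
    generalize 7 ^ (k + (6 * k + 1)) = p at hR
    generalize 7 ^ (k + 1) = q at hR
    omega
  have hgrow : ∀ n : ℕ, n ≤ 6 * k → ∃ T ⊆ S, IndepMod F T id ∧ ∑ t ∈ T, t = z ∧
      T.card = n + 1 := by
    intro n
    induction n with
    | zero => exact fun _ => ⟨{z}, by simpa using hz, indepMod_singleton hzF, by simp, by simp⟩
    | succ n ih =>
      intro hn
      obtain ⟨T, hTS, hT, hsum, hcard⟩ := ih (by omega)
      obtain ⟨t₀, ht₀⟩ : T.Nonempty := Finset.card_pos.1 (by omega)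
      obtain ⟨X, hXS, -, hXt, -, hXcard⟩ := hS.exists_triangles_mod hN hYS hY hU (hTS ht₀)
        (by simpa using hT.notMem ht₀)
      have hpow : 7 ^ (Y.card + T.card) ≤ 7 ^ (k + (6 * k + 1)) :=
        Nat.pow_le_pow_right (by norm_num) (by omega)
      rw [hYk] at hXcard
      obtain ⟨s, -, T', hT'S, hT', hsum', hcard', -⟩ := hS.exists_split hYS hTS hY hT ht₀
        hXS (by
          generalize 7 ^ (k + (6 * k + 1)) = p at *
          generalize 7 ^ (k + 1) = q at *
          omega) (fun s hs => by simpa using hS.neg_mem _ (hXt s hs))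
      exact ⟨T', hT'S, hT', hsum'.trans hsum, by omega⟩
  obtain ⟨T, hTS, hT, hsum, hcard⟩ := hgrow (6 * k) le_rfl
  have hfl : ∀ (T : Finset V) (G : V → Prop), (T.filter fun t => ¬ G t).card ≤ T.card :=
    fun T G => Finset.card_filter_le _ _
  have hK' : ∀ m, m ≤ 8 * (6 * k + 1) → 7 ^ (Y.card + m) < K := by
    intro m hm
    refine lt_of_le_of_lt (Nat.pow_le_pow_right (by norm_num)
      (show Y.card + m ≤ k + 8 * (6 * k + 1) by omega)) (by omega)
  obtain ⟨T₂, hT₂S, hT₂, hsum₂, h2a, h2b, hG₂⟩ := hS.exists_expand hYS hY _ T hTS hT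
    (fun t ht => hcon t (hTS ht) (hT.notMem ht)) rfl
    (hK' _ (by have := hfl T (Closure K S (Long S F)); omega))
  have := hfl T (Closure K S (Long S F))
  obtain ⟨T₁, hT₁S, hT₁, hsum₁, h1a, h1b, hG₁⟩ := hS.exists_expand hYS hY _ T₂ hT₂S hT₂
    hG₂ rfl (hK' _ (by have := hfl T₂ (Long S F); omega))
  have h1 := hS.card_long_le hYS hT₁S hY hT₁ hz (by rw [hsum₁, hsum₂, hsum]; simp)
  rw [Finset.filter_true_of_mem hG₁] at h1
  omega

end ThreeModular

end

section

open Module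

section

variable {V : Type*} [AddCommGroup V] [Module ℚ V]

/-- A distinguished system `Y` together with coordinates `c a`, `a ∈ ι`, modulo its span, such that
elements of `S` have coordinates `0, 1, -1` and at most two nonzero coordinates. -/
structure Frame (S Y ι : Finset V) (c : V → V →ₗ[ℚ] ℚ) : Prop where
  subset : Y ⊆ S
  indep : LinearIndepOn ℚ id (Y : Set V)
  bad : HasBadCoord S Y
  index_subset : ι ⊆ S
  coord_self : ∀ a ∈ ι, c a a = 1
  coord_ne : ∀ a ∈ ι, ∀ b ∈ ι, a ≠ b → c a b = 0
  coord_span : ∀ a ∈ ι, ∀ w ∈ Submodule.span ℚ (Y : Set V), c a w = 0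
  mem_span : ∀ w, (∀ a ∈ ι, c a w = 0) → w ∈ Submodule.span ℚ (Y : Set V)
  coord : ∀ w ∈ S, ∀ a ∈ ι, c a w = 0 ∨ c a w = 1 ∨ c a w = -1
  three : ∀ w ∈ S, ∀ x ∈ ι, ∀ y ∈ ι, ∀ z ∈ ι, x ≠ y → x ≠ z → y ≠ z →
    c x w = 0 ∨ c y w = 0 ∨ c z w = 0
  root : ∃ y ∈ Submodule.span ℚ (Y : Set V), y ≠ 0 ∧ ∀ a ∈ ι, a - y ∈ S
  card : ι.card + Y.card = finrank ℚ V

theorem indepMod_insert_of_sup [DecidableEq V] {F : Submodule ℚ V} {B : Finset V} {σ : V → V}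
    {y : V}
    (h : IndepMod (F ⊔ Submodule.span ℚ {y}) B σ) (hy : y ∉ F) (hσ : σ y = y) (hyB : y ∉ B) :
    IndepMod F (insert y B) σ := by
  intro c hc
  rw [Finset.sum_insert hyB, hσ] at hc
  have h1 : ∀ t ∈ B, c t = 0 := by
    apply h
    have : ∑ t ∈ B, c t • σ t = (c y • y + ∑ t ∈ B, c t • σ t) - c y • y := by abel
    rw [this]
    exact Submodule.sub_mem _ (Submodule.mem_sup_left hc) (Submodule.mem_sup_right
      (Submodule.smul_mem _ _ (Submodule.mem_span_singleton_self y)))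
  have h2 : c y = 0 := by
    rw [Finset.sum_eq_zero (fun t ht => by rw [h1 t ht, zero_smul]), add_zero] at hc
    by_contra h0
    exact hy ((Submodule.smul_mem_iff _ h0).1 hc)
  intro t ht
  rcases Finset.mem_insert.1 ht with rfl | ht
  · exact h2
  · exact h1 t ht

theorem UniMod.coord_shift {S : Finset V} {F : Submodule ℚ V} (hU : UniMod S F) {y : V}
    (hy : y ∈ S) (hyF : y ∉ F) {B : Finset V} (hBS : B ⊆ S)
    (hB : IndepMod (F ⊔ Submodule.span ℚ {y}) B id) {w : V} (hw : w ∈ S) {c : V → ℚ} {γ : ℚ}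
    (hwB : w - (∑ t ∈ B, c t • t + γ • y) ∈ F) {A : Finset V} (hA : A ⊆ B)
    (hAy : ∀ t ∈ A, t - y ∈ S) :
    (∀ t ∈ B, c t = 0 ∨ c t = 1 ∨ c t = -1) ∧
      (γ + ∑ t ∈ A, c t = 0 ∨ γ + ∑ t ∈ A, c t = 1 ∨ γ + ∑ t ∈ A, c t = -1) := by
  classical
  have hymem : y ∈ F ⊔ Submodule.span ℚ {y} :=
    Submodule.mem_sup_right (Submodule.mem_span_singleton_self y)
  have hyB : y ∉ B := fun h => hB.notMem h hymem
  set σ : V → V := fun t => if t ∈ A then t - y else t with hσ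
  have hσB : IndepMod (F ⊔ Submodule.span ℚ {y}) B σ := hB.shift fun t _ => by
    simp only [hσ, id]
    split_ifs
    · simpa using Submodule.neg_mem _ hymem
    · simp
  have hσy : σ y = y := by simp only [hσ]; rw [if_neg fun h => hyB (hA h)]
  have key := hU (insert y B) σ (by
    intro t ht
    simp only [hσ]
    split_ifs with h
    · exact hAy t h
    · rcases Finset.mem_insert.1 ht with rfl | ht
      · exact hy
      · exact hBS ht) (indepMod_insert_of_sup hσB hyF hσy hyB) w hw
    (fun t => if t = y then γ + ∑ t ∈ A, c t else c t) (by
      rw [Finset.sum_insert hyB, hσy, if_pos rfl]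
      have e : ∑ t ∈ B, (if t = y then γ + ∑ t ∈ A, c t else c t) • σ t =
          ∑ t ∈ B, c t • t - (∑ t ∈ A, c t) • y := by
        have e' : (∑ t ∈ A, c t) • y = ∑ t ∈ B, if t ∈ A then c t • y else 0 := by
          rw [← Finset.sum_filter, Finset.filter_mem_eq_inter, Finset.inter_eq_right.2 hA,
            Finset.sum_smul]
        rw [e', ← Finset.sum_sub_distrib]
        refine Finset.sum_congr rfl fun t ht => ?_
        have : t ≠ y := fun h => hyB (h ▸ ht)
        simp only [hσ, this, if_false]
        split_ifs <;> module
      rw [e]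
      convert hwB using 1
      module)
  refine ⟨fun t ht => ?_, by simpa using key y (Finset.mem_insert_self _ _)⟩
  have : t ≠ y := fun h => hyB (h ▸ ht)
  simpa [this] using key t (Finset.mem_insert_of_mem ht)

/-- Two elements forming triangles with `y`, one of which is short, are not parallel modulo `y` and
`F` unless they are parallel modulo `y`. -/
theorem UniMod.eq_of_parallel {S : Finset V} (hneg : ∀ v ∈ S, -v ∈ S) {F : Submodule ℚ V}
    (hU : UniMod S F) {y t t' : V}
    (hy : y ∈ S) (hyF : y ∉ F) (ht : t ∈ S) (ht' : t' ∈ S) (hty : t - y ∈ S) (hty' : t' - y ∈ S)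
    (htF : t ∉ F ⊔ Submodule.span ℚ {y}) (htF' : t' ∉ F ⊔ Submodule.span ℚ {y})
    (hshort : ¬ (Long S F t ∧ Long S F (y - t)))
    (hpar : ∀ c : ℚ, t' - c • t ∈ Submodule.span ℚ {y} → t' = t) {c : ℚ}
    (hc : t' - c • t ∈ F ⊔ Submodule.span ℚ {y}) : t' = t := by
  have hymem : y ∈ F ⊔ Submodule.span ℚ {y} :=
    Submodule.mem_sup_right (Submodule.mem_span_singleton_self y)
  obtain ⟨f, hf, g, hg, hfg⟩ := Submodule.mem_sup.1 hc
  obtain ⟨d, rfl⟩ := Submodule.mem_span_singleton.1 hg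
  have htyF : t - y ∉ F ⊔ Submodule.span ℚ {y} := fun h =>
    htF (by simpa using Submodule.add_mem _ h hymem)
  obtain ⟨hc1, -⟩ := hU.coord_pair (c := c) (d := d) ht ht' hy hyF htF (by
    convert hf using 1; linear_combination (norm := module) -hfg)
  obtain ⟨-, hd1⟩ := hU.coord_pair (c := c) (d := d) ht ht' hy hyF htF (by
    convert hf using 1; linear_combination (norm := module) -hfg)
  obtain ⟨-, hd2⟩ := hU.coord_pair (c := c) (d := d - 1) ht hty' hy hyF htF (by
    convert hf using 1; linear_combination (norm := module) -hfg)
  obtain ⟨-, hd3⟩ := hU.coord_pair (c := c) (d := d + c) hty ht' hy hyF htyF (by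
    convert hf using 1; linear_combination (norm := module) -hfg)
  obtain ⟨-, hd4⟩ := hU.coord_pair (c := c) (d := d + c - 1) hty hty' hy hyF htyF (by
    convert hf using 1; linear_combination (norm := module) -hfg)
  have hyt : y - t ∈ S := by simpa using hneg _ hty
  have htF0 : t ∉ F := fun h => htF (Submodule.mem_sup_left h)
  have hytF0 : y - t ∉ F := fun h => htyF (by
    simpa using Submodule.neg_mem _ (Submodule.mem_sup_left (T := Submodule.span ℚ {y}) h))
  rcases hc1 with rfl | rfl | rfl
  · exact absurd (by simpa using hc) htF'
  · have hd : d = 0 := by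
      rcases hd1 with h | h | h <;> subst h <;> first | rfl | (exfalso; revert hd2 hd3; norm_num)
    subst hd
    by_cases hf0 : f = 0
    · exact hpar 1 (by rw [← hfg, hf0]; simp)
    · exfalso
      refine hshort ⟨⟨ht, htF0, f, hf, hf0, ?_⟩, hyt, hytF0, -f, F.neg_mem hf, by simpa, ?_⟩
      · convert ht' using 1; linear_combination (norm := module) hfg
      · convert hneg _ hty' using 1; linear_combination (norm := module) -hfg
  · have hd : d = 1 := by
      rcases hd1 with h | h | h <;> subst h <;> first | rfl | (exfalso; revert hd2 hd4; norm_num)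
    subst hd
    by_cases hf0 : f = 0
    · exact hpar (-1) (by
        rw [← hfg, hf0, zero_add]
        exact Submodule.smul_mem _ _ (Submodule.mem_span_singleton_self y))
    · exfalso
      refine hshort ⟨⟨ht, htF0, -f, F.neg_mem hf, by simpa, ?_⟩, hyt, hytF0, f, hf, hf0, ?_⟩
      · convert hneg _ hty' using 1; linear_combination (norm := module) -hfg
      · convert ht' using 1; linear_combination (norm := module) hfg

theorem UniMod.sum_abs_le {S : Finset V} {F : Submodule ℚ V} (hU : UniMod S F) {y : V}
    (hy : y ∈ S) (hyF : y ∉ F) {B : Finset V} (hBS : B ⊆ S)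
    (hB : IndepMod (F ⊔ Submodule.span ℚ {y}) B id) {w : V} (hw : w ∈ S) {c : V → ℚ} {γ : ℚ}
    (hwB : w - (∑ t ∈ B, c t • t + γ • y) ∈ F) {I : Finset V} (hI : I ⊆ B)
    (hIy : ∀ t ∈ I, t - y ∈ S) :
    ∑ t ∈ I, |c t| ≤ 2 ∧ (w - y ∈ S → ∑ t ∈ I, |c t| ≤ 1) := by
  have key : ∀ w' ∈ S, ∀ γ', w' - (∑ t ∈ B, c t • t + γ' • y) ∈ F → ∀ A ⊆ I,
      -1 ≤ γ' + ∑ t ∈ A, c t ∧ γ' + ∑ t ∈ A, c t ≤ 1 := by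
    intro w' hw' γ' h A hA
    rcases (hU.coord_shift hy hyF hBS hB hw' h (hA.trans hI) (fun t ht => hIy t (hA ht))).2 with
      h | h | h <;> rw [h] <;> norm_num
  have e := sum_filter_pos_sub_neg I c
  have h1 := key w hw γ hwB _ (Finset.filter_subset (fun t => 0 < c t) I)
  have h2 := key w hw γ hwB _ (Finset.filter_subset (fun t => c t < 0) I)
  refine ⟨by linarith [h1.2, h2.1], fun hwy => ?_⟩
  have h3 := key (w - y) hwy (γ - 1) (by convert hwB using 1; module) _
    (Finset.filter_subset (fun t => c t < 0) I)
  linarith [h1.2, h3.1]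

/-- Elements forming triangles with `y` which are pairwise nonparallel modulo `F` and `y` are
independent modulo `F` and `y`. -/
theorem UniMod.indepMod_of_nonparallel {S : Finset V} {F : Submodule ℚ V} (hU : UniMod S F) {y : V}
    (hy : y ∈ S) (hyF : y ∉ F) {T : Finset V} (hTS : T ⊆ S) (hTy : ∀ t ∈ T, t - y ∈ S)
    (hTF : ∀ t ∈ T, t ∉ F ⊔ Submodule.span ℚ {y})
    (hpar : ∀ t ∈ T, ∀ t' ∈ T, ∀ c : ℚ, t' - c • t ∈ F ⊔ Submodule.span ℚ {y} → t' = t) :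
    IndepMod (F ⊔ Submodule.span ℚ {y}) T id := by
  classical
  obtain ⟨B, -, hBT, hB, hspan⟩ := IndepMod.exists_extension (T := ∅) (C := T) (σ := id)
    (F := F ⊔ Submodule.span ℚ {y}) (by intro c _ t ht; simp at ht) (by simp)
  suffices T ⊆ B by rwa [← hBT.antisymm this]
  intro s hs
  by_contra hsB
  obtain ⟨c, hc⟩ := mem_sup_span_finset (hspan s hs)
  obtain ⟨f, hf, g, hg, hfg⟩ := Submodule.mem_sup.1 hc
  obtain ⟨γ, rfl⟩ := Submodule.mem_span_singleton.1 hg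
  simp only [id] at hfg hc
  have hwB : s - (∑ t ∈ B, c t • t + γ • y) ∈ F := by
    convert hf using 1; linear_combination (norm := module) -hfg
  have h01 := (hU.coord_shift hy hyF (hBT.trans hTS) hB (hTS hs) hwB (A := ∅) (by simp)
    (by simp)).1
  by_cases h2 : ∃ a ∈ B, c a ≠ 0
  · obtain ⟨a, ha, hca⟩ := h2
    by_cases h3 : ∃ b ∈ B, b ≠ a ∧ c b ≠ 0
    · obtain ⟨b, hb, hba, hcb⟩ := h3
      have := (hU.sum_abs_le hy hyF (hBT.trans hTS) hB (hTS hs) hwB (I := {b, a})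
        (by intro x hx; simp at hx; rcases hx with rfl | rfl <;> assumption)
        (by intro x hx; simp at hx; rcases hx with rfl | rfl <;> exact hTy _ (hBT ‹_›))).2 (hTy s
          hs)
      rw [Finset.sum_pair hba] at this
      rcases h01 a ha with h | h | h <;> rcases h01 b hb with h' | h' | h' <;>
        first
        | exact hca h
        | exact hcb h'
        | (rw [h, h'] at this; norm_num at this)
    · push Not at h3
      rw [Finset.sum_eq_single a (fun b hb hba => by rw [h3 b hb hba, zero_smul])
        (fun h => absurd ha h)] at hc
      exact hsB (hpar a (hBT ha) s hs _ hc ▸ ha)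
  · push Not at h2
    rw [Finset.sum_eq_zero (fun b hb => by rw [h2 b hb, zero_smul]), sub_zero] at hc
    exact hTF s hs hc

end

end

section

open Module

namespace Frame

variable {V : Type*} [AddCommGroup V] [Module ℚ V] {S Y ι : Finset V} {c : V → V →ₗ[ℚ] ℚ}

theorem coord_sum (h : Frame S Y ι c) {A : Finset V} (hA : A ⊆ ι) (a : V → ℚ) {x : V}
    (hx : x ∈ A) : c x (∑ t ∈ A, a t • t) = a x := by
  rw [map_sum, Finset.sum_eq_single x]
  · simp [h.coord_self x (hA hx)]
  · intro t ht hne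
    simp [h.coord_ne x (hA hx) t (hA ht) hne.symm]
  · exact fun hn => absurd hx hn

theorem indepMod (h : Frame S Y ι c) : IndepMod (Submodule.span ℚ (Y : Set V)) ι id := by
  intro a ha x hx
  have := h.coord_span x hx _ ha
  simpa only [id, h.coord_sum subset_rfl a hx] using this

end Frame

namespace ThreeModular

variable {V : Type*} [AddCommGroup V] [Module ℚ V] [FiniteDimensional ℚ V] {S : Finset V}

theorem exists_frame_of_not_closure (hS : ThreeModular S) (hN : NoGain S) {Y : Finset V}
    (hYS : Y ⊆ S) (hY : LinearIndepOn ℚ id (Y : Set V)) (hbad : HasBadCoord S Y) {K : ℕ} {y : V}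
    (hy : y ∈ S) (hyF : y ∉ Submodule.span ℚ (Y : Set V))
    (hcl : ¬ Closure K S (Long S (Submodule.span ℚ (Y : Set V))) y) :
    ∃ Y' ι : Finset V, ∃ c : V → V →ₗ[ℚ] ℚ, Frame S Y' ι c ∧
      Y'.card ≤ 7 ^ (Y.card + 1) + K := by
  classical
  have hU := hS.uniMod_of_hasBadCoord hYS hY hbad
  set F := Submodule.span ℚ (Y : Set V) with hF
  obtain ⟨T, hTS, hTF, hTy, hTpar, hTcard⟩ := hS.exists_triangles_mod hN hYS hY hU hy hyF
  have hK : (S.filter fun t => y - t ∈ S ∧ Long S F t ∧ Long S F (y - t)).card < K := by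
    by_contra! h
    apply hcl
    right
    convert h
  set T₁ := T.filter fun t => ¬ (Long S F t ∧ Long S F (y - t)) with hT₁
  have hT₁T : T₁ ⊆ T := Finset.filter_subset _ _
  have hT₁S := hT₁T.trans hTS
  have hcard : T.card < T₁.card + K := by
    have h1 : (T.filter fun t => Long S F t ∧ Long S F (y - t)).card + T₁.card = T.card := by
      convert Finset.card_filter_add_card_filter_not (s := T)
        (fun t => Long S F t ∧ Long S F (y - t))
    have h2 : (T.filter fun t => Long S F t ∧ Long S F (y - t)).card ≤
        (S.filter fun t => y - t ∈ S ∧ Long S F t ∧ Long S F (y - t)).card := by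
      apply Finset.card_le_card
      intro t ht
      obtain ⟨h1, h2⟩ := Finset.mem_filter.1 ht
      exact Finset.mem_filter.2 ⟨hTS h1, by simpa using hS.neg_mem _ (hTy t h1), h2⟩
    omega
  have hindep : IndepMod (F ⊔ Submodule.span ℚ {y}) T₁ id := by
    refine hU.indepMod_of_nonparallel hy hyF hT₁S (fun t ht => hTy t (hT₁T ht))
      (fun t ht => hTF t (hT₁T ht)) fun t ht t' ht' d hd => ?_
    obtain ⟨h1, h2⟩ := Finset.mem_filter.1 ht
    exact hU.eq_of_parallel hS.neg_mem hy hyF (hTS h1) (hT₁S ht') (hTy t h1) (hTy t' (hT₁T ht'))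
      (hTF t h1) (hTF t' (hT₁T ht')) h2 (fun d hd => hTpar t h1 t' (hT₁T ht') d hd) hd
  have hyY : y ∉ Y := fun h => hyF (Submodule.subset_span h)
  have hspan1 : Submodule.span ℚ ((insert y Y : Finset V) : Set V) =
      F ⊔ Submodule.span ℚ {y} := by
    rw [Finset.coe_insert, Submodule.span_insert, sup_comm]
  have hY1 : LinearIndepOn ℚ id ((insert y Y : Finset V) : Set V) := by
    rw [Finset.coe_insert, linearIndepOn_id_insert (by exact_mod_cast hyY)]
    exact ⟨hY, hyF⟩
  have hY1S : insert y Y ⊆ S := Finset.insert_subset hy hYS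
  obtain ⟨hdisj, hi⟩ := LinearIndepOn.union_indepMod hY1 (by rwa [hspan1])
  obtain ⟨B, hB, hBS, hBi, hBspan, hBcard⟩ :=
    hS.exists_basis_extension (Finset.union_subset hY1S hT₁S) hi
  have hYB : insert y Y ⊆ B := Finset.subset_union_left.trans hB
  have hTB : T₁ ⊆ B := Finset.subset_union_right.trans hB
  let b : Basis B ℚ V := Basis.mk (v := fun t : B => t.1) hBi (by
    rw [← hBspan]
    apply Submodule.span_mono
    intro x hx
    exact ⟨⟨x, hx⟩, rfl⟩)
  have hb : ∀ x (hx : x ∈ B), b ⟨x, hx⟩ = x := fun x hx => Basis.mk_apply hBi _ _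
  set c : V → V →ₗ[ℚ] ℚ := fun a => if h : a ∈ B then b.coord ⟨a, h⟩ else 0 with hc
  have hcb : ∀ a ∈ B, ∀ x ∈ B, c a x = if a = x then 1 else 0 := by
    intro a ha x hx
    simp only [hc, dif_pos ha]
    conv_lhs => rw [← hb x hx]
    rw [Basis.coord_apply, Basis.repr_self, Finsupp.single_apply]
    simp [eq_comm]
  have hsum : ∀ w, ∑ t ∈ B, c t w • t = w := by
    intro w
    conv_rhs => rw [← b.sum_repr w]
    rw [← Finset.sum_coe_sort]
    refine Finset.sum_congr rfl fun t _ => ?_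
    rw [hb t.1 t.2]
    simp only [hc, dif_pos t.2, Basis.coord_apply]
  have hcspan : ∀ A ⊆ B, ∀ a ∈ B, a ∉ A → ∀ w ∈ Submodule.span ℚ (A : Set V), c a w = 0 := by
    intro A hA a ha haA w hw
    have : Submodule.span ℚ (A : Set V) ≤ LinearMap.ker (c a) := by
      rw [Submodule.span_le]
      intro x hx
      have hne : a ≠ x := fun h => haA (h ▸ hx)
      simp [hcb a ha x (hA hx), hne]
    exact this hw
  have hmem : ∀ A ⊆ B, ∀ w, (∀ a ∈ B, a ∉ A → c a w = 0) →
      w ∈ Submodule.span ℚ (A : Set V) := by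
    intro A hA w h
    rw [← hsum w, ← Finset.sum_subset hA]
    · exact Submodule.sum_mem _ fun t ht => Submodule.smul_mem _ _ (Submodule.subset_span ht)
    · intro t ht htA; rw [h t ht htA, zero_smul]
  have hYY : Y ⊆ B \ T₁ := fun x hx => Finset.mem_sdiff.2 ⟨hYB (Finset.mem_insert_of_mem hx),
    Finset.disjoint_left.1 hdisj (Finset.mem_insert_of_mem hx)⟩
  have hyB : y ∈ B \ T₁ := Finset.mem_sdiff.2 ⟨hYB (Finset.mem_insert_self _ _),
    Finset.disjoint_left.1 hdisj (Finset.mem_insert_self _ _)⟩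
  have hsd : B \ T₁ ⊆ B := Finset.sdiff_subset
  have hY'S : B \ T₁ ⊆ S := hsd.trans hBS
  have hY'i : LinearIndepOn ℚ id ((B \ T₁ : Finset V) : Set V) :=
    hBi.mono (by exact_mod_cast hsd)
  have hU' := hS.uniMod_of_hasBadCoord hY'S hY'i (hbad.mono hYY)
  have hcs : ∀ a ∈ T₁, ∀ w ∈ Submodule.span ℚ ((B \ T₁ : Finset V) : Set V), c a w = 0 :=
    fun a ha => hcspan _ hsd a (hTB ha) (by simp [ha])
  refine ⟨B \ T₁, T₁, c, ?_, ?_⟩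
  · refine ⟨hY'S, hY'i, hbad.mono hYY, hT₁S, fun a ha => by simp [hcb a (hTB ha) a (hTB ha)],
      fun a ha b hb hne => by simp [hcb a (hTB ha) b (hTB hb), hne], hcs, ?_, ?_, ?_,
      ⟨y, Submodule.subset_span hyB, hS.ne_zero y hy, fun a ha => hTy a (hT₁T ha)⟩, ?_⟩
    · intro w h
      exact hmem _ hsd w fun a ha haT => h a (by simpa [ha] using haT)
    · intro w hw a ha
      refine hU' T₁ id hT₁S ?_ w hw (fun a => c a w) ?_ a ha
      · apply LinearIndepOn.indepMod_of_union Finset.sdiff_disjoint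
        rwa [Finset.sdiff_union_of_subset hTB]
      · apply hmem _ hsd
        intro a ha haT
        have haT' : a ∈ T₁ := by simpa [ha] using haT
        rw [map_sub, map_sum, Finset.sum_eq_single a]
        · simp [hcb a ha a ha]
        · intro t ht hne; simp [hcb a ha t (hTB ht), hne.symm]
        · exact fun h => absurd haT' h
    · intro w hw p hp q hq s hs hpq hps hqs
      by_contra! hne
      have hIB : ({p, q, s} : Finset V) ⊆ T₁ := by
        intro x hx
        simp only [Finset.mem_insert, Finset.mem_singleton] at hx
        rcases hx with rfl | rfl | rfl <;> assumption
      have h2 := (hU.sum_abs_le hy hyF (B := B \ insert y Y) (Finset.sdiff_subset.trans hBS) (by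
          rw [← hspan1]
          apply LinearIndepOn.indepMod_of_union Finset.disjoint_sdiff
          rwa [Finset.union_sdiff_of_subset hYB]) hw (c := fun a => c a w) (γ := c y w) (by
          have e := hsum w
          rw [← Finset.sum_sdiff hYB, Finset.sum_insert hyY] at e
          have : w - (∑ t ∈ B \ insert y Y, c t w • t + c y w • y) = ∑ t ∈ Y, c t w • t := by
            linear_combination (norm := module) -e
          rw [this]
          exact Submodule.sum_mem _ fun t ht =>
            Submodule.smul_mem _ _ (Submodule.subset_span ht)) (I := {p, q, s})
          (fun x hx => Finset.mem_sdiff.2 ⟨hTB (hIB hx), Finset.disjoint_right.1 hdisj (hIB hx)⟩)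
          (fun x hx => hTy x (hT₁T (hIB hx)))).1
      have habs : ∀ x ∈ ({p, q, s} : Finset V), (1 : ℚ) ≤ |c x w| := by
        intro x hx
        have h0 : c x w ≠ 0 := by
          simp only [Finset.mem_insert, Finset.mem_singleton] at hx
          rcases hx with rfl | rfl | rfl
          · exact hne.1
          · exact hne.2.1
          · exact hne.2.2
        rcases hU' T₁ id hT₁S (by
            apply LinearIndepOn.indepMod_of_union Finset.sdiff_disjoint
            rwa [Finset.sdiff_union_of_subset hTB]) w hw (fun a => c a w) (by
            apply hmem _ hsd
            intro a ha haT
            have haT' : a ∈ T₁ := by simpa [ha] using haT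
            rw [map_sub, map_sum, Finset.sum_eq_single a]
            · simp [hcb a ha a ha]
            · intro t ht hne; simp [hcb a ha t (hTB ht), hne.symm]
            · exact fun h => absurd haT' h) x (hIB hx) with h | h | h
        · exact absurd h h0
        · simp only [h]; norm_num
        · simp only [h]; norm_num
      have h3 := Finset.sum_le_sum habs
      rw [Finset.sum_const, Finset.card_eq_three.2 ⟨p, q, s, hpq, hps, hqs, rfl⟩] at h3
      have := h3.trans h2
      norm_num at this
    · rw [← hBcard, add_comm]
      exact Finset.card_sdiff_add_card_eq_card hTB
  · have h1 := Finset.card_sdiff_add_card_eq_card hTB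
    generalize 7 ^ (Y.card + 1) = q at *
    omega

/-- In large rank there is a frame with a bounded distinguished system. -/
theorem exists_frame : ∃ C R : ℕ, ∀ {V : Type*} [AddCommGroup V] [Module ℚ V]
    [FiniteDimensional ℚ V] {S : Finset V}, ThreeModular S → NoGain S → R ≤ finrank ℚ V →
    ∃ Y ι : Finset V, ∃ c : V → V →ₗ[ℚ] ℚ, Frame S Y ι c ∧ Y.card ≤ C := by
  choose K hK using exists_not_closure
  choose R hR using fun k => hK k _ le_rfl
  refine ⟨7 ^ 7 + ∑ k ∈ Finset.range 7, K k, 1 + ∑ k ∈ Finset.range 7, R k, ?_⟩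
  intro V _ _ _ S hS hN hr
  obtain ⟨Y, hYS, hY, hY6, hbad⟩ := hS.exists_hasBadCoord hN (by omega)
  have hk : Y.card ∈ Finset.range 7 := by simp; omega
  have h1 : R Y.card ≤ ∑ k ∈ Finset.range 7, R k :=
    Finset.single_le_sum (f := R) (fun _ _ => Nat.zero_le _) hk
  have h2 : K Y.card ≤ ∑ k ∈ Finset.range 7, K k :=
    Finset.single_le_sum (f := K) (fun _ _ => Nat.zero_le _) hk
  obtain ⟨z, hz, hzF, hcl⟩ := hR Y.card hS hN Y hYS hY rfl
    (hS.uniMod_of_hasBadCoord hYS hY hbad) (by omega)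
  obtain ⟨Y', ι, c, hf, hc⟩ := hS.exists_frame_of_not_closure hN hYS hY hbad hz hzF
    (K := K Y.card) (fun h => hcl (by
      rcases h with h | h
      · exact Or.inl (Or.inl h)
      · exact Or.inl (Or.inr h)))
  refine ⟨Y', ι, c, hf, hc.trans ?_⟩
  have : 7 ^ (Y.card + 1) ≤ 7 ^ 7 := Nat.pow_le_pow_right (by norm_num) (by omega)
  omega

end ThreeModular

end

section

open Module

/-- Elements of `S` with two nonzero coordinates, one of them common, and with differences
in `S`. -/
structure StarSystem {V : Type*} [AddCommGroup V] [Module ℚ V] (S ι : Finset V) (c : V → V →ₗ[ℚ] ℚ)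
    (J : Finset V) (v : V → V) (a : V) (ε : ℚ) : Prop where
  subset : J ⊆ S
  center_mem : a ∈ ι
  vertex_mem : ∀ u ∈ J, v u ∈ ι
  vertex_ne : ∀ u ∈ J, v u ≠ a
  inj : ∀ u ∈ J, ∀ u' ∈ J, v u = v u' → u = u'
  coord_vertex : ∀ u ∈ J, c (v u) u ≠ 0
  coord_center : ∀ u ∈ J, c a u = ε
  coord_other : ∀ u ∈ J, ∀ x ∈ ι, x ≠ a → x ≠ v u → c x u = 0
  sub_mem : ∀ u ∈ J, ∀ u' ∈ J, u ≠ u' → u - u' ∈ S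

theorem exists_clique {α : Type*} [DecidableEq α] {r : α → α → Prop} [DecidableRel r]
    (hr : ∀ u u', r u u' → r u' u) {M : ℕ} (P : ℕ) : ∀ U : Finset α,
    (∀ u ∈ U, (U.filter fun u' => ¬ r u u').card ≤ M) → P * (M + 1) ≤ U.card →
    ∃ J ⊆ U, J.card = P ∧ ∀ u ∈ J, ∀ u' ∈ J, u ≠ u' → r u u' := by
  induction P with
  | zero => exact fun U _ _ => ⟨∅, by simp, by simp, by simp⟩
  | succ P ih =>
    intro U hU hcard
    obtain ⟨u, hu⟩ : U.Nonempty := by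
      rw [← Finset.card_pos]
      refine lt_of_lt_of_le ?_ hcard
      positivity
    have h1 := Finset.card_filter_add_card_filter_not (s := U) (fun u' => r u u')
    have h2 := hU u hu
    have h3 := Finset.pred_card_le_card_erase (s := U.filter fun u' => r u u') (a := u)
    obtain ⟨J, hJ, hJP, hJr⟩ := ih ((U.filter fun u' => r u u').erase u) (by
      intro w hw
      refine (Finset.card_le_card ?_).trans
        (hU w (Finset.mem_of_mem_filter w (Finset.mem_of_mem_erase hw)))
      intro x hx
      simp only [Finset.mem_filter, Finset.mem_erase] at hx ⊢
      exact ⟨hx.1.2.1, hx.2⟩) (by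
      have : (P + 1) * (M + 1) = P * (M + 1) + (M + 1) := by ring
      omega)
    have hJu : ∀ w ∈ J, r u w ∧ w ≠ u ∧ w ∈ U := fun w hw => by
      have := hJ hw
      simp only [Finset.mem_filter, Finset.mem_erase] at this
      exact ⟨this.2.2, this.1, this.2.1⟩
    have huJ : u ∉ J := fun h => (hJu u h).2.1 rfl
    refine ⟨insert u J, ?_, by rw [Finset.card_insert_of_notMem huJ, hJP], ?_⟩
    · exact Finset.insert_subset hu fun w hw => (hJu w hw).2.2
    · intro x hx x' hx' hne
      rcases Finset.mem_insert.1 hx with h4 | h4 <;> rcases Finset.mem_insert.1 hx' with h5 | h5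
      · exact absurd (h4.trans h5.symm) hne
      · rw [h4]
        exact (hJu x' h5).1
      · rw [h5]
        exact hr _ _ (hJu x h4).1
      · exact hJr x h4 x' h5 hne

namespace Frame

variable {V : Type*} [AddCommGroup V] [Module ℚ V] {S Y ι : Finset V} {c : V → V →ₗ[ℚ] ℚ}

theorem long_of_single (h : Frame S Y ι c) (hneg : ∀ v ∈ S, -v ∈ S) {w x : V} (hw : w ∈ S)
    (hx : x ∈ ι) (hxw : c x w ≠ 0) (hz : ∀ z ∈ ι, z ≠ x → c z w = 0) :
    Long S (Submodule.span ℚ (Y : Set V)) w := by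
  obtain ⟨y, hy, hy0, hyS⟩ := h.root
  have hwF : w ∉ Submodule.span ℚ (Y : Set V) := fun hF => hxw (h.coord_span x hx w hF)
  have key : ∀ s : V, s ∈ S → s - y ∈ S ∨ s + y ∈ S → c x s = c x w →
      (∀ z ∈ ι, z ≠ x → c z s = 0) → Long S (Submodule.span ℚ (Y : Set V)) w := by
    intro s hs hsy hxs hzs
    by_cases hsw : s = w
    · subst hsw
      rcases hsy with hsy | hsy
      · exact ⟨hw, hwF, -y, Submodule.neg_mem _ hy, by simpa, by simpa [sub_eq_add_neg] using hsy⟩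
      · exact ⟨hw, hwF, y, hy, hy0, hsy⟩
    · refine ⟨hw, hwF, s - w, ?_, by rwa [sub_ne_zero], by simpa using hs⟩
      apply h.mem_span
      intro z hz'
      rw [map_sub]
      by_cases hzx : z = x
      · rw [hzx, hxs, sub_self]
      · rw [hzs z hz' hzx, hz z hz' hzx, sub_self]
  have hxS := h.index_subset hx
  rcases h.coord w hw x hx with h0 | h1 | h1
  · exact absurd h0 hxw
  · exact key x hxS (Or.inl (hyS x hx)) (by rw [h1, h.coord_self x hx])
      fun z hz' hne => h.coord_ne z hz' x hx hne
  · refine key (-x) (hneg x hxS) (Or.inr ?_) (by rw [h1, map_neg, h.coord_self x hx])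
      fun z hz' hne => by rw [map_neg, h.coord_ne z hz' x hx hne, neg_zero]
    convert hneg _ (hyS x hx) using 1
    abel

theorem exists_vertex (h : Frame S Y ι c) (hneg : ∀ v ∈ S, -v ∈ S) {w x : V} (hw : w ∈ S)
    (hlong : ¬ Long S (Submodule.span ℚ (Y : Set V)) w) (hx : x ∈ ι) (hxw : c x w ≠ 0) :
    ∃ v ∈ ι, v ≠ x ∧ c v w ≠ 0 := by
  by_contra! hcon
  exact hlong (h.long_of_single hneg hw hx hxw fun z hz hne => hcon z hz hne)

theorem eq_zero_of_ne (h : Frame S Y ι c) {w x y z : V} (hw : w ∈ S) (hx : x ∈ ι) (hy : y ∈ ι)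
    (hz : z ∈ ι) (hxy : x ≠ y) (hxw : c x w ≠ 0) (hyw : c y w ≠ 0) (hzx : z ≠ x) (hzy : z ≠ y) :
    c z w = 0 := by
  rcases h.three w hw x hx y hy z hz hxy hzx.symm hzy.symm with h | h | h
  · exact absurd h hxw
  · exact absurd h hyw
  · exact h

theorem sub_mem (h : Frame S Y ι c) (hU : UniMod S (Submodule.span ℚ (Y : Set V))) {w w' x y : V}
    (hw : w ∈ S) (hw' : w' ∈ S) (hx : x ∈ ι) (hy : y ∈ ι) (hxy : x ≠ y) (hxw : c x w ≠ 0)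
    (hxw' : c x w' = c x w) (hyw : c y w ≠ 0) (hyw' : c y w' ≠ 0) :
    w - w' ∈ Submodule.span ℚ (Y : Set V) := by
  have hoth : ∀ z ∈ ι, z ≠ x → z ≠ y → c z w = 0 ∧ c z w' = 0 := fun z hz hzx hzy =>
    ⟨h.eq_zero_of_ne hw hx hy hz hxy hxw hyw hzx hzy,
      h.eq_zero_of_ne hw' hx hy hz hxy (hxw' ▸ hxw) hyw' hzx hzy⟩
  have hyF : y ∉ Submodule.span ℚ (Y : Set V) := fun hF => by
    have := h.coord_span y hy y hF
    rw [h.coord_self y hy] at this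
    norm_num at this
  have hwF : w ∉ Submodule.span ℚ (Y : Set V) ⊔ Submodule.span ℚ {y} := fun hF => by
    obtain ⟨f, hf, g, hg, rfl⟩ := Submodule.mem_sup.1 hF
    obtain ⟨d, rfl⟩ := Submodule.mem_span_singleton.1 hg
    apply hxw
    rw [map_add, map_smul, h.coord_span x hx f hf, h.coord_ne x hx y hy hxy]
    simp
  obtain ⟨-, h1⟩ := hU.coord_pair (u := w) (v := w') (z := y) (c := 1) (d := c y w' - c y w) hw hw'
    (h.index_subset hy) hyF hwF (by
      apply h.mem_span
      intro z hz
      simp only [map_sub, map_add, map_smul, smul_eq_mul, one_mul]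
      by_cases hzx : z = x
      · rw [hzx, hxw', h.coord_ne x hx y hy hxy]; ring
      · by_cases hzy : z = y
        · rw [hzy, h.coord_self y hy]; ring
        · rw [(hoth z hz hzx hzy).1, (hoth z hz hzx hzy).2, h.coord_ne z hz y hy hzy]; ring)
  have h2 : c y w' = c y w := by
    rcases h.coord w hw y hy with h0 | h0 | h0 <;> rcases h.coord w' hw' y hy with h3 | h3 | h3 <;>
      first
      | exact absurd h0 hyw
      | exact absurd h3 hyw'
      | exact h3.trans h0.symm
      | (exfalso; rw [h0, h3] at h1; revert h1; norm_num)
  apply h.mem_span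
  intro z hz
  rw [map_sub]
  by_cases hzx : z = x
  · rw [hzx, hxw', sub_self]
  · by_cases hzy : z = y
    · rw [hzy, h2, sub_self]
    · rw [(hoth z hz hzx hzy).1, (hoth z hz hzx hzy).2, sub_self]

/-- The two summands of an element with coordinates at `a` and `b` carry one coordinate each. -/
theorem triangle (h : Frame S Y ι c) {z t a b : V} (hz : z ∈ S) (ht : t ∈ S) (hzt : z - t ∈ S)
    (htF : t ∉ Submodule.span ℚ (Y : Set V) ⊔ Submodule.span ℚ {z}) (ha : a ∈ ι) (hb : b ∈ ι)
    (hab : a ≠ b) (haz : c a z ≠ 0) (hbz : c b z ≠ 0) :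
    (c a t = c a z ∧ c b t = 0) ∨ (c a t = 0 ∧ c b t = c b z) := by
  have key : ∀ x ∈ ι, c x z ≠ 0 → c x t = 0 ∨ c x t = c x z := by
    intro x hx hxz
    have h1 := h.coord (z - t) hzt x hx
    rw [map_sub] at h1
    rcases h.coord z hz x hx with h0 | h0 | h0 <;> rcases h.coord t ht x hx with h3 | h3 | h3 <;>
      first
      | exact absurd h0 hxz
      | exact Or.inl h3
      | exact Or.inr (h3.trans h0.symm)
      | (exfalso; rw [h0, h3] at h1; revert h1; norm_num)
  have hoz : ∀ x ∈ ι, x ≠ a → x ≠ b → c x z = 0 := fun x hx hxa hxb =>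
    h.eq_zero_of_ne hz ha hb hx hab haz hbz hxa hxb
  rcases key a ha haz with h1 | h1 <;> rcases key b hb hbz with h2 | h2
  · exfalso
    apply htF
    apply Submodule.mem_sup_left
    apply h.mem_span
    intro x hx
    by_cases hxa : x = a
    · rw [hxa, h1]
    · by_cases hxb : x = b
      · rw [hxb, h2]
      · have := h.eq_zero_of_ne hzt ha hb hx hab (by rw [map_sub, h1, sub_zero]; exact haz)
          (by rw [map_sub, h2, sub_zero]; exact hbz) hxa hxb
        rw [map_sub, hoz x hx hxa hxb, zero_sub, neg_eq_zero] at this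
        exact this
  · exact Or.inr ⟨h1, h2⟩
  · exact Or.inl ⟨h1, h2⟩
  · exfalso
    apply htF
    have hF : z - t ∈ Submodule.span ℚ (Y : Set V) := by
      apply h.mem_span
      intro x hx
      rw [map_sub]
      by_cases hxa : x = a
      · rw [hxa, h1, sub_self]
      · by_cases hxb : x = b
        · rw [hxb, h2, sub_self]
        · rw [hoz x hx hxa hxb, h.eq_zero_of_ne ht ha hb hx hab (by rwa [h1]) (by rwa [h2]) hxa hxb,
            sub_self]
    have : t = -(z - t) + z := by abel
    rw [this]
    exact Submodule.add_mem _ (Submodule.mem_sup_left (Submodule.neg_mem _ hF))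
      (Submodule.mem_sup_right (Submodule.mem_span_singleton_self z))

end Frame

namespace ThreeModular

variable {V : Type*} [AddCommGroup V] [Module ℚ V] [FiniteDimensional ℚ V] {S Y ι : Finset V}
  {c : V → V →ₗ[ℚ] ℚ}

/-- Triangles on `z` with one side violating `G`. -/
theorem exists_triangles_closure (hS : ThreeModular S) (hN : NoGain S) (h : Frame S Y ι c) {K : ℕ}
    {G : V → Prop} {z : V} (hz : z ∈ S) (hzF : z ∉ Submodule.span ℚ (Y : Set V))
    (hcl : ¬ Closure K S G z) :
    ∃ T : Finset V, (∀ t ∈ T, t ∈ S ∧ z - t ∈ S ∧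
        t ∉ Submodule.span ℚ (Y : Set V) ⊔ Submodule.span ℚ {z} ∧ ¬ (G t ∧ G (z - t))) ∧
      (∀ t ∈ T, ∀ t' ∈ T, t = z - t' → t = t') ∧
      finrank ℚ V ≤ T.card + (7 ^ (Y.card + 1) + K) := by
  classical
  obtain ⟨T, hTS, hTF, hTz, hTpar, hTcard⟩ := hS.exists_triangles_mod hN h.subset h.indep
    (hS.uniMod_of_hasBadCoord h.subset h.indep h.bad) hz hzF
  have hK : (S.filter fun t => z - t ∈ S ∧ G t ∧ G (z - t)).card < K := by
    by_contra! h
    apply hcl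
    right
    convert h
  have hTz' : ∀ t ∈ T, z - t ∈ S := fun t ht => by simpa using hS.neg_mem _ (hTz t ht)
  refine ⟨T.filter fun t => ¬ (G t ∧ G (z - t)), ?_, ?_, ?_⟩
  · intro t ht
    obtain ⟨h1, h2⟩ := Finset.mem_filter.1 ht
    exact ⟨hTS h1, hTz' t h1, hTF t h1, h2⟩
  · intro t ht t' ht' he
    refine hTpar t' (Finset.mem_of_mem_filter _ ht') t (Finset.mem_of_mem_filter _ ht) (-1) ?_
    rw [he]
    simp
  · have h1 := Finset.card_filter_add_card_filter_not (s := T) (fun t => G t ∧ G (z - t))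
    have h2 : (T.filter fun t => G t ∧ G (z - t)).card ≤
        (S.filter fun t => z - t ∈ S ∧ G t ∧ G (z - t)).card := by
      apply Finset.card_le_card
      intro t ht
      obtain ⟨h1, h2⟩ := Finset.mem_filter.1 ht
      exact Finset.mem_filter.2 ⟨hTS h1, hTz' t h1, h2⟩
    generalize 7 ^ (Y.card + 1) = q at *
    omega

/-- Few short elements with the same coordinate at `a` are not adjacent to `u`. -/
theorem exists_neighbors (hS : ThreeModular S) (hN : NoGain S) (h : Frame S Y ι c) {K : ℕ}
    {u a v : V} (hu : u ∈ S) (hcl : ¬ Closure K S (Long S (Submodule.span ℚ (Y : Set V))) u)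
    (ha : a ∈ ι) (hv : v ∈ ι) (hav : a ≠ v) (hau : c a u ≠ 0) (hvu : c v u ≠ 0) :
    ∃ N ⊆ ι, ι.card ≤ N.card + (7 ^ (Y.card + 1) + K) ∧ ∀ w ∈ N, w ≠ a →
      ∀ u' ∈ S, ¬ Long S (Submodule.span ℚ (Y : Set V)) u' → c a u' = c a u → c w u' ≠ 0 →
      u - u' ∈ S := by
  classical
  have hU := hS.uniMod_of_hasBadCoord h.subset h.indep h.bad
  set F := Submodule.span ℚ (Y : Set V) with hF
  have huF : u ∉ F := fun hF => hau (h.coord_span a ha u hF)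
  obtain ⟨T, hT, hTinj, hTcard⟩ := hS.exists_triangles_closure hN h hu huF hcl
  set s : V → V := fun t => if c a t = 0 then u - t else t with hs
  have hsT : ∀ t ∈ T, s t ∈ S ∧ u - s t ∈ S ∧ c a (s t) = c a u ∧ c v (s t) = 0 ∧
      ¬ (Long S F (s t) ∧ Long S F (u - s t)) := by
    intro t ht
    obtain ⟨h1, h2, h3, h4⟩ := hT t ht
    simp only [hs]
    rcases h.triangle hu h1 h2 h3 ha hv hav hau hvu with h5 | h5
    · rw [if_neg (by rw [h5.1]; exact hau)]
      exact ⟨h1, h2, h5.1, h5.2, h4⟩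
    · rw [if_pos h5.1, sub_sub_cancel]
      refine ⟨h2, h1, by rw [map_sub, h5.1, sub_zero], by rw [map_sub, h5.2, sub_self], ?_⟩
      tauto
  have hex : ∀ t, ∃ w, t ∈ T → w ∈ ι ∧ w ≠ a ∧ c w (s t) ≠ 0 := by
    intro t
    by_cases ht : t ∈ T
    · obtain ⟨h1, h2, h3, h4, h5⟩ := hsT t ht
      by_contra! hcon
      have hcon' : ∀ w ∈ ι, w ≠ a → c w (s t) = 0 := fun w hw hwa => (hcon w).2 hw hwa
      refine h5 ⟨h.long_of_single hS.neg_mem h1 ha (by rwa [h3]) hcon',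
        h.long_of_single hS.neg_mem h2 hv (by rwa [map_sub, h4, sub_zero]) ?_⟩
      intro w hw hwv
      rw [map_sub]
      by_cases hwa : w = a
      · rw [hwa, h3, sub_self]
      · rw [hcon' w hw hwa, h.eq_zero_of_ne hu ha hv hw hav hau hvu hwa hwv, sub_self]
    · exact ⟨0, fun h => absurd h ht⟩
  choose w hw using hex
  have hw_inj : Set.InjOn w T := by
    intro t ht t' ht' he
    obtain ⟨h1, h2, h3, h4, h5⟩ := hsT t ht
    obtain ⟨h1', h2', h3', h4', h5'⟩ := hsT t' ht'
    obtain ⟨hw1, hw2, hw3⟩ := hw t ht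
    have hw3' := (hw t' ht').2.2
    rw [← he] at hw3'
    have hsub := h.sub_mem hU h1 h1' ha hw1 hw2.symm (by rwa [h3]) (by rw [h3, h3']) hw3 hw3'
    have hss : s t = s t' := by
      by_contra hne
      refine h5 ⟨⟨h1, fun hF => hau (by rw [← h3]; exact h.coord_span a ha _ hF),
        s t' - s t, by simpa using Submodule.neg_mem _ hsub, sub_ne_zero.2 (Ne.symm hne), by simpa⟩,
        h2, fun hF => hvu ?_, s t - s t', hsub, sub_ne_zero.2 hne, by simpa⟩
      have := h.coord_span v hv _ hF
      rwa [map_sub, h4, sub_zero] at this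
    simp only [hs] at hss
    split_ifs at hss with h6 h7 h7
    · simpa using hss
    · exact (hTinj t' ht' t ht hss.symm).symm
    · exact hTinj t ht t' ht' hss
    · exact hss
  refine ⟨T.image w, ?_, ?_, ?_⟩
  · intro x hx
    obtain ⟨t, ht, rfl⟩ := Finset.mem_image.1 hx
    exact (hw t ht).1
  · rw [Finset.card_image_of_injOn hw_inj]
    have := h.card
    omega
  · intro x hx hxa u' hu' hl hau' hxu'
    obtain ⟨t, ht, rfl⟩ := Finset.mem_image.1 hx
    obtain ⟨h1, h2, h3, h4, h5⟩ := hsT t ht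
    obtain ⟨hw1, hw2, hw3⟩ := hw t ht
    have hsub := h.sub_mem hU h1 hu' ha hw1 hw2.symm (by rwa [h3]) (by rw [h3, hau']) hw3 hxu'
    have : s t = u' := by
      by_contra hne
      refine hl ⟨hu', fun hF => hau (by rw [← hau']; exact h.coord_span a ha _ hF), s t - u', hsub,
        sub_ne_zero.2 hne, by simpa⟩
    rwa [← this]

theorem exists_star_of_short (hS : ThreeModular S) (hN : NoGain S) (h : Frame S Y ι c) {K P : ℕ}
    {U : Finset V} (hUS : U ⊆ S)
    (hcl : ∀ u ∈ U, ¬ Closure K S (Long S (Submodule.span ℚ (Y : Set V))) u) {a : V} (ha : a ∈ ι)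
    {ε : ℚ} (hε : ε ≠ 0) (haU : ∀ u ∈ U, c a u = ε)
    (hcard : P * (7 ^ (Y.card + 1) + K + 1) ≤ U.card) :
    ∃ J v, StarSystem S ι c J v a ε ∧ J.card = P := by
  classical
  have hU := hS.uniMod_of_hasBadCoord h.subset h.indep h.bad
  set F := Submodule.span ℚ (Y : Set V) with hF
  have hshort : ∀ u ∈ U, ¬ Long S F u := fun u hu hl => hcl u hu (Or.inl hl)
  have hex : ∀ u, ∃ v, u ∈ U → v ∈ ι ∧ v ≠ a ∧ c v u ≠ 0 := by
    intro u
    by_cases hu : u ∈ U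
    · obtain ⟨v, h1, h2, h3⟩ := h.exists_vertex hS.neg_mem (hUS hu) (hshort u hu) ha
        (by rwa [haU u hu])
      exact ⟨v, fun _ => ⟨h1, h2, h3⟩⟩
    · exact ⟨0, fun h => absurd h hu⟩
  choose v hv using hex
  have hinj : ∀ u ∈ U, ∀ u' ∈ U, v u = v u' → u = u' := by
    intro u hu u' hu' he
    obtain ⟨h1, h2, h3⟩ := hv u hu
    have h3' := (hv u' hu').2.2
    rw [← he] at h3'
    have hsub := h.sub_mem hU (hUS hu) (hUS hu') ha h1 h2.symm (by rwa [haU u hu])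
      (by rw [haU u hu, haU u' hu']) h3 h3'
    by_contra hne
    refine hshort u' hu' ⟨hUS hu', fun hF => hε ?_, u - u', hsub, sub_ne_zero.2 hne, ?_⟩
    · rw [← haU u' hu']; exact h.coord_span a ha _ hF
    · simpa using hUS hu
  obtain ⟨J, hJU, hJP, hJ⟩ := exists_clique (r := fun u u' => u - u' ∈ S)
    (fun u u' h => by simpa using hS.neg_mem _ h) P U (M := 7 ^ (Y.card + 1) + K) (by
      intro u hu
      obtain ⟨h1, h2, h3⟩ := hv u hu
      obtain ⟨N, hN, hNcard, hNu⟩ := hS.exists_neighbors hN h (hUS hu) (hcl u hu) ha h1 h2.symm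
        (by rwa [haU u hu]) h3
      have hle : (U.filter fun u' => ¬ (u - u' ∈ S)).card ≤ (ι \ N).card := by
        apply Finset.card_le_card_of_injOn v
        · intro u' hu'
          obtain ⟨h4, h5⟩ := Finset.mem_filter.1 hu'
          refine Finset.mem_coe.2 (Finset.mem_sdiff.2 ⟨(hv u' h4).1, fun h6 => h5 ?_⟩)
          exact hNu _ h6 (hv u' h4).2.1 u' (hUS h4) (hshort u' h4) (by rw [haU u hu, haU u' h4])
            (hv u' h4).2.2
        · intro x hx y hy hxy
          exact hinj x (Finset.mem_of_mem_filter x hx) y (Finset.mem_of_mem_filter y hy) hxy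
      rw [Finset.card_sdiff_of_subset hN] at hle
      generalize 7 ^ (Y.card + 1) = q at *
      omega) hcard
  refine ⟨J, v, ⟨hJU.trans hUS, ha, fun u hu => (hv u (hJU hu)).1, fun u hu => (hv u (hJU hu)).2.1,
    fun u hu u' hu' => hinj u (hJU hu) u' (hJU hu'), fun u hu => (hv u (hJU hu)).2.2,
    fun u hu => haU u (hJU hu), fun u hu x hx hxa hxv => ?_, hJ⟩, hJP⟩
  obtain ⟨h1, h2, h3⟩ := hv u (hJU hu)
  exact h.eq_zero_of_ne (hUS (hJU hu)) ha h1 hx h2.symm (by rwa [haU u (hJU hu)]) h3 hxa hxv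

end ThreeModular

theorem exists_star (k P : ℕ) : ∃ R : ℕ, ∀ {V : Type*} [AddCommGroup V] [Module ℚ V]
    [FiniteDimensional ℚ V] {S Y ι : Finset V} {c : V → V →ₗ[ℚ] ℚ}, ThreeModular S → NoGain S →
    Frame S Y ι c → Y.card = k → R ≤ finrank ℚ V →
    ∃ J v a ε, StarSystem S ι c J v a ε ∧ J.card = P := by
  classical
  obtain ⟨K, hK⟩ := ThreeModular.exists_not_closure k
  obtain ⟨R, hR⟩ := hK K le_rfl
  refine ⟨R + 2 * (P * (7 ^ (k + 1) + K + 1)) + (7 ^ (k + 1) + K), ?_⟩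
  intro V _ _ _ S Y ι c hS hN h hk hr
  have hU := hS.uniMod_of_hasBadCoord h.subset h.indep h.bad
  obtain ⟨y, hy, hyF, hcl⟩ := hR hS hN Y h.subset h.indep hk hU
    ((Nat.le_add_right _ _).trans ((Nat.le_add_right _ _).trans hr))
  set F := Submodule.span ℚ (Y : Set V) with hF
  obtain ⟨a, ha, hay⟩ : ∃ a ∈ ι, c a y ≠ 0 := by
    by_contra! hcon
    exact hyF (h.mem_span y hcon)
  obtain ⟨b, hb, hba, hby⟩ := h.exists_vertex hS.neg_mem hy
    (fun hl => hcl (Or.inl (Or.inl hl))) ha hay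
  obtain ⟨T, hT, hTinj, hTcard⟩ := hS.exists_triangles_closure hN h hy hyF hcl
  set s : V → V := fun t => if Closure K S (Long S F) t then y - t else t with hs
  have hsT : ∀ t ∈ T, s t ∈ S ∧ ¬ Closure K S (Long S F) (s t) ∧
      (c a (s t) = c a y ∨ c b (s t) = c b y) := by
    intro t ht
    obtain ⟨h1, h2, h3, h4⟩ := hT t ht
    have h5 := h.triangle hy h1 h2 h3 ha hb hba.symm hay hby
    simp only [hs]
    split_ifs with h6
    · refine ⟨h2, fun h7 => h4 ⟨h6, h7⟩, ?_⟩
      rcases h5 with h5 | h5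
      · right; rw [map_sub, h5.2, sub_zero]
      · left; rw [map_sub, h5.1, sub_zero]
    · exact ⟨h1, h6, h5.imp And.left And.right⟩
  have hinj : Set.InjOn s T := by
    intro t ht t' ht' he
    simp only [hs] at he
    split_ifs at he
    · simpa using he
    · exact (hTinj t' ht' t ht he.symm).symm
    · exact hTinj t ht t' ht' he
    · exact he
  set U := T.image s with hUdef
  have hUcard : U.card = T.card := Finset.card_image_of_injOn hinj
  have hUT : ∀ u ∈ U, u ∈ S ∧ ¬ Closure K S (Long S F) u ∧ (c a u = c a y ∨ c b u = c b y) := by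
    intro u hu
    obtain ⟨t, ht, rfl⟩ := Finset.mem_image.1 hu
    exact hsT t ht
  have hsplit : U.card ≤ (U.filter fun u => c a u = c a y).card +
      (U.filter fun u => c b u = c b y).card := by
    refine (Finset.card_le_card ?_).trans (Finset.card_union_le _ _)
    intro u hu
    rcases (hUT u hu).2.2 with h1 | h1 <;> simp [hu, h1]
  have key : ∀ x ∈ ι, c x y ≠ 0 →
      P * (7 ^ (k + 1) + K + 1) ≤ (U.filter fun u => c x u = c x y).card →
      ∃ J v a ε, StarSystem S ι c J v a ε ∧ J.card = P := by
    intro x hx hxy hcard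
    obtain ⟨J, v, h1, h2⟩ := hS.exists_star_of_short hN h (K := K) (P := P)
      (U := U.filter fun u => c x u = c x y)
      (fun u hu => (hUT u (Finset.mem_of_mem_filter u hu)).1)
      (fun u hu => (hUT u (Finset.mem_of_mem_filter u hu)).2.1) hx hxy
      (fun u hu => (Finset.mem_filter.1 hu).2) (by rwa [hk])
    exact ⟨J, v, x, _, h1, h2⟩
  rw [hk] at hTcard
  by_cases h1 : P * (7 ^ (k + 1) + K + 1) ≤ (U.filter fun u => c a u = c a y).card
  · exact key a ha hay h1
  · refine key b hb hby ?_
    generalize P * (7 ^ (k + 1) + K + 1) = p at *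
    generalize 7 ^ (k + 1) = q at *
    omega

end

section

open Module

/-- A Sauer-Shelah argument: a set of `0/1`-vectors on `I` with at least `|I| + 1` elements,
together with one more vector `A`, has all patterns on some pair of coordinates. -/
theorem exists_pair_of_card_le {ι α : Type*} {Q : Finset α} {I : Finset ι} {h : ι → α → ℚ}
    (hinj : ∀ q ∈ Q, ∀ q' ∈ Q, (∀ j ∈ I, h j q = h j q') → q = q')
    (h01 : ∀ q ∈ Q, ∀ j ∈ I, h j q = 0 ∨ h j q = 1) {A : ι → ℚ} (hA01 : ∀ j ∈ I, A j = 0 ∨ A j = 1)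
    (hcard : I.card + 1 ≤ Q.card) (hA : ∀ q ∈ Q, ∃ j ∈ I, h j q ≠ A j) :
    ∃ j ∈ I, ∃ l ∈ I, j ≠ l ∧ ∀ s t : ℚ, (s = 0 ∨ s = 1) → (t = 0 ∨ t = 1) →
      (s ≠ A j ∨ t ≠ A l) → ∃ q ∈ Q, h j q = s ∧ h l q = t := by
  classical
  set g : (ι → ℚ) → Finset ι := fun v => I.filter fun j => v j = 1 with hg
  have hg_inj : ∀ v w : ι → ℚ, (∀ j ∈ I, v j = 0 ∨ v j = 1) → (∀ j ∈ I, w j = 0 ∨ w j = 1) →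
      g v = g w → ∀ j ∈ I, v j = w j := by
    intro v w hv hw he j hj
    have h1 : j ∈ g v ↔ j ∈ g w := by rw [he]
    simp only [hg, Finset.mem_filter, hj, true_and] at h1
    rcases hv j hj with h2 | h2 <;> rcases hw j hj with h3 | h3
    · rw [h2, h3]
    · rw [h1.2 h3, h3]
    · rw [h2, h1.1 h2]
    · rw [h2, h3]
  set 𝒜 := insert (g A) (Q.image fun q => g fun j => h j q) with h𝒜
  have hAnot : g A ∉ Q.image fun q => g fun j => h j q := by
    intro hm
    obtain ⟨q, hq, he⟩ := Finset.mem_image.1 hm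
    obtain ⟨j, hj, hne⟩ := hA q hq
    exact hne (hg_inj _ _ (h01 q hq) hA01 he j hj)
  have hcard𝒜 : 𝒜.card = Q.card + 1 := by
    rw [h𝒜, Finset.card_insert_of_notMem hAnot, Finset.card_image_of_injOn]
    intro q hq q' hq' he
    exact hinj q hq q' hq' (hg_inj _ _ (h01 q hq) (h01 q' hq') he)
  have hsub𝒜 : ∀ u ∈ 𝒜, u ⊆ I := by
    intro u hu
    rcases Finset.mem_insert.1 hu with rfl | hu
    · exact Finset.filter_subset _ _
    · obtain ⟨q, -, rfl⟩ := Finset.mem_image.1 hu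
      exact Finset.filter_subset _ _
  obtain ⟨B, hB, hBnot⟩ : ∃ B ∈ 𝒜.shatterer, B ∉ insert ∅ (I.image fun j => ({j} : Finset ι)) := by
    by_contra! hcon
    have h1 := Finset.card_le_card hcon
    have h2 := Finset.card_le_card_shatterer 𝒜
    have h3 := Finset.card_insert_le ∅ (I.image fun j => ({j} : Finset ι))
    have h4 := Finset.card_image_le (s := I) (f := fun j => ({j} : Finset ι))
    omega
  have hBs := Finset.mem_shatterer.1 hB
  have hBI : B ⊆ I := by
    obtain ⟨u, hu, he⟩ := hBs subset_rfl
    exact (Finset.inter_eq_left.1 he).trans (hsub𝒜 u hu)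
  obtain ⟨j, hj, l, hl, hjl⟩ : ∃ j ∈ B, ∃ l ∈ B, j ≠ l := by
    by_contra! hcon
    apply hBnot
    rcases B.eq_empty_or_nonempty with h1 | ⟨j, hj⟩
    · rw [h1]; exact Finset.mem_insert_self _ _
    · refine Finset.mem_insert_of_mem (Finset.mem_image.2 ⟨j, hBI hj, ?_⟩)
      ext l
      rw [Finset.mem_singleton]
      exact ⟨fun h => h ▸ hj, fun hl => (hcon j hj l hl).symm⟩
  refine ⟨j, hBI hj, l, hBI hl, hjl, fun s t hs ht hst => ?_⟩
  have hval : ∀ (v : ι → ℚ) (x : ι) (s : ℚ), x ∈ I → (v x = 0 ∨ v x = 1) → (s = 0 ∨ s = 1) →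
      (x ∈ g v ↔ s = 1) → v x = s := by
    intro v x s hx hv hs he
    simp only [hg, Finset.mem_filter, hx, true_and] at he
    rcases hv with h1 | h1 <;> rcases hs with h2 | h2
    · rw [h1, h2]
    · rw [he.2 h2, h2]
    · rw [h1, he.1 h1]
    · rw [h1, h2]
  obtain ⟨u, hu, he⟩ := hBs (t := B.filter fun x => (x = j ∧ s = 1) ∨ (x = l ∧ t = 1))
    (Finset.filter_subset _ _)
  have hju : j ∈ u ↔ s = 1 := by
    have : j ∈ B ∩ u ↔ s = 1 := by rw [he]; simp [hj, hjl]
    simpa [hj] using this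
  have hlu : l ∈ u ↔ t = 1 := by
    have : l ∈ B ∩ u ↔ t = 1 := by rw [he]; simp [hl, hjl.symm]
    simpa [hl] using this
  rcases Finset.mem_insert.1 hu with rfl | hu
  · exfalso
    rcases hst with h1 | h1
    · exact h1 (hval A j s (hBI hj) (hA01 j (hBI hj)) hs hju).symm
    · exact h1 (hval A l t (hBI hl) (hA01 l (hBI hl)) ht hlu).symm
  · obtain ⟨q, hq, rfl⟩ := Finset.mem_image.1 hu
    exact ⟨q, hq, hval (fun x => h x q) j s (hBI hj) (h01 q hq j (hBI hj)) hs hju,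
      hval (fun x => h x q) l t (hBI hl) (h01 q hq l (hBI hl)) ht hlu⟩

/-- Points of a finite set with coordinates in `[0, 1] ∩ μ⁻¹ ℤ` and with bounded `2 × 2` minors
of differences. -/
structure GridSystem {ι α : Type*} (Q : Finset α) (h : ι → α → ℚ) (a b : ι → α) (μ : ℕ) :
    Prop where
  a_mem : ∀ j, a j ∈ Q
  b_mem : ∀ j, b j ∈ Q
  coord_a : ∀ j, h j (a j) = 0
  coord_b : ∀ j, h j (b j) = 1
  coord_eq : ∀ i j, i ≠ j → h i (b j) = h i (a j)
  abs_sub_le : ∀ j, ∀ q ∈ Q, ∀ q' ∈ Q, |h j q - h j q'| ≤ 1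
  int : ∀ j, ∀ q ∈ Q, ∃ k : ℤ, μ * h j q = k
  minor_le : ∀ i j, i ≠ j → ∀ q ∈ Q, ∀ q' ∈ Q, ∀ s ∈ Q, ∀ s' ∈ Q,
    |(h i q - h i q') * (h j s - h j s') - (h i s - h i s') * (h j q - h j q')| ≤ 1
  minor_int : ∀ i j, i ≠ j → ∀ q ∈ Q, ∀ q' ∈ Q, ∀ s ∈ Q, ∀ s' ∈ Q, ∃ k : ℤ,
    μ * ((h i q - h i q') * (h j s - h j s') - (h i s - h i s') * (h j q - h j q')) = k
  sep : ∀ q ∈ Q, ∀ q' ∈ Q, (∀ j, h j q = h j q') → q = q'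

namespace GridSystem

variable {ι α : Type*} {Q : Finset α} {h : ι → α → ℚ} {a b : ι → α} {μ : ℕ}

theorem nonneg (H : GridSystem Q h a b μ) {q : α} (hq : q ∈ Q) (j : ι) : 0 ≤ h j q := by
  have := (abs_le.1 (H.abs_sub_le j q hq (b j) (H.b_mem j))).1
  rw [H.coord_b] at this
  linarith

theorem le_one (H : GridSystem Q h a b μ) {q : α} (hq : q ∈ Q) (j : ι) : h j q ≤ 1 := by
  have := (abs_le.1 (H.abs_sub_le j q hq (a j) (H.a_mem j))).2
  rw [H.coord_a] at this
  linarith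

theorem eq_zero_or_one (H : GridSystem Q h a b μ) {q : α} (hq : q ∈ Q) {j : ι}
    (hi : ∃ k : ℤ, h j q = k) : h j q = 0 ∨ h j q = 1 := by
  obtain ⟨k, hk⟩ := hi
  have h0 := H.nonneg hq j
  have h1 := H.le_one hq j
  rw [hk] at h0 h1 ⊢
  have h2 : 0 ≤ k := by exact_mod_cast h0
  have h3 : k ≤ 1 := by exact_mod_cast h1
  have : k = 0 ∨ k = 1 := by omega
  exact_mod_cast this

/-- Two points with equal `j`-coordinate opposite to that of `a g` have equal `g`-coordinate. -/
theorem coord_eq_of_opposite (H : GridSystem Q h a b μ) {j g : ι} (hg : g ≠ j) {q q' : α}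
    (hq : q ∈ Q) (hq' : q' ∈ Q) (hqq : h j q = h j q')
    (hopp : h j q - h j (a g) = 1 ∨ h j q - h j (a g) = -1) : h g q = h g q' := by
  have h1 := abs_le.1 (H.minor_le j g hg.symm q' hq' (b g) (H.b_mem g) q hq (a g) (H.a_mem g))
  have h2 := abs_le.1 (H.minor_le j g hg.symm q hq (b g) (H.b_mem g) q' hq' (a g) (H.a_mem g))
  rw [H.coord_eq j g hg.symm, H.coord_a, H.coord_b, ← hqq] at h1 h2
  rcases hopp with ho | ho <;> rw [ho] at h1 h2 <;> apply le_antisymm <;>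
    linarith [h1.1, h1.2, h2.1, h2.2]

/-- If a coordinate separates two points modulo `1`, it determines all coordinates modulo `1`. -/
theorem int_of_int (H : GridSystem Q h a b μ) (hμ : μ.Prime ∨ μ = 1) {i : ι} {s s' q q' : α}
    (hs : s ∈ Q) (hs' : s' ∈ Q) (hq : q ∈ Q) (hq' : q' ∈ Q) (hss : ¬ ∃ k : ℤ, h i s - h i s' = k)
    (hqq : ∃ k : ℤ, h i q - h i q' = k) (j : ι) : ∃ k : ℤ, h j q - h j q' = k := by
  by_cases hij : i = j
  · exact hij ▸ hqq
  obtain ⟨n1, h1⟩ := H.int i s hs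
  obtain ⟨n2, h2⟩ := H.int i s' hs'
  rcases hμ with hμ | hμ
  swap
  · refine absurd ⟨n1 - n2, ?_⟩ hss
    rw [hμ] at h1 h2
    push_cast at h1 h2 ⊢
    linarith
  obtain ⟨m, hm⟩ := hqq
  obtain ⟨n3, h3⟩ := H.int j q hq
  obtain ⟨n4, h4⟩ := H.int j q' hq'
  obtain ⟨n5, h5⟩ := H.int j s hs
  obtain ⟨n6, h6⟩ := H.int j s' hs'
  obtain ⟨k, hk⟩ := H.minor_int i j hij s hs s' hs' q hq q' hq'
  have hμ0 : (μ : ℚ) ≠ 0 := by exact_mod_cast hμ.ne_zero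
  have key : (n1 - n2) * (n3 - n4) = (μ : ℤ) * (k + m * (n5 - n6)) := by
    have : ((n1 : ℚ) - n2) * (n3 - n4) = μ * (k + m * (n5 - n6)) := by
      rw [← h1, ← h2, ← h3, ← h4, ← h5, ← h6, ← hk, ← hm]
      ring
    exact_mod_cast this
  rcases (Nat.prime_iff_prime_int.1 hμ).dvd_or_dvd ⟨_, key⟩ with ⟨w, hw⟩ | ⟨w, hw⟩
  · refine absurd ⟨w, ?_⟩ hss
    have : ((n1 : ℚ) - n2) = μ * w := by exact_mod_cast hw
    rw [← h1, ← h2] at this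
    exact mul_left_cancel₀ hμ0 (by linarith)
  · refine ⟨w, ?_⟩
    have : ((n3 : ℚ) - n4) = μ * w := by exact_mod_cast hw
    rw [← h3, ← h4] at this
    exact mul_left_cancel₀ hμ0 (by linarith)

theorem int_a_of_ne (H : GridSystem Q h a b μ) (hμ : μ.Prime ∨ μ = 1) {q q' : α} (hq : q ∈ Q)
    (hq' : q' ∈ Q) (hqq : ∀ g, ∃ k : ℤ, h g q - h g q' = k) {j : ι} (hj : h j q ≠ h j q') (g : ι) :
    ∃ k : ℤ, h g q - h g (a j) = k := by
  wlog h0 : h j q ≤ h j q' generalizing q q'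
  · obtain ⟨k, hk⟩ := this hq' hq (fun g => by
      obtain ⟨k, hk⟩ := hqq g
      exact ⟨-k, by push_cast; rw [← hk]; ring⟩) hj.symm (le_of_not_ge h0)
    obtain ⟨k', hk'⟩ := hqq g
    exact ⟨k' + k, by push_cast; rw [← hk, ← hk']; ring⟩
  have h01 : h j q = 0 ∧ h j q' = 1 := by
    obtain ⟨k, hk⟩ := hqq j
    have h1 := H.nonneg hq j
    have h2 := H.le_one hq' j
    have h3 : (k : ℚ) < 0 := by rw [← hk]; linarith [lt_of_le_of_ne h0 hj]
    have h4 : k ≤ -1 := by have : k < 0 := by exact_mod_cast h3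
                           omega
    have h5 : (k : ℚ) ≤ -1 := by exact_mod_cast h4
    constructor <;> linarith
  by_cases hall : ∃ s ∈ Q, ¬ ∃ k : ℤ, h j s - h j (a j) = k
  · obtain ⟨s, hs, hsk⟩ := hall
    exact H.int_of_int hμ hs (H.a_mem j) hq (H.a_mem j) hsk
      ⟨0, by rw [h01.1, H.coord_a]; norm_num⟩ g
  · push Not at hall
    by_cases hg : g = j
    · exact ⟨0, by rw [hg, h01.1, H.coord_a]; norm_num⟩
    rcases H.eq_zero_or_one (j := j) (H.a_mem g) (by
      obtain ⟨k, hk⟩ := hall _ (H.a_mem g)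
      exact ⟨k, by rw [← hk, H.coord_a, sub_zero]⟩) with h1 | h1
    · have h2 := H.coord_eq_of_opposite hg hq' (H.b_mem j) (by rw [h01.2, H.coord_b])
        (Or.inl (by rw [h01.2, h1, sub_zero]))
      rw [H.coord_eq g j hg] at h2
      rw [← h2]
      exact hqq g
    · have h2 := H.coord_eq_of_opposite hg hq (H.a_mem j) (by rw [h01.1, H.coord_a])
        (Or.inr (by rw [h01.1, h1, zero_sub]))
      exact ⟨0, by rw [h2]; norm_num⟩

/-- The points congruent modulo `1`: their number, and the patterns they realize. -/
theorem class_card_le (H : GridSystem Q h a b μ) {C : Finset α}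
    {I : Finset ι} (hC : C ⊆ Q) (hdet : ∀ q ∈ C, ∀ q' ∈ C, ∀ j, h j q ≠ h j q' → j ∈ I)
    (h01 : ∀ q ∈ C, ∀ j ∈ I, h j q = 0 ∨ h j q = 1) : C.card ≤ I.card + 1 := by
  classical
  by_contra! hcon
  obtain ⟨q0, hq0⟩ : C.Nonempty := Finset.card_pos.1 (by omega)
  have hinj : ∀ q ∈ C, ∀ q' ∈ C, (∀ j ∈ I, h j q = h j q') → q = q' := by
    intro q hq q' hq' he
    apply H.sep q (hC hq) q' (hC hq')
    intro j
    by_contra hne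
    exact hne (he j (hdet q hq q' hq' j hne))
  have hsub : ∀ q ∈ C.erase q0, q ∈ C := fun q hq => Finset.mem_of_mem_erase hq
  obtain ⟨j, hj, l, hl, hjl, hp⟩ := exists_pair_of_card_le (Q := C.erase q0) (I := I) (h := h)
    (A := fun j => h j q0) (fun q hq q' hq' => hinj q (hsub q hq) q' (hsub q' hq'))
    (fun q hq => h01 q (hsub q hq)) (h01 q0 hq0) (by rw [Finset.card_erase_of_mem hq0]; omega) (by
      intro q hq
      by_contra! hcon
      exact Finset.ne_of_mem_erase hq (hinj q (hsub q hq) q0 hq0 hcon))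
  have hp' : ∀ s t : ℚ, (s = 0 ∨ s = 1) → (t = 0 ∨ t = 1) → ∃ q ∈ Q, h j q = s ∧ h l q = t := by
    intro s t hs ht
    by_cases hst : s ≠ h j q0 ∨ t ≠ h l q0
    · obtain ⟨q, hq, he⟩ := hp s t hs ht hst
      exact ⟨q, hC (hsub q hq), he⟩
    · push Not at hst
      exact ⟨q0, hC hq0, hst.1.symm, hst.2.symm⟩
  obtain ⟨q1, hq1, e1, e1'⟩ := hp' 0 0 (by simp) (by simp)
  obtain ⟨q2, hq2, e2, e2'⟩ := hp' 1 1 (by simp) (by simp)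
  obtain ⟨q3, hq3, e3, e3'⟩ := hp' 1 0 (by simp) (by simp)
  obtain ⟨q4, hq4, e4, e4'⟩ := hp' 0 1 (by simp) (by simp)
  have := abs_le.1 (H.minor_le j l hjl q2 hq2 q1 hq1 q3 hq3 q4 hq4)
  rw [e1, e1', e2, e2', e3, e3', e4, e4'] at this
  norm_num at this

end GridSystem

end

section

open Module

namespace GridSystem

variable {ι α : Type*} {Q : Finset α} {h : ι → α → ℚ} {a b : ι → α} {μ : ℕ}

theorem card_class_le [Fintype ι] [DecidableEq ι] [DecidableEq α] (H : GridSystem Q h a b μ)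
    (hμ : μ.Prime ∨ μ = 1) {cl : α → ℤ}
    (hcl : ∀ q ∈ Q, ∀ q' ∈ Q, cl q = cl q' ↔ ∀ g, ∃ k : ℤ, h g q - h g q' = k) (c : ℤ) :
    (∀ q ∈ Q.filter (cl · = c), ∀ q' ∈ Q.filter (cl · = c), ∀ j, h j q ≠ h j q' →
      j ∈ Finset.univ.filter fun j => cl (a j) = c) ∧
    (∀ q ∈ Q.filter (cl · = c), ∀ j ∈ Finset.univ.filter (fun j => cl (a j) = c),
      h j q = 0 ∨ h j q = 1) ∧
    (Q.filter (cl · = c)).card ≤ (Finset.univ.filter fun j => cl (a j) = c).card + 1 := by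
  have h1 : ∀ q ∈ Q.filter (cl · = c), ∀ q' ∈ Q.filter (cl · = c), ∀ j, h j q ≠ h j q' →
      j ∈ Finset.univ.filter fun j => cl (a j) = c := by
    intro q hq q' hq' j hne
    obtain ⟨hq1, hq2⟩ := Finset.mem_filter.1 hq
    obtain ⟨hq1', hq2'⟩ := Finset.mem_filter.1 hq'
    refine Finset.mem_filter.2 ⟨Finset.mem_univ _, ?_⟩
    rw [← hq2, eq_comm, hcl q hq1 _ (H.a_mem j)]
    exact H.int_a_of_ne hμ hq1 hq1' ((hcl q hq1 q' hq1').1 (hq2.trans hq2'.symm)) hne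
  have h2 : ∀ q ∈ Q.filter (cl · = c), ∀ j ∈ Finset.univ.filter (fun j => cl (a j) = c),
      h j q = 0 ∨ h j q = 1 := by
    intro q hq j hj
    obtain ⟨hq1, hq2⟩ := Finset.mem_filter.1 hq
    apply H.eq_zero_or_one hq1
    obtain ⟨k, hk⟩ := (hcl q hq1 _ (H.a_mem j)).1 (hq2.trans (Finset.mem_filter.1 hj).2.symm) j
    exact ⟨k, by rw [← hk, H.coord_a, sub_zero]⟩
  exact ⟨h1, h2, H.class_card_le (Finset.filter_subset _ _) h1 h2⟩

theorem card_eq_sum [Fintype ι] [DecidableEq α] {T : Finset ℤ} (H : GridSystem Q h a b μ)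
    {cl : α → ℤ} (hT : ∀ q ∈ Q, cl q ∈ T) :
    Q.card = ∑ c ∈ T, (Q.filter (cl · = c)).card ∧
    Fintype.card ι + T.card =
      ∑ c ∈ T, ((Finset.univ.filter fun j => cl (a j) = c).card + 1) := by
  refine ⟨Finset.card_eq_sum_card_fiberwise hT, ?_⟩
  rw [Finset.sum_add_distrib, ← Finset.card_eq_sum_card_fiberwise fun j _ => hT _ (H.a_mem j)]
  simp

/-- Classes modulo `1` are determined by one coordinate. -/
theorem exists_class (H : GridSystem Q h a b μ) (hμ : μ.Prime ∨ μ = 1) :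
    (∀ q ∈ Q, ∀ q' ∈ Q, ∀ g, ∃ k : ℤ, h g q - h g q' = k) ∨
    ∃ i, ∃ n : α → ℤ, (∀ q ∈ Q, μ * h i q = n q) ∧ ∀ q ∈ Q, ∀ q' ∈ Q,
      n q % μ = n q' % μ ↔ ∀ g, ∃ k : ℤ, h g q - h g q' = k := by
  by_cases hall : ∀ q ∈ Q, ∀ q' ∈ Q, ∀ g, ∃ k : ℤ, h g q - h g q' = k
  · exact Or.inl hall
  right
  push Not at hall
  obtain ⟨s, hs, s', hs', i, hne⟩ := hall
  have hex : ∀ q, ∃ n : ℤ, q ∈ Q → μ * h i q = n := by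
    intro q
    by_cases hq : q ∈ Q
    · obtain ⟨k, hk⟩ := H.int i q hq
      exact ⟨k, fun _ => hk⟩
    · exact ⟨0, fun h => absurd h hq⟩
  choose n hn using hex
  have hμ0 : (μ : ℚ) ≠ 0 := by
    rcases hμ with hμ | hμ
    · exact_mod_cast hμ.ne_zero
    · rw [hμ]; norm_num
  refine ⟨i, n, hn, fun q hq q' hq' => ?_⟩
  constructor
  · intro he g
    refine H.int_of_int hμ hs hs' hq hq' (by push Not; exact hne) ?_ g
    obtain ⟨k, hk⟩ := Int.ModEq.dvd (show n q' ≡ n q [ZMOD μ] from he.symm)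
    refine ⟨k, mul_left_cancel₀ hμ0 ?_⟩
    rw [mul_sub, hn q hq, hn q' hq']
    exact_mod_cast hk
  · intro hsame
    obtain ⟨k, hk⟩ := hsame i
    have : n q = n q' + μ * k := by
      have : (n q : ℚ) = n q' + μ * k := by
        rw [← hn q hq, ← hn q' hq', ← hk]; ring
      exact_mod_cast this
    rw [this, Int.add_mul_emod_self_left]

theorem card_le [Fintype ι] (H : GridSystem Q h a b μ) (hμ : μ.Prime ∨ μ = 1) :
    Q.card ≤ Fintype.card ι + μ := by
  classical
  have key : ∀ (cl : α → ℤ) (T : Finset ℤ), T.card ≤ μ → (∀ q ∈ Q, cl q ∈ T) →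
      (∀ q ∈ Q, ∀ q' ∈ Q, cl q = cl q' ↔ ∀ g, ∃ k : ℤ, h g q - h g q' = k) →
      Q.card ≤ Fintype.card ι + μ := by
    intro cl T hTμ hT hcl
    obtain ⟨h1, h2⟩ := H.card_eq_sum hT
    have h3 := Finset.sum_le_sum fun c (_ : c ∈ T) => (H.card_class_le hμ hcl c).2.2
    omega
  have hμ0 : 0 < μ := by
    rcases hμ with hμ | hμ
    · exact hμ.pos
    · omega
  rcases H.exists_class hμ with hall | ⟨i, n, hn, hcl⟩
  · exact key (fun _ => 0) {0} (by rw [Finset.card_singleton]; exact hμ0) (by simp) fun q hq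
      q' hq' =>
      ⟨fun _ => hall q hq q' hq', fun _ => rfl⟩
  · refine key (fun q => n q % μ) (Finset.Ico 0 μ) (by simp) (fun q _ => ?_) hcl
    have h0 : (0 : ℤ) < μ := by exact_mod_cast hμ0
    exact Finset.mem_Ico.2 ⟨Int.emod_nonneg _ h0.ne', Int.emod_lt_of_pos _ h0⟩

/-- A planar configuration incompatible with the bound on minors. -/
theorem false_of_pattern (H : GridSystem Q h a b μ) {j l : ι} (hjl : j ≠ l) {p₁ p₂ p₃ w : α}
    (hp₁ : p₁ ∈ Q) (hp₂ : p₂ ∈ Q) (hp₃ : p₃ ∈ Q) (hw : w ∈ Q) {s t : ℚ}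
    (hs : s = 0 ∨ s = 1) (ht : t = 0 ∨ t = 1) (h₁ : h j p₁ = 1 - s ∧ h l p₁ = t)
    (h₂ : h j p₂ = s ∧ h l p₂ = 1 - t) (h₃ : h j p₃ = 1 - s ∧ h l p₃ = 1 - t)
    (hwj : h j w = s ∨ h j w = s + (1 - 2 * s) / 3)
    (hwl : h l w = t ∨ h l w = t + (1 - 2 * t) / 3) : False := by
  have m := abs_le.1 (H.minor_le j l hjl p₃ hp₃ w hw p₁ hp₁ p₂ hp₂)
  rw [h₁.1, h₁.2, h₂.1, h₂.2, h₃.1, h₃.2] at m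
  clear h₁ h₂ h₃
  rcases hwj with e | e <;> rcases hwl with e' | e' <;> rw [e, e'] at m <;> clear e e' <;>
    rcases hs with rfl | rfl <;> rcases ht with rfl | rfl <;> revert m <;> norm_num

/-- In the extremal case `μ = 3`, and some translation maps three points to three points. -/
theorem exists_shift [Fintype ι] [DecidableEq α] (H : GridSystem Q h a b μ)
    (hμ : μ = 1 ∨ μ = 2 ∨ μ = 3) (hcard : Fintype.card ι + 3 ≤ Q.card) :
    ∃ τ : ι → ℚ, (∃ i, τ i ≠ 0) ∧ ∃ E ⊆ Q, E.card = 3 ∧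
      ∀ e ∈ E, ∃ s ∈ Q, ∀ j, h j e = h j s + τ j := by
  classical
  have hμp : μ.Prime ∨ μ = 1 := by
    rcases hμ with rfl | rfl | rfl
    · exact Or.inr rfl
    · exact Or.inl Nat.prime_two
    · exact Or.inl Nat.prime_three
  have hle := H.card_le hμp
  obtain rfl : μ = 3 := by omega
  have hclass := H.exists_class hμp
  have hnot : ¬ ∀ q ∈ Q, ∀ q' ∈ Q, ∀ g, ∃ k : ℤ, h g q - h g q' = k := by
    intro hall
    obtain ⟨h1, h2⟩ := H.card_eq_sum (cl := fun _ => 0) (T := {0}) (by simp)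
    have h3 := (H.card_class_le hμp (cl := fun _ => 0)
      (fun q hq q' hq' => ⟨fun _ => hall q hq q' hq', fun _ => rfl⟩) 0).2.2
    rw [Finset.sum_singleton] at h1 h2
    rw [Finset.card_singleton] at h2
    omega
  obtain ⟨i, m, hm, hcl⟩ := hclass.resolve_left hnot
  set cl : α → ℤ := fun q => m q % 3 with hcl_def
  have hcl' : ∀ q ∈ Q, ∀ q' ∈ Q, cl q = cl q' ↔ ∀ g, ∃ k : ℤ, h g q - h g q' = k := hcl
  have hm' : ∀ q ∈ Q, 3 * h i q = m q := fun q hq => by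
    have := hm q hq; push_cast at this; exact this
  have hCI := H.card_class_le hμp hcl'
  obtain ⟨hsum1, hsum2⟩ := H.card_eq_sum (cl := cl) (T := Finset.Ico 0 3) (fun q _ => by
    simp only [hcl_def, Finset.mem_Ico]; omega)
  have hfull : ∀ c ∈ Finset.Ico (0 : ℤ) 3,
      (Finset.univ.filter fun j => cl (a j) = c).card + 1 ≤ (Q.filter (cl · = c)).card := by
    have h3 := (Finset.sum_eq_sum_iff_of_le fun c (_ : c ∈ Finset.Ico (0 : ℤ) 3) =>
      (hCI c).2.2).1 (le_antisymm (Finset.sum_le_sum fun c _ => (hCI c).2.2) (by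
        rw [← hsum1, ← hsum2]; simpa using hcard))
    exact fun c hc => (h3 c hc).ge
  have hW : ∀ c, ∃ w, c ∈ Finset.Ico (0 : ℤ) 3 → w ∈ Q ∧ cl w = c := by
    intro c
    by_cases hc : c ∈ Finset.Ico (0 : ℤ) 3
    · obtain ⟨w, hw⟩ : (Q.filter (cl · = c)).Nonempty :=
        Finset.card_pos.1 (lt_of_lt_of_le (Nat.succ_pos _) (hfull c hc))
      exact ⟨w, fun _ => Finset.mem_filter.1 hw⟩
    · obtain ⟨w, hw⟩ : Q.Nonempty := ⟨_, H.a_mem i⟩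
      exact ⟨w, fun h => absurd h hc⟩
  choose W hW using hW
  have hWQ : ∀ c, 0 ≤ c → c < 3 → W c ∈ Q ∧ cl (W c) = c := fun c h0 h3 =>
    hW c (Finset.mem_Ico.2 ⟨h0, h3⟩)
  have hn : ∀ j q, ∃ n : ℤ, q ∈ Q → 3 * h j q = n ∧ 0 ≤ n ∧ n ≤ 3 := by
    intro j q
    by_cases hq : q ∈ Q
    · obtain ⟨n, hn⟩ := H.int j q hq
      push_cast at hn
      refine ⟨n, fun _ => ⟨hn, ?_, ?_⟩⟩
      · have : (0 : ℚ) ≤ n := by rw [← hn]; linarith [H.nonneg hq j]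
        exact_mod_cast this
      · have : (n : ℚ) ≤ 3 := by rw [← hn]; linarith [H.le_one hq j]
        exact_mod_cast this
    · exact ⟨0, fun h => absurd h hq⟩
  choose n hn using hn
  have hτ : ∀ j, ∃ τ : ℤ, (τ = 0 ∨ τ = 1 ∨ τ = -1) ∧ (j = i → τ = 1) ∧
      ∀ q ∈ Q, ∀ q' ∈ Q, (n j q - n j q' - τ * (m q - m q')) % 3 = 0 := by
    intro j
    obtain ⟨hw0, hc0⟩ := hWQ 0 (by norm_num) (by norm_num)
    obtain ⟨hw1, hc1⟩ := hWQ 1 (by norm_num) (by norm_num)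
    simp only [hcl_def] at hc0 hc1
    by_cases hij : i = j
    · subst hij
      refine ⟨1, by simp, by simp, fun q hq q' hq' => ?_⟩
      have h1 : n i q = m q := by
        have := (hn i q hq).1; rw [hm' q hq] at this; exact_mod_cast this.symm
      have h2 : n i q' = m q' := by
        have := (hn i q' hq').1; rw [hm' q' hq'] at this; exact_mod_cast this.symm
      rw [h1, h2]; simp
    · obtain ⟨τ, β, hτ, hτβ⟩ : ∃ τ β : ℤ, (τ = 0 ∨ τ = 1 ∨ τ = -1) ∧
          n j (W 1) - n j (W 0) = τ + 3 * β := by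
        have h1 : (n j (W 1) - n j (W 0)) % 3 = 0 ∨ (n j (W 1) - n j (W 0)) % 3 = 1 ∨
          (n j (W 1) - n j (W 0)) % 3 = 2 := by omega
        rcases h1 with h1 | h1 | h1
        · exact ⟨0, (n j (W 1) - n j (W 0)) / 3, by simp, by omega⟩
        · exact ⟨1, (n j (W 1) - n j (W 0)) / 3, by simp, by omega⟩
        · exact ⟨-1, (n j (W 1) - n j (W 0) + 1) / 3, by simp, by omega⟩
      obtain ⟨γ, hγ⟩ : ∃ γ : ℤ, m (W 1) - m (W 0) = 1 + 3 * γ :=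
        ⟨(m (W 1) - m (W 0)) / 3, by omega⟩
      refine ⟨τ, hτ, fun h => absurd h.symm hij, fun q hq q' hq' => ?_⟩
      obtain ⟨k, hk⟩ := H.minor_int i j hij _ hw1 _ hw0 q hq q' hq'
      have e : (m (W 1) - m (W 0)) * (n j q - n j q') -
          (m q - m q') * (n j (W 1) - n j (W 0)) = 3 * k := by
        have : ((m (W 1) : ℚ) - m (W 0)) * (n j q - n j q') -
            (m q - m q') * (n j (W 1) - n j (W 0)) = 3 * k := by
          rw [← hk, ← hm' _ hw1, ← hm' _ hw0, ← hm' q hq, ← hm' q' hq', ← (hn j _ hw1).1,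
            ← (hn j _ hw0).1, ← (hn j q hq).1, ← (hn j q' hq').1]
          push_cast
          ring
        exact_mod_cast this
      rw [hγ, hτβ] at e
      apply Int.emod_eq_zero_of_dvd
      exact ⟨k - γ * (n j q - n j q') + (m q - m q') * β, by linear_combination e⟩
  choose τ hτ01 hτi hτ using hτ
  have hna : ∀ j, n j (a j) = 0 := fun j => by
    have := (hn j _ (H.a_mem j)).1
    rw [H.coord_a, mul_zero] at this
    exact_mod_cast this.symm
  have hval : ∀ j, ∀ q ∈ Q, ∀ x : ℤ, n j q = x → h j q = x / 3 := by
    intro j q hq x hx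
    have := (hn j q hq).1
    rw [hx] at this
    linarith
  -- points outside the class of `a j` have the same coordinate if `τ j = 0`
  have hconst : ∀ j, τ j = 0 → ∀ q ∈ Q, ∀ q' ∈ Q, cl q ≠ cl (a j) → cl q' ≠ cl (a j) →
      h j q = h j q' := by
    intro j hj
    have h01 : ∀ q ∈ Q, h j q = 0 ∨ h j q = 1 := by
      intro q hq
      have h1 := hτ j q hq _ (H.a_mem j)
      have h2 := (hn j q hq).2
      rw [hj, hna] at h1
      have h3 : n j q = 0 ∨ n j q = 3 := by omega
      rcases h3 with h3 | h3
      · left; rw [hval j q hq _ h3]; norm_num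
      · right; rw [hval j q hq _ h3]; norm_num
    have hij : i ≠ j := fun h => by
      have := hτi j h.symm
      omega
    have hcli : ∀ q ∈ Q, ∀ q' ∈ Q, h i q = h i q' → cl q = cl q' := by
      intro q hq q' hq' he
      have h1 : (m q : ℚ) = m q' := by rw [← hm' q hq, ← hm' q' hq', he]
      have h2 : m q = m q' := by exact_mod_cast h1
      simp only [hcl_def, h2]
    have key : ∀ q ∈ Q, ∀ q' ∈ Q, cl q ≠ cl (a j) → cl q' ≠ cl (a j) → h j q = 0 →
        h j q' = 1 → False := by
      intro q hq q' hq' hc hc' h0 h1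
      rcases h01 _ (H.a_mem i) with ht | ht
      · refine hc' (hcli _ hq' _ (H.a_mem j) ?_)
        rw [← H.coord_eq i j hij]
        exact H.coord_eq_of_opposite hij hq' (H.b_mem j) (by rw [h1, H.coord_b])
          (Or.inl (by rw [h1, ht, sub_zero]))
      · exact hc (hcli _ hq _ (H.a_mem j) (H.coord_eq_of_opposite hij hq (H.a_mem j)
          (by rw [h0, H.coord_a]) (Or.inr (by rw [h0, ht, zero_sub]))))
    intro q hq q' hq' hc hc'
    rcases h01 q hq with h1 | h1 <;> rcases h01 q' hq' with h2 | h2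
    · rw [h1, h2]
    · exact (key q hq q' hq' hc hc' h1 h2).elim
    · exact (key q' hq' q hq hc' hc h2 h1).elim
    · rw [h1, h2]
  set v : ι → ℚ := fun j => h j (W ((cl (a j) + 1) % 3)) with hv
  have hcl_mem : ∀ q, 0 ≤ cl q ∧ cl q < 3 := fun q => by simp only [hcl_def]; omega
  have hv_eq : ∀ j, τ j = 0 → ∀ q ∈ Q, cl q ≠ cl (a j) → h j q = v j := by
    intro j hj q hq hc
    have h0 := hcl_mem (a j)
    obtain ⟨h1, h2⟩ := hWQ ((cl (a j) + 1) % 3) (by omega) (by omega)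
    exact hconst j hj q hq _ h1 hc (by rw [h2]; omega)
  have h0v : ∀ j, τ j = 0 → v j = 0 ∨ v j = 1 := by
    intro j hj
    have h0 := hcl_mem (a j)
    obtain ⟨hw, -⟩ := hWQ ((cl (a j) + 1) % 3) (by omega) (by omega)
    have h1 := hτ j _ hw _ (H.a_mem j)
    have h2 := (hn j _ hw).2
    rw [hj, hna] at h1
    have h3 : n j (W ((cl (a j) + 1) % 3)) = 0 ∨ n j (W ((cl (a j) + 1) % 3)) = 3 := by omega
    rcases h3 with h3 | h3
    · left; rw [hv]; simp only; rw [hval j _ hw _ h3]; norm_num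
    · right; rw [hv]; simp only; rw [hval j _ hw _ h3]; norm_num
  set st : ι → ℚ := fun j => if τ j = 1 then 0 else if τ j = -1 then 1 else v j with hst
  set en : ι → ℚ := fun j => if τ j = 1 then 1 else if τ j = -1 then 0 else v j with hen
  have hst01 : ∀ j, st j = 0 ∨ st j = 1 := by
    intro j
    rcases hτ01 j with h1 | h1 | h1
    · simpa [hst, h1] using h0v j h1
    · simp [hst, h1]
    · simp [hst, h1]
  have hen01 : ∀ j, en j = 0 ∨ en j = 1 := by
    intro j
    rcases hτ01 j with h1 | h1 | h1
    · simpa [hen, h1] using h0v j h1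
    · simp [hen, h1]
    · simp [hen, h1]
  have hval1 : ∀ j, ∀ q ∈ Q, cl q = (cl (a j) + 1) % 3 →
      h j q = if τ j = 1 then 1 / 3 else if τ j = -1 then 2 / 3 else v j := by
    intro j q hq hc
    have h1 := hτ j q hq _ (H.a_mem j)
    have h2 := (hn j q hq).2
    rw [hna] at h1
    simp only [hcl_def] at hc
    rcases hτ01 j with h3 | h3 | h3 <;> rw [h3] at h1
    · rw [hv_eq j h3 q hq (by simp only [hcl_def]; omega)]; simp [h3]
    · have h4 : n j q = 1 := by omega
      rw [hval j q hq _ h4]; simp [h3]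
    · have h4 : n j q = 2 := by omega
      rw [hval j q hq _ h4]; simp [h3]
  have hval2 : ∀ j, ∀ q ∈ Q, cl q = (cl (a j) + 2) % 3 →
      h j q = if τ j = 1 then 2 / 3 else if τ j = -1 then 1 / 3 else v j := by
    intro j q hq hc
    have h1 := hτ j q hq _ (H.a_mem j)
    have h2 := (hn j q hq).2
    rw [hna] at h1
    simp only [hcl_def] at hc
    rcases hτ01 j with h3 | h3 | h3 <;> rw [h3] at h1
    · rw [hv_eq j h3 q hq (by simp only [hcl_def]; omega)]; simp [h3]
    · have h4 : n j q = 2 := by omega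
      rw [hval j q hq _ h4]; simp [h3]
    · have h4 : n j q = 1 := by omega
      rw [hval j q hq _ h4]; simp [h3]
  have hpat : ∀ A : ι → ℚ, (∀ j, A j = 0 ∨ A j = 1) → (∀ c, 0 ≤ c → c < 3 → ∃ w ∈ Q,
      ∀ j, cl (a j) = c → h j w = A j ∨ h j w = A j + (1 - 2 * A j) / 3) →
      ∀ c, 0 ≤ c → c < 3 → ∃ q ∈ Q, cl q = c ∧ ∀ j, cl (a j) = c → h j q = A j := by
    intro A hA hw c hc0 hc3
    by_contra! hcon
    obtain ⟨hC1, hC2, -⟩ := hCI c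
    obtain ⟨j, hj, l, hl, hjl, hp⟩ := exists_pair_of_card_le (Q := Q.filter (cl · = c))
      (I := Finset.univ.filter fun j => cl (a j) = c) (h := h) (A := A)
      (fun q hq q' hq' he => H.sep q (Finset.mem_of_mem_filter q hq) q'
        (Finset.mem_of_mem_filter q' hq') fun j => by
          by_contra hne
          exact hne (he j (hC1 q hq q' hq' j hne)))
      hC2 (fun j _ => hA j) (hfull c (Finset.mem_Ico.2 ⟨hc0, hc3⟩)) (by
        intro q hq
        obtain ⟨h1, h2⟩ := Finset.mem_filter.1 hq
        obtain ⟨j, hj, hne⟩ := hcon q h1 h2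
        exact ⟨j, by simpa using hj, hne⟩)
    have hflip : ∀ s : ℚ, s = 0 ∨ s = 1 → (1 - s = 0 ∨ 1 - s = 1) ∧ 1 - s ≠ s := by
      rintro s (rfl | rfl) <;> norm_num
    obtain ⟨p₁, hp₁, h₁⟩ := hp (1 - A j) (A l) (hflip _ (hA j)).1 (hA l)
      (Or.inl (hflip _ (hA j)).2)
    obtain ⟨p₂, hp₂, h₂⟩ := hp (A j) (1 - A l) (hA j) (hflip _ (hA l)).1
      (Or.inr (hflip _ (hA l)).2)
    obtain ⟨p₃, hp₃, h₃⟩ := hp (1 - A j) (1 - A l) (hflip _ (hA j)).1 (hflip _ (hA l)).1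
      (Or.inl (hflip _ (hA j)).2)
    obtain ⟨w, hwQ, hw⟩ := hw c hc0 hc3
    exact H.false_of_pattern hjl (Finset.mem_of_mem_filter _ hp₁) (Finset.mem_of_mem_filter _ hp₂)
      (Finset.mem_of_mem_filter _ hp₃) hwQ (hA j) (hA l) h₁ h₂ h₃
      (hw j (by simpa using hj)) (hw l (by simpa using hl))
  have hs_ex := hpat st hst01 (by
    intro c hc0 hc3
    obtain ⟨h1, h2⟩ := hWQ ((c + 1) % 3) (by omega) (by omega)
    refine ⟨_, h1, fun j hj => ?_⟩
    rw [hval1 j _ h1 (by rw [h2, hj])]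
    rcases hτ01 j with h5 | h5 | h5 <;> simp only [hst, h5] <;> norm_num)
  have he_ex := hpat en hen01 (by
    intro c hc0 hc3
    obtain ⟨h3, h4⟩ := hWQ ((c + 2) % 3) (by omega) (by omega)
    refine ⟨_, h3, fun j hj => ?_⟩
    rw [hval2 j _ h3 (by rw [h4, hj])]
    rcases hτ01 j with h5 | h5 | h5 <;> simp only [hen, h5] <;> norm_num)
  have hE : ∀ c, ∃ e, 0 ≤ c → c < 3 → e ∈ Q ∧ cl e = c ∧ ∀ j, cl (a j) = c → h j e = en j := by
    intro c
    by_cases hc : 0 ≤ c ∧ c < 3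
    · obtain ⟨e, he⟩ := he_ex c hc.1 hc.2
      exact ⟨e, fun _ _ => he⟩
    · exact ⟨a i, fun h0 h3 => absurd ⟨h0, h3⟩ hc⟩
  choose e he using hE
  refine ⟨fun j => τ j / 3, ⟨i, by simp [hτi i rfl]⟩, (Finset.Ico (0 : ℤ) 3).image e, ?_, ?_, ?_⟩
  · intro x hx
    obtain ⟨c, hc, rfl⟩ := Finset.mem_image.1 hx
    exact (he c (Finset.mem_Ico.1 hc).1 (Finset.mem_Ico.1 hc).2).1
  · rw [Finset.card_image_of_injOn]
    · simp
    · intro c hc c' hc' hcc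
      have hc := Finset.mem_Ico.1 (Finset.mem_coe.1 hc)
      have hc' := Finset.mem_Ico.1 (Finset.mem_coe.1 hc')
      rw [← (he c hc.1 hc.2).2.1, ← (he c' hc'.1 hc'.2).2.1, hcc]
  · intro x hx
    obtain ⟨c, hc, rfl⟩ := Finset.mem_image.1 hx
    obtain ⟨hc0, hc3⟩ := Finset.mem_Ico.1 hc
    obtain ⟨he1, he2, he3⟩ := he c hc0 hc3
    obtain ⟨s, hs1, hs2, hs3⟩ := hs_ex ((c + 2) % 3) (by omega) (by omega)
    refine ⟨s, hs1, fun j => ?_⟩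
    have h0 := hcl_mem (a j)
    have hcase : cl (a j) = (c + 2) % 3 ∨ cl (a j) = (c + 1) % 3 ∨ cl (a j) = c := by omega
    rcases hcase with h1 | h1 | h1
    · rw [hs3 j h1, hval1 j _ he1 (by omega)]
      rcases hτ01 j with h5 | h5 | h5 <;> simp only [hst, h5] <;> norm_num
    · rw [hval1 j s hs1 (by omega), hval2 j _ he1 (by omega)]
      rcases hτ01 j with h5 | h5 | h5 <;> simp only [h5] <;> norm_num
    · rw [he3 j h1, hval2 j s hs1 (by omega)]
      rcases hτ01 j with h5 | h5 | h5 <;> simp only [hen, h5] <;> norm_num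

end GridSystem

end

section

open Module

theorem AlternatingMap.map_update_update_sum_smul {V ι : Type*} [AddCommGroup V] [Module ℚ V]
    [Fintype ι] [DecidableEq ι] (D : V [⋀^ι]→ₗ[ℚ] ℚ) (v : ι → V) {i j : ι} (hij : i ≠ j)
    (c : ι → ℚ) (y : V) :
    D (Function.update (Function.update v j y) i (∑ l, c l • v l)) =
      c i * D (Function.update v j y) - c j * D (Function.update v i y) := by
  have h1 : D (Function.update (Function.update v j y) i (∑ l, c l • v l)) =
      ∑ l, c l * D (Function.update (Function.update v j y) i (v l)) := by
    have := map_sum (D.toMultilinearMap.toLinearMap (Function.update v j y) i)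
      (fun l => c l • v l) Finset.univ
    refine this.trans (Finset.sum_congr rfl fun l _ => ?_)
    rw [map_smul]
    rfl
  have h2 : Function.update (Function.update v j y) i (v i) = Function.update v j y := by
    ext k
    by_cases hk : k = i
    · subst hk; simp [hij]
    · simp [hk]
  have h3 : D (Function.update (Function.update v j y) i (v j)) = - D (Function.update v i y) := by
    rw [← D.map_swap (Function.update v i y) hij]
    congr 1
    ext k
    by_cases hk : k = i
    · subst hk; simp [hij.symm]
    · by_cases hk' : k = j
      · subst hk'; simp [hij.symm]
      · simp [hk, hk', Equiv.swap_apply_of_ne_of_ne hk hk']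
  rw [h1, Fintype.sum_eq_add i j hij, h2, h3]
  · ring
  · rintro l ⟨hl1, hl2⟩
    rw [D.map_eq_zero_of_eq _ (i := i) (j := l) (by simp [hl1, hl2]) hl1.symm, mul_zero]

variable {V : Type*} [AddCommGroup V] [Module ℚ V]

/-- A finite set such that an alternating form takes values `0, ±1, ±2, ±3` on its differences has
at most `d + 3` elements, and in the extremal case it contains three translates of its points. -/
theorem card_le_of_alternating [FiniteDimensional ℚ V] [DecidableEq V] {Q : Finset V} {d : ℕ}
    (hd : finrank ℚ (vectorSpan ℚ (Q : Set V)) = d) (Φ : V [⋀^Fin d]→ₗ[ℚ] ℚ)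
    (hΦ0 : ∀ v : Fin d → V, (∀ i, v i ∈ vectorSpan ℚ (Q : Set V)) → LinearIndependent ℚ v → Φ v ≠ 0)
    (hΦ : ∀ v : Fin d → V, (∀ i, v i ∈ (Q : Set V) -ᵥ (Q : Set V)) → ∃ k : ℤ, Φ v = k ∧ |k| ≤ 3) :
    Q.card ≤ d + 3 ∧ (d + 3 ≤ Q.card → ∃ x : V, x ≠ 0 ∧ ∃ E ⊆ Q, E.card = 3 ∧
      ∀ e ∈ E, e - x ∈ Q) := by
  classical
  have hdiff : ∀ x, x ∈ (Q : Set V) -ᵥ (Q : Set V) ↔ ∃ q ∈ Q, ∃ q' ∈ Q, q - q' = x := by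
    intro x; simp [Set.mem_vsub]
  have hdU : ∀ x ∈ (Q : Set V) -ᵥ (Q : Set V), x ∈ vectorSpan ℚ (Q : Set V) := fun x hx =>
    Submodule.subset_span hx
  obtain ⟨f0, hf0, hf0i⟩ : ∃ f : Fin d → V, (∀ i, f i ∈ (Q : Set V) -ᵥ (Q : Set V)) ∧
      LinearIndependent ℚ f := by
    obtain ⟨b, hb, hbs, hbi⟩ := exists_linearIndependent ℚ ((Q : Set V) -ᵥ (Q : Set V))
    have hfin : b.Finite := hbi.setFinite
    have := hfin.fintype
    have hcard : Fintype.card b = d := by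
      rw [← hd, vectorSpan_def, ← hbs, ← Set.toFinset_card]
      exact (finrank_span_set_eq_card hbi).symm
    let e := (Fintype.equivFinOfCardEq hcard).symm
    exact ⟨fun i => (e i : V), fun i => hb (e i).2, hbi.comp _ e.injective⟩
  have hfinset : ∃ F : Finset (Fin d → V), ∀ f, f ∈ F ↔ ∀ i, f i ∈ (Q : Set V) -ᵥ (Q : Set V) := by
    refine ⟨Fintype.piFinset fun _ => (Q ×ˢ Q).image fun p => p.1 - p.2, fun f => ?_⟩
    rw [Fintype.mem_piFinset]
    refine forall_congr' fun i => ?_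
    rw [hdiff]
    simp only [Finset.mem_image, Finset.mem_product, Prod.exists]
    constructor
    · rintro ⟨q, q', ⟨h1, h2⟩, h3⟩
      exact ⟨q, h1, q', h2, h3⟩
    · rintro ⟨q, h1, q', h2, h3⟩
      exact ⟨q, q', ⟨h1, h2⟩, h3⟩
  obtain ⟨F, hF⟩ := hfinset
  obtain ⟨f, hfF, hmax⟩ := F.exists_max_image (fun f => |Φ f|) ⟨f0, (hF f0).2 hf0⟩
  have hf := (hF f).1 hfF
  have hΦf : Φ f ≠ 0 := fun h0 => by
    have h1 := hmax f0 ((hF f0).2 hf0)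
    rw [h0, abs_zero] at h1
    exact hΦ0 f0 (fun i => hdU _ (hf0 i)) hf0i (abs_nonpos_iff.1 h1)
  have hmax' : ∀ v : Fin d → V, (∀ i, v i ∈ (Q : Set V) -ᵥ (Q : Set V)) → |Φ v / Φ f| ≤ 1 := by
    intro v hv
    rw [abs_div]
    exact div_le_one_of_le₀ (hmax v ((hF v).2 hv)) (abs_nonneg _)
  obtain ⟨k, hk, hk3⟩ := hΦ f hf
  have hk0 : k ≠ 0 := fun h => hΦf (by rw [hk, h]; norm_num)
  set μ := k.natAbs with hμ
  have hμ3 : μ = 1 ∨ μ = 2 ∨ μ = 3 := by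
    have := abs_le.1 hk3
    omega
  have h_int : ∀ v : Fin d → V, (∀ i, v i ∈ (Q : Set V) -ᵥ (Q : Set V)) →
      ∃ n : ℤ, μ * (Φ v / Φ f) = n := by
    intro v hv
    obtain ⟨n, hn, -⟩ := hΦ v hv
    have hkq : (k : ℚ) ≠ 0 := by exact_mod_cast hk0
    have hμk : (μ : ℚ) = k ∨ (μ : ℚ) = -k := by
      rcases Int.natAbs_eq k with h | h
      · left
        have : (μ : ℤ) = k := h.symm
        exact_mod_cast this
      · right
        have : (μ : ℤ) = -k := by omega
        exact_mod_cast this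
    rw [hn, hk]
    rcases hμk with h | h <;> rw [h]
    · exact ⟨n, by field_simp⟩
    · exact ⟨-n, by push_cast; field_simp⟩
  choose b hb a ha hab using fun i => (hdiff _).1 (hf i)
  set ξ : Fin d → V → ℚ := fun j x => Φ (Function.update f j x) / Φ f with hξ
  have hξ_sub : ∀ j x y, ξ j (x - y) = ξ j x - ξ j y := by
    intro j x y
    simp only [hξ, AlternatingMap.map_update_sub, sub_div]
  have hfi : LinearIndependent ℚ f := by
    by_contra h
    exact hΦf (Φ.map_linearDependent f h)
  have hspan : Submodule.span ℚ (Set.range f) = vectorSpan ℚ (Q : Set V) := by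
    apply Submodule.eq_of_le_of_finrank_eq
    · rw [Submodule.span_le]
      rintro _ ⟨i, rfl⟩
      exact hdU _ (hf i)
    · rw [finrank_span_eq_card hfi, hd, Fintype.card_fin]
  have hξ_sum : ∀ c : Fin d → ℚ, ∀ i, ξ i (∑ j, c j • f j) = c i := by
    intro c i
    simp only [hξ]
    rw [AlternatingMap.map_update_sum_smul, mul_div_assoc, div_self hΦf, mul_one]
  have hexp : ∀ x ∈ vectorSpan ℚ (Q : Set V), x = ∑ j, ξ j x • f j := by
    intro x hx
    rw [← hspan] at hx
    obtain ⟨c, rfl⟩ := (Submodule.mem_span_range_iff_exists_fun ℚ).1 hx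
    exact Finset.sum_congr rfl fun j _ => by rw [hξ_sum]
  have hξ_self : ∀ i j, ξ i (f j) = if i = j then 1 else 0 := by
    intro i j
    have h1 := hξ_sum (fun l => if l = j then 1 else 0) i
    rw [← h1]
    congr 1
    simp
  have hsubQ : ∀ q ∈ Q, ∀ q' ∈ Q, q - q' ∈ (Q : Set V) -ᵥ (Q : Set V) := fun q hq q' hq' =>
    (hdiff _).2 ⟨q, hq, q', hq', rfl⟩
  have hupd : ∀ (v : Fin d → V) i x, (∀ i, v i ∈ (Q : Set V) -ᵥ (Q : Set V)) →
      x ∈ (Q : Set V) -ᵥ (Q : Set V) →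
      ∀ l, Function.update v i x l ∈ (Q : Set V) -ᵥ (Q : Set V) := by
    intro v i x hv hx l
    by_cases hl : l = i
    · subst hl; simpa using hx
    · simpa [hl] using hv l
  have hminor : ∀ i j, i ≠ j → ∀ x ∈ vectorSpan ℚ (Q : Set V), ∀ y,
      ξ i x * ξ j y - ξ i y * ξ j x =
        Φ (Function.update (Function.update f j y) i x) / Φ f := by
    intro i j hij x hx y
    conv_rhs => rw [hexp x hx]
    rw [AlternatingMap.map_update_update_sum_smul Φ f hij]
    simp only [hξ]
    ring
  have H : GridSystem Q (fun j q => ξ j (q - a j)) a b μ := by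
    refine ⟨ha, hb, ?_, ?_, ?_, ?_, ?_, ?_, ?_, ?_⟩
    · intro j
      rw [hξ_sub, sub_self]
    · intro j
      rw [hab, hξ_self, if_pos rfl]
    · intro i j hij
      have := hξ_self i j
      rw [if_neg hij, ← hab, hξ_sub] at this
      simp only [hξ_sub]
      linarith
    · intro j q hq q' hq'
      rw [← hξ_sub, sub_sub_sub_cancel_right]
      exact hmax' _ (hupd f j _ hf (hsubQ q hq q' hq'))
    · intro j q hq
      exact h_int _ (hupd f j _ hf (hsubQ q hq _ (ha j)))
    · intro i j hij q hq q' hq' s hs s' hs'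
      simp only [← hξ_sub, sub_sub_sub_cancel_right]
      rw [hminor i j hij _ (hdU _ (hsubQ q hq q' hq'))]
      exact hmax' _ (hupd _ i _ (hupd f j _ hf (hsubQ s hs s' hs')) (hsubQ q hq q' hq'))
    · intro i j hij q hq q' hq' s hs s' hs'
      simp only [← hξ_sub, sub_sub_sub_cancel_right]
      rw [hminor i j hij _ (hdU _ (hsubQ q hq q' hq'))]
      exact h_int _ (hupd _ i _ (hupd f j _ hf (hsubQ s hs s' hs')) (hsubQ q hq q' hq'))
    · intro q hq q' hq' he
      have h1 := hexp _ (hdU _ (hsubQ q hq q' hq'))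
      rw [Finset.sum_eq_zero] at h1
      · exact sub_eq_zero.1 h1
      · intro j _
        have := he j
        simp only [hξ_sub, sub_left_inj] at this
        rw [hξ_sub, this, sub_self, zero_smul]
  have hμp : μ.Prime ∨ μ = 1 := by
    rcases hμ3 with h | h | h <;> rw [h]
    · exact Or.inr rfl
    · exact Or.inl Nat.prime_two
    · exact Or.inl Nat.prime_three
  constructor
  · have := H.card_le hμp
    rw [Fintype.card_fin] at this
    omega
  · intro hcard
    obtain ⟨τ, ⟨i, hi⟩, E, hEQ, hE3, hE⟩ := H.exists_shift hμ3 (by rwa [Fintype.card_fin])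
    refine ⟨∑ j, τ j • f j, fun h0 => hi ?_, E, hEQ, hE3, fun e he => ?_⟩
    · have := hξ_sum τ i
      rw [h0] at this
      rw [← this]
      simp only [hξ, AlternatingMap.map_update_zero, zero_div]
    · obtain ⟨s, hs, hes⟩ := hE e he
      have h1 := hexp _ (hdU _ (hsubQ e (hEQ he) s hs))
      have h2 : ∀ j, ξ j (e - s) = τ j := by
        intro j
        have := hes j
        simp only [hξ_sub] at this ⊢
        linarith
      simp only [h2] at h1
      rw [← h1, sub_sub_cancel]
      exact hs

end

section

open Module

section AlternatingForms

variable {V ι κ : Type*} [AddCommGroup V] [Module ℚ V]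

/-- If an alternating form takes values in `ℤ μ` on a set, then it does so on the subgroup
generated by that set. -/
theorem AlternatingMap.exists_int_mul_of_closure [Finite ι] (D : V [⋀^ι]→ₗ[ℚ] ℚ) {X : Set V}
    {μ : ℚ} (h : ∀ v : ι → V, (∀ i, v i ∈ X) → ∃ k : ℤ, D v = k * μ) (v : ι → V)
    (hv : ∀ i, v i ∈ AddSubgroup.closure X) : ∃ k : ℤ, D v = k * μ := by
  classical
  have := Fintype.ofFinite ι
  have key : ∀ s : Finset ι, ∀ v : ι → V, (∀ i ∈ s, v i ∈ AddSubgroup.closure X) →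
      (∀ i ∉ s, v i ∈ X) → ∃ k : ℤ, D v = k * μ := by
    intro s
    induction s using Finset.induction_on with
    | empty => exact fun v _ hv => h v fun i => hv i (by simp)
    | insert a s ha ih =>
      intro v hvs hvn
      have main : ∀ x ∈ AddSubgroup.closure X, ∃ k : ℤ, D (Function.update v a x) = k * μ := by
        intro x hx
        induction hx using AddSubgroup.closure_induction with
        | mem x hx =>
          refine ih _ (fun i hi => ?_) (fun i hi => ?_)
          · have : i ≠ a := by rintro rfl; exact ha hi
            rw [Function.update_of_ne this]
            exact hvs i (Finset.mem_insert_of_mem hi)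
          · by_cases hia : i = a
            · subst hia; simpa using hx
            · rw [Function.update_of_ne hia]
              exact hvn i (by simp [hia, hi])
        | zero => exact ⟨0, by simp⟩
        | add x y _ _ hx hy =>
          obtain ⟨k, hk⟩ := hx
          obtain ⟨l, hl⟩ := hy
          exact ⟨k + l, by rw [D.map_update_add, hk, hl]; push_cast; ring⟩
        | neg x _ hx =>
          obtain ⟨k, hk⟩ := hx
          exact ⟨-k, by rw [D.map_update_neg, hk]; push_cast; ring⟩
      simpa using main (v a) (hvs a (Finset.mem_insert_self _ _))
  exact key Finset.univ v (fun i _ => hv i) (by simp)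

theorem AlternatingMap.exists_int_mul_of_closure_range [Finite ι] (D : V [⋀^ι]→ₗ[ℚ] ℚ)
    (B w : ι → V) (hw : ∀ i, w i ∈ AddSubgroup.closure (Set.range B)) :
    ∃ k : ℤ, D w = k * D B := by
  classical
  have := Fintype.ofFinite ι
  refine D.exists_int_mul_of_closure (fun v hv => ?_) w hw
  choose f hf using hv
  by_cases hinj : Function.Injective f
  · let e : Equiv.Perm ι := Equiv.ofBijective f (Finite.injective_iff_bijective.1 hinj)
    have hv : v = B ∘ e := by
      funext i; exact (hf i).symm
    refine ⟨(Equiv.Perm.sign e : ℤ), ?_⟩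
    rw [hv, D.map_perm, Units.smul_def, zsmul_eq_mul]
  · simp only [Function.Injective, not_forall] at hinj
    obtain ⟨i, j, hij, hne⟩ := hinj
    exact ⟨0, by rw [D.map_eq_zero_of_eq v (by rw [← hf i, ← hf j, hij]) hne]; simp⟩

/-- The alternating form obtained by fixing the arguments in the second summand. -/
def AlternatingMap.fixRight (D : V [⋀^ι ⊕ κ]→ₗ[ℚ] ℚ) (g : κ → V) : V [⋀^ι]→ₗ[ℚ] ℚ where
  toFun u := D (Sum.elim u g)
  map_update_add' u i x y := by
    classical
    simp only [Sum.elim_update_left, D.map_update_add]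
  map_update_smul' u i c x := by
    classical
    simp only [Sum.elim_update_left, D.map_update_smul]
  map_eq_zero_of_eq' u i j h hij :=
    D.map_eq_zero_of_eq _ (i := .inl i) (j := .inl j) (by simpa using h) (by simpa using hij)

theorem AlternatingMap.fixRight_apply (D : V [⋀^ι ⊕ κ]→ₗ[ℚ] ℚ) (g : κ → V) (u : ι → V) :
    D.fixRight g u = D (Sum.elim u g) := rfl

end AlternatingForms

variable {V : Type*} [AddCommGroup V] [Module ℚ V] [FiniteDimensional ℚ V]

theorem exists_fin_linearIndependent {ι : Type*} [Fintype ι] (hι : Fintype.card ι = finrank ℚ V)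
    {X : Set V} (hX : Submodule.span ℚ X = ⊤) :
    ∃ w : ι → V, (∀ i, w i ∈ X) ∧ LinearIndependent ℚ w := by
  classical
  obtain ⟨b, hb, hbs, hbi⟩ := exists_linearIndependent ℚ X
  have hfin : b.Finite := hbi.setFinite
  have := hfin.fintype
  have hcard : Fintype.card b = Fintype.card ι := by
    rw [hι, ← finrank_top ℚ V, ← hX, ← hbs, ← Set.toFinset_card]
    exact (finrank_span_set_eq_card hbi).symm
  let e : ι ≃ b := (Fintype.equivOfCardEq hcard).symm
  exact ⟨fun i => (e i : V), fun i => hb (e i).2, hbi.comp _ e.injective⟩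

theorem form_eq_int_of_closure {ι : Type*} [Fintype ι] (hι : Fintype.card ι = finrank ℚ V)
    (D : V [⋀^ι]→ₗ[ℚ] ℚ) (hD0 : ∀ v : ι → V, LinearIndependent ℚ v → D v ≠ 0) {X : Set V}
    (hD : ∀ v, (∀ i, v i ∈ X) → ∃ k : ℤ, D v = k ∧ |k| ≤ 3) (B : ι → V)
    (h1 : ∀ i, B i ∈ AddSubgroup.closure X) (h2 : X ⊆ AddSubgroup.closure (Set.range B)) :
    ∃ k : ℤ, D B = k ∧ |k| ≤ 3 := by
  obtain ⟨k, hk⟩ := D.exists_int_mul_of_closure (X := X) (μ := 1)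
    (fun v hv => by obtain ⟨k, hk, -⟩ := hD v hv; exact ⟨k, by simpa using hk⟩) B h1
  rw [mul_one] at hk
  refine ⟨k, hk, ?_⟩
  by_cases hB : LinearIndependent ℚ B
  · have hspan : Submodule.span ℚ X = ⊤ := by
      rw [eq_top_iff, ← hB.span_eq_top_of_card_eq_finrank' hι, Submodule.span_le]
      rintro _ ⟨i, rfl⟩
      have : AddSubgroup.closure X ≤ (Submodule.span ℚ X).toAddSubgroup :=
        (AddSubgroup.closure_le _).2 Submodule.subset_span
      exact this (h1 i)
    obtain ⟨w, hwX, hwi⟩ := exists_fin_linearIndependent hι hspan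
    obtain ⟨l, hl⟩ := D.exists_int_mul_of_closure_range B w fun i => h2 (hwX i)
    obtain ⟨m, hm, hm3⟩ := hD w hwX
    have hne : m ≠ 0 := by
      rintro rfl
      exact hD0 w hwi (by simpa using hm)
    have e : m = l * k := by
      rw [hm, hk] at hl
      exact_mod_cast hl
    have hl0 : l ≠ 0 := by rintro rfl; simp [e] at hne
    have : 1 ≤ |l| := Int.one_le_abs hl0
    rw [e, abs_mul] at hm3
    nlinarith [abs_nonneg k]
  · have := D.map_linearDependent B hB
    rw [hk] at this
    have : k = 0 := by exact_mod_cast this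
    simp [this]

end

section

open Module

variable {V : Type*} [AddCommGroup V] [Module ℚ V] [FiniteDimensional ℚ V]

/-- A clique `J` of elements with differences in `S`, all of whose translates of `Q` lie in `S`,
together with functionals dual to `J` vanishing on `Q`. -/
structure CloneSystem (S J Q : Finset V) (δ : V → V →ₗ[ℚ] ℚ) : Prop where
  sub_mem : ∀ i ∈ J, ∀ j ∈ J, i ≠ j → i - j ∈ S
  add_mem : ∀ i ∈ J, ∀ q ∈ Q, i + q ∈ S
  coord_self : ∀ i ∈ J, δ i i = 1
  coord_ne : ∀ i ∈ J, ∀ j ∈ J, i ≠ j → δ i j = 0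
  coord_eq_zero : ∀ i ∈ J, ∀ q ∈ Q, δ i q = 0

theorem CloneSystem.mono {V : Type*} [AddCommGroup V] [Module ℚ V]
    {S J Q Q' : Finset V} {δ : V → V →ₗ[ℚ] ℚ} (h : CloneSystem S J Q δ)
    (hQ : Q' ⊆ Q) : CloneSystem S J Q' δ :=
  ⟨h.sub_mem, fun i hi q hq => h.add_mem i hi q (hQ hq), h.coord_self, h.coord_ne,
    fun i hi q hq => h.coord_eq_zero i hi q (hQ hq)⟩

theorem CloneSystem.coord_vectorSpan {V : Type*} [AddCommGroup V] [Module ℚ V]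
    {S J Q : Finset V} {δ : V → V →ₗ[ℚ] ℚ}
    (h : CloneSystem S J Q δ) {i : V} (hi : i ∈ J) {u : V}
    (hu : u ∈ vectorSpan ℚ (Q : Set V)) : δ i u = 0 := by
  have : vectorSpan ℚ (Q : Set V) ≤ LinearMap.ker (δ i) := by
    rw [vectorSpan_def, Submodule.span_le]
    intro x hx
    obtain ⟨q, hq, q', hq', rfl⟩ := Set.mem_vsub.1 hx
    simp [h.coord_eq_zero i hi q hq, h.coord_eq_zero i hi q' hq']
  exact this hu

theorem IndepMod.linearIndependent_elim {V : Type*} [AddCommGroup V] [Module ℚ V]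
    {ι : Type*} [Fintype ι] {U : Submodule ℚ V} {B : Finset V}
    (hB : IndepMod U B id) {v : ι → V} (hv : LinearIndependent ℚ v) (hvU : ∀ i, v i ∈ U) :
    LinearIndependent ℚ (Sum.elim v ((↑) : B → V)) := by
  classical
  rw [Fintype.linearIndependent_iff] at hv ⊢
  intro g hg
  simp only [Fintype.sum_sum_type, Sum.elim_inl, Sum.elim_inr] at hg
  have h1 : ∀ b : B, g (.inr b) = 0 := by
    have := hB (fun x => if hx : x ∈ B then g (.inr ⟨x, hx⟩) else 0) (by
      have e : ∑ t ∈ B, (if hx : t ∈ B then g (.inr ⟨t, hx⟩) else 0) • id t =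
          ∑ b : B, g (.inr b) • (b : V) := by
        rw [← Finset.sum_coe_sort]
        exact Finset.sum_congr rfl fun b _ => by simp
      rw [e, eq_neg_of_add_eq_zero_right hg]
      exact Submodule.neg_mem _ (Submodule.sum_mem _ fun i _ => Submodule.smul_mem _ _ (hvU i)))
    intro b
    simpa using this b b.2
  simp only [h1, zero_smul, Finset.sum_const_zero, add_zero] at hg
  rintro (i | b)
  · exact hv _ hg i
  · exact h1 b

theorem IndepMod.finrank_add_card {U : Submodule ℚ V} {B : Finset V} (hB : IndepMod U B id)
    (htop : U ⊔ Submodule.span ℚ (B : Set V) = ⊤) : finrank ℚ U + B.card = finrank ℚ V := by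
  have hli := hB.linearIndependent_elim (v := fun i => ((finBasis ℚ U i : U) : V))
    ((finBasis ℚ U).linearIndependent.map' U.subtype U.ker_subtype) (fun i => (finBasis ℚ U i).2)
  have hspan : Submodule.span ℚ (Set.range (Sum.elim (fun i => ((finBasis ℚ U i : U) : V))
      ((↑) : B → V))) = ⊤ := by
    rw [Set.Sum.elim_range, Submodule.span_union, ← htop]
    congr 1
    · have := congrArg (Submodule.map U.subtype) (finBasis ℚ U).span_eq
      rw [Submodule.map_span, Submodule.map_top, Submodule.range_subtype, ← Set.range_comp] at this
      exact this
    · simp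
  have := finrank_eq_card_basis (Basis.mk hli hspan.ge)
  simpa using this.symm

/-- A labelling of the points of `Q` by at most `|J|` labels, constant exactly on the classes
modulo the subgroup generated by a linearly independent family of differences. -/
theorem exists_class_labels {V : Type*} [AddCommGroup V] [Module ℚ V]
    [DecidableEq V] {Q J : Finset V} {d : ℕ} (hQ : Q.Nonempty)
    {f : Fin d → V} (hf : ∀ i, f i ∈ (Q : Set V) -ᵥ (Q : Set V)) (hfi : LinearIndependent ℚ f)
    (hJ : Q.card ≤ d + J.card) :
    ∃ (κ : V → V) (ρ : V → V), (∀ q ∈ Q, κ q ∈ J) ∧ (∀ i, ρ i ∈ Q) ∧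
      (∀ q ∈ Q, q - ρ (κ q) ∈ AddSubgroup.closure (Set.range f)) ∧
      ∀ q ∈ Q, ∀ q' ∈ Q, q - q' ∈ AddSubgroup.closure (Set.range f) → κ q = κ q' := by
  classical
  set H := AddSubgroup.closure (Set.range f) with hH
  let mk : V → V ⧸ H := fun v => v
  have hmk : ∀ q q', mk q = mk q' ↔ q - q' ∈ H := by
    intro q q'
    have : mk q = mk q' ↔ -q + q' ∈ H := QuotientAddGroup.eq
    rw [this, ← H.neg_mem_iff]
    congr! 1
    abel
  set N := Q.image mk with hN
  have hex : ∀ x : N, ∃ q ∈ Q, mk q = x := fun x => Finset.mem_image.1 x.2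
  choose rep hrepQ hrep using hex
  have hmem : ∀ q ∈ Q, mk q ∈ N := fun q hq => Finset.mem_image_of_mem _ hq
  set R := Finset.univ.image rep with hR
  have hRcard : R.card = N.card := by
    rw [hR, Finset.card_image_of_injective]
    · simp
    · intro x y hxy
      apply Subtype.ext
      rw [← hrep x, ← hrep y, hxy]
  have hRQ : R ⊆ Q := by
    intro x hx
    obtain ⟨y, -, rfl⟩ := Finset.mem_image.1 hx
    exact hrepQ y
  let φ : V → V := fun q => if hq : mk q ∈ N then q - rep ⟨mk q, hq⟩ else 0
  have hφ : ∀ q ∈ Q, φ q ∈ Submodule.span ℚ (((Q \ R).image φ : Finset V) : Set V) := by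
    intro q hq
    by_cases hqR : q ∈ R
    · obtain ⟨y, -, rfl⟩ := Finset.mem_image.1 hqR
      have : φ (rep y) = 0 := by
        simp only [φ, hmem _ hq, dif_pos]
        have : (⟨mk (rep y), hmem _ hq⟩ : N) = y := Subtype.ext (hrep y)
        rw [this, sub_self]
      rw [this]
      exact Submodule.zero_mem _
    · exact Submodule.subset_span (by
        exact_mod_cast Finset.mem_image_of_mem φ (Finset.mem_sdiff.2 ⟨hq, hqR⟩))
  have hcard : d ≤ (Q \ R).card := by
    have h1 : Submodule.span ℚ (Set.range f) ≤
        Submodule.span ℚ (((Q \ R).image φ : Finset V) : Set V) := by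
      rw [Submodule.span_le]
      rintro _ ⟨i, rfl⟩
      obtain ⟨b, hb, a, ha, hab⟩ := Set.mem_vsub.1 (hf i)
      have hb : b ∈ Q := by exact_mod_cast hb
      have ha : a ∈ Q := by exact_mod_cast ha
      have hab : b - a = f i := hab
      have hc : mk b = mk a := (hmk _ _).2 (hab ▸ AddSubgroup.subset_closure ⟨i, rfl⟩)
      have : f i = φ b - φ a := by
        simp only [φ, hmem _ ha, hc, dif_pos, ← hab]
        abel
      rw [this]
      exact Submodule.sub_mem _ (hφ b hb) (hφ a ha)
    calc d = finrank ℚ (Submodule.span ℚ (Set.range f)) := by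
          rw [finrank_span_eq_card hfi, Fintype.card_fin]
      _ ≤ _ := Submodule.finrank_mono h1
      _ ≤ ((Q \ R).image φ).card := finrank_span_finset_le_card _
      _ ≤ _ := Finset.card_image_le
  rw [Finset.card_sdiff_of_subset hRQ, hRcard] at hcard
  have hle := Finset.card_le_card hRQ
  have hNJ : Fintype.card N ≤ Fintype.card J := by
    simp only [Fintype.card_coe]
    omega
  obtain ⟨e⟩ := Function.Embedding.nonempty_of_card_le hNJ
  obtain ⟨q0, hq0⟩ := hQ
  let κ : V → V := fun q => if hq : mk q ∈ N then e ⟨mk q, hq⟩ else 0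
  have hκ : ∀ q (hq : q ∈ Q), κ q = e ⟨mk q, hmem q hq⟩ := fun q hq => dif_pos (hmem q hq)
  let ρ : V → V := fun i => if h : ∃ x : N, (e x : V) = i then rep h.choose else q0
  have hρ : ∀ x : N, ρ (e x) = rep x := by
    intro x
    have h : ∃ y : N, (e y : V) = e x := ⟨x, rfl⟩
    have : ρ (e x) = rep h.choose := dif_pos h
    rw [this, e.injective (Subtype.ext h.choose_spec)]
  refine ⟨κ, ρ, fun q hq => hκ q hq ▸ (e _).2, fun i => ?_, fun q hq => ?_, fun q hq q' hq' h => ?_⟩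
  · by_cases h : ∃ x : N, (e x : V) = i
    · simp only [ρ, h, dif_pos]; exact hrepQ _
    · simp only [ρ, h, dif_neg, not_false_eq_true]; exact hq0
  · rw [hκ q hq, hρ, ← hmk, hrep]
  · have := (hmk _ _).2 h
    rw [hκ q hq, hκ q' hq']
    simp only [this]

end

section

open Module

variable {V : Type*} [AddCommGroup V] [Module ℚ V] [FiniteDimensional ℚ V]

theorem CloneSystem.exists_alternating [DecidableEq V] {S J Q : Finset V} {δ : V → V →ₗ[ℚ] ℚ}
    (hS : ThreeModular S) (h : CloneSystem S J Q δ) (hQ : Q.Nonempty) {d : ℕ}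
    (hd : finrank ℚ (vectorSpan ℚ (Q : Set V)) = d) (hJ : Q.card ≤ d + J.card) :
    ∃ Φ : V [⋀^Fin d]→ₗ[ℚ] ℚ,
      (∀ v : Fin d → V, (∀ i, v i ∈ vectorSpan ℚ (Q : Set V)) → LinearIndependent ℚ v → Φ v ≠ 0) ∧
      ∀ v : Fin d → V, (∀ i, v i ∈ (Q : Set V) -ᵥ (Q : Set V)) → ∃ k : ℤ, Φ v = k ∧ |k| ≤ 3 := by
  classical
  obtain ⟨q0, hq0⟩ := id hQ
  set U := vectorSpan ℚ (Q : Set V) with hU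
  have hinj : Function.Injective fun i : V => i + q0 := fun a b hab => add_right_cancel hab
  set J' := J.image fun i => i + q0 with hJ'
  have hJ'S : J' ⊆ S := by
    intro x hx
    obtain ⟨i, hi, rfl⟩ := Finset.mem_image.1 hx
    exact h.add_mem i hi q0 hq0
  have hJ'i : IndepMod U J' id := by
    intro c hc t ht
    obtain ⟨i, hi, rfl⟩ := Finset.mem_image.1 ht
    have := h.coord_vectorSpan hi hc
    rw [hJ', Finset.sum_image (fun a _ b _ hab => hinj hab), map_sum,
      Finset.sum_eq_single_of_mem i hi] at this
    · simpa [h.coord_self i hi, h.coord_eq_zero i hi q0 hq0] using this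
    · intro j hj hne
      simp [h.coord_ne i hi j hj hne.symm, h.coord_eq_zero i hi q0 hq0]
  obtain ⟨B, hJB, hBS, hBi, hBspan⟩ := hJ'i.exists_extension hJ'S
  have htop : U ⊔ Submodule.span ℚ (B : Set V) = ⊤ := by
    rw [eq_top_iff, ← hS.span_eq, Submodule.span_le]
    intro x hx
    simpa using hBspan x hx
  have hcard := hBi.finrank_add_card htop
  rw [hd] at hcard
  have hι : Fintype.card (Fin d ⊕ B) = finrank ℚ V := by simpa using hcard
  obtain ⟨D, hD0, hD⟩ := hS.exists_form hι
  refine ⟨D.fixRight (↑), fun v hv hvi => hD0 _ (hBi.linearIndependent_elim hvi hv), ?_⟩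
  intro f hf
  rw [AlternatingMap.fixRight_apply]
  by_cases hne : D (Sum.elim f ((↑) : B → V)) = 0
  · exact ⟨0, by simp [hne]⟩
  have hfi : LinearIndependent ℚ f := by
    have h1 : LinearIndependent ℚ (Sum.elim f ((↑) : B → V)) := by
      by_contra hcon
      exact hne (D.map_linearDependent _ hcon)
    simpa using h1.comp Sum.inl Sum.inl_injective
  have hfU : ∀ i, f i ∈ U := fun i => Submodule.subset_span (hf i)
  obtain ⟨κ, ρ, hκJ, hρQ, hκρ, hκ⟩ := exists_class_labels hQ hf hfi hJ
  have hfspan : Submodule.span ℚ (Set.range f) = U := by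
    refine Submodule.eq_of_le_of_finrank_eq ?_ ?_
    · rw [Submodule.span_le]
      rintro _ ⟨i, rfl⟩
      exact hfU i
    · rw [finrank_span_eq_card hfi, Fintype.card_fin, hd]
  have hsubU : ∀ q ∈ Q, ∀ q' ∈ Q, q - q' ∈ U := fun q hq q' hq' =>
    Submodule.subset_span (Set.vsub_mem_vsub (by exact_mod_cast hq) (by exact_mod_cast hq'))
  let w : Fin d ⊕ B → V := Sum.elim (fun _ => 0) fun b =>
    if (b : V) ∈ J' then ρ (b - q0) - q0 else 0
  have himg : (Sum.elim f ((↑) : B → V)) '' (Set.range Sum.inl) = Set.range f := by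
    rw [← Set.range_comp]; rfl
  have hshift : D (Sum.elim f ((↑) : B → V) + w) = D (Sum.elim f ((↑) : B → V)) := by
    refine D.map_add_shift _ _ (Set.range Sum.inl) ?_ ?_
    · rintro _ ⟨i, rfl⟩
      rfl
    · rintro (i | b) hi
      · exact absurd ⟨i, rfl⟩ hi
      · rw [himg, hfspan]
        simp only [w, Sum.elim_inr]
        split_ifs
        · exact hsubU _ (hρQ _) _ hq0
        · exact Submodule.zero_mem _
  rw [← hshift]
  set X : Set V := {x | (∃ q ∈ Q, x = κ q + q) ∨ (∃ i ∈ J, x = i + ρ i) ∨ (x ∈ B ∧ x ∉ J')} with hX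
  have hXS : ∀ x ∈ X, x ∈ S := by
    rintro x (⟨q, hq, rfl⟩ | ⟨i, hi, rfl⟩ | ⟨hx, -⟩)
    · exact h.add_mem _ (hκJ q hq) q hq
    · exact h.add_mem i hi _ (hρQ i)
    · exact hBS hx
  have hJv : ∀ i (hi : i ∈ J), (Sum.elim f ((↑) : B → V) + w)
      (.inr ⟨i + q0, hJB (Finset.mem_image_of_mem _ hi)⟩) = i + ρ i := by
    intro i hi
    have : i + q0 ∈ J' := Finset.mem_image_of_mem _ hi
    simp only [w, Pi.add_apply, Sum.elim_inr, this, if_true, add_sub_cancel_right]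
    abel
  refine form_eq_int_of_closure hι D hD0 (X := X) (fun v hv => hD v fun i => hXS _ (hv i)) _ ?_ ?_
  · rintro (i | b)
    · obtain ⟨q, hq, q', hq', hqq⟩ := Set.mem_vsub.1 (hf i)
      have hq : q ∈ Q := by exact_mod_cast hq
      have hq' : q' ∈ Q := by exact_mod_cast hq'
      have hqq : q - q' = f i := hqq
      have e : (Sum.elim f ((↑) : B → V) + w) (.inl i) = (κ q + q) - (κ q' + q') := by
        rw [hκ q hq q' hq' (hqq ▸ AddSubgroup.subset_closure ⟨i, rfl⟩)]
        simp only [w, Pi.add_apply, Sum.elim_inl, ← hqq]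
        abel
      rw [e]
      exact AddSubgroup.sub_mem _ (AddSubgroup.subset_closure (.inl ⟨q, hq, rfl⟩))
        (AddSubgroup.subset_closure (.inl ⟨q', hq', rfl⟩))
    · by_cases hb : (b : V) ∈ J'
      · obtain ⟨i, hi, hib⟩ := Finset.mem_image.1 hb
        have : b = ⟨i + q0, hJB (Finset.mem_image_of_mem _ hi)⟩ := Subtype.ext hib.symm
        rw [this, hJv i hi]
        exact AddSubgroup.subset_closure (.inr (.inl ⟨i, hi, rfl⟩))
      · have e : (Sum.elim f ((↑) : B → V) + w) (.inr b) = b := by simp [w, hb]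
        rw [e]
        exact AddSubgroup.subset_closure (.inr (.inr ⟨b.2, hb⟩))
  · have hfle : AddSubgroup.closure (Set.range f) ≤
        AddSubgroup.closure (Set.range (Sum.elim f ((↑) : B → V) + w)) := by
      refine AddSubgroup.closure_mono ?_
      rintro _ ⟨i, rfl⟩
      exact ⟨.inl i, by simp [w]⟩
    have hJc : ∀ i ∈ J, i + ρ i ∈
        AddSubgroup.closure (Set.range (Sum.elim f ((↑) : B → V) + w)) := fun i hi =>
      AddSubgroup.subset_closure ⟨_, hJv i hi⟩
    rintro x (⟨q, hq, rfl⟩ | ⟨i, hi, rfl⟩ | ⟨hx, hxJ⟩)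
    · have e : κ q + q = (κ q + ρ (κ q)) + (q - ρ (κ q)) := by abel
      rw [e]
      exact AddSubgroup.add_mem _ (hJc _ (hκJ q hq)) (hfle (hκρ q hq))
    · exact hJc i hi
    · exact AddSubgroup.subset_closure ⟨.inr ⟨x, hx⟩, by simp [w, hxJ]⟩

/-- The set of translates in a clone system has at most `d + 3` points; in the extremal case it
contains three translates of its points by a common vector. -/
theorem CloneSystem.card_le {S J Q : Finset V} {δ : V → V →ₗ[ℚ] ℚ} (hS : ThreeModular S)
    (h : CloneSystem S J Q δ) (hJ : 4 ≤ J.card) :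
    Q.card ≤ finrank ℚ (vectorSpan ℚ (Q : Set V)) + 3 ∧
      (finrank ℚ (vectorSpan ℚ (Q : Set V)) + 3 ≤ Q.card →
        ∃ x : V, x ≠ 0 ∧ ∃ E ⊆ Q, E.card = 3 ∧ ∀ e ∈ E, e - x ∈ Q) := by
  classical
  have small : ∀ Q' ⊆ Q, Q'.card ≤ finrank ℚ (vectorSpan ℚ (Q' : Set V)) + 4 →
      Q'.card ≤ finrank ℚ (vectorSpan ℚ (Q' : Set V)) + 3 ∧
      (finrank ℚ (vectorSpan ℚ (Q' : Set V)) + 3 ≤ Q'.card →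
        ∃ x : V, x ≠ 0 ∧ ∃ E ⊆ Q', E.card = 3 ∧ ∀ e ∈ E, e - x ∈ Q') := by
    intro Q' hQ' hle
    rcases Q'.eq_empty_or_nonempty with rfl | hne
    · simp
    obtain ⟨Φ, hΦ0, hΦ⟩ := (h.mono hQ').exists_alternating hS hne rfl (by omega)
    exact card_le_of_alternating rfl Φ hΦ0 hΦ
  have key : ∀ n, ∀ Q' ⊆ Q, Q'.card = n →
      Q'.card ≤ finrank ℚ (vectorSpan ℚ (Q' : Set V)) + 3 := by
    intro n
    induction n with
    | zero => intro Q' _ hn; omega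
    | succ n ih =>
      intro Q' hQ' hn
      obtain ⟨a, ha⟩ := Finset.card_pos.1 (by omega : 0 < Q'.card)
      have hc : (Q'.erase a).card = n := by rw [Finset.card_erase_of_mem ha]; omega
      have hmono : finrank ℚ (vectorSpan ℚ ((Q'.erase a : Finset V) : Set V)) ≤
          finrank ℚ (vectorSpan ℚ (Q' : Set V)) :=
        Submodule.finrank_mono (vectorSpan_mono ℚ (by
          exact_mod_cast Finset.erase_subset a Q'))
      have := ih _ ((Finset.erase_subset _ _).trans hQ') hc
      exact (small Q' hQ' (by omega)).1
  have h3 := key _ Q subset_rfl rfl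
  exact small Q subset_rfl (by omega)

end

section

open Module

variable {V : Type*} [AddCommGroup V] [Module ℚ V]

open Classical in
/-- A system of elements of `S`, independent modulo `F`, whose coordinates outside `A` vanish and
which contains at least `g` long elements. -/
structure LongSystem (S ι : Finset V) (F : Submodule ℚ V) (c : V → V →ₗ[ℚ] ℚ) (T A : Finset V)
    (g : ℕ) : Prop where
  subset : T ⊆ S
  indepMod : IndepMod F T id
  coord : ∀ x ∈ ι, x ∉ A → ∀ t ∈ T, c x t = 0
  le_card : g ≤ (T.filter (Long S F)).card

theorem LongSystem.insert_of_coord [DecidableEq V] {S ι T A A' Y : Finset V} {c : V → V →ₗ[ℚ] ℚ}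
    {g g' : ℕ} (hF : Frame S Y ι c) (h : LongSystem S ι (Submodule.span ℚ (Y : Set V)) c T A g)
    {p x : V} (hp : p ∈ S) (hx : x ∈ ι) (hxA : x ∉ A) (hxp : c x p ≠ 0) (hA : A ⊆ A')
    (hA' : ∀ y ∈ ι, y ∉ A' → c y p = 0)
    (hg : g' ≤ g ∨ (g' ≤ g + 1 ∧ Long S (Submodule.span ℚ (Y : Set V)) p)) :
    LongSystem S ι (Submodule.span ℚ (Y : Set V)) c (insert p T) A' g' ∧
      ∑ t ∈ insert p T, t = p + ∑ t ∈ T, t := by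
  classical
  have hpT : p ∉ T := fun hpT => hxp (h.coord x hx hxA p hpT)
  refine ⟨⟨Finset.insert_subset hp h.subset, h.indepMod.insert ?_, ?_, ?_⟩,
    Finset.sum_insert hpT⟩
  · intro hmem
    have hle : Submodule.span ℚ (Y : Set V) ⊔ Submodule.span ℚ (id '' (T : Set V)) ≤
        LinearMap.ker (c x) := by
      refine sup_le (fun w hw => hF.coord_span x hx w hw) (Submodule.span_le.2 ?_)
      rintro _ ⟨t, ht, rfl⟩
      exact h.coord x hx hxA t ht
    exact hxp (hle hmem)
  · intro y hy hyA t ht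
    rcases Finset.mem_insert.1 ht with ht | ht
    · rw [ht]; exact hA' y hy hyA
    · exact h.coord y hy (fun hh => hyA (hA hh)) t ht
  · have hc := h.le_card
    rcases hg with hg | ⟨hg, hl⟩
    · refine (hg.trans hc).trans (Finset.card_le_card ?_)
      exact Finset.filter_subset_filter _ (Finset.subset_insert _ _)
    · rw [Finset.filter_insert, if_pos hl, Finset.card_insert_of_notMem (by simp [hpT])]
      omega

/-- Outside `A`, differences of elements of the star have no parallel translates by `F`, and
common translates are determined modulo `F`. -/
structure Rigid (S Y ι : Finset V) (c : V → V →ₗ[ℚ] ℚ) (J : Finset V) (v : V → V)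
    (A : Finset V) : Prop where
  subset : A ⊆ ι
  sub_add_notMem : ∀ i ∈ J, ∀ j ∈ J, i ≠ j → v i ∉ A → v j ∉ A →
    ∀ f ∈ Submodule.span ℚ (Y : Set V), f ≠ 0 → i - j + f ∉ S
  eq_of_sub_mem : ∀ i ∈ J, ∀ j ∈ J, i ≠ j → v i ∉ A → v j ∉ A → ∀ q q' : V,
    q - q' ∈ Submodule.span ℚ (Y : Set V) → i + q ∈ S → i + q' ∈ S → j + q ∈ S →
    c (v i) q = 0 → c (v j) q = 0 → ∀ x ∈ ι, x ∉ A → x ≠ v i → x ≠ v j → c x q ≠ 0 → q = q'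

theorem StarSystem.coord_sub {S ι J : Finset V} {c : V → V →ₗ[ℚ] ℚ} {v : V → V} {a : V} {ε : ℚ}
    (h : StarSystem S ι c J v a ε) {i j x : V} (hi : i ∈ J) (hj : j ∈ J) (hx : x ∈ ι)
    (hxi : x ≠ v i) (hxj : x ≠ v j) : c x (i - j) = 0 := by
  rw [map_sub]
  by_cases hxa : x = a
  · rw [hxa, h.coord_center i hi, h.coord_center j hj, sub_self]
  · rw [h.coord_other i hi x hx hxa hxi, h.coord_other j hj x hx hxa hxj, sub_self]

theorem StarSystem.coord_vertex_of_ne {S ι J : Finset V} {c : V → V →ₗ[ℚ] ℚ} {v : V → V} {a : V}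
    {ε : ℚ} (h : StarSystem S ι c J v a ε) {i j : V} (hi : i ∈ J) (hj : j ∈ J) (hij : i ≠ j) :
    c (v i) j = 0 :=
  h.coord_other j hj _ (h.vertex_mem i hi) (h.vertex_ne i hi) fun e => hij (h.inj i hi j hj e)

theorem exists_rigid [FiniteDimensional ℚ V] {S Y ι J : Finset V} {c : V → V →ₗ[ℚ] ℚ} {v : V → V}
    {a : V} {ε : ℚ} (hS : ThreeModular S) (hF : Frame S Y ι c) (h : StarSystem S ι c J v a ε)
    (hJ : J.Nonempty) :
    ∃ A, a ∈ A ∧ A.card ≤ 3 * (6 * Y.card) + 2 ∧ Rigid S Y ι c J v A := by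
  classical
  obtain ⟨i0, hi0⟩ := hJ
  set F := Submodule.span ℚ (Y : Set V) with hFdef
  have key : ∀ g ≤ 6 * Y.card + 1, (∃ A, a ∈ A ∧ A.card ≤ 3 * (6 * Y.card) + 2 ∧
      Rigid S Y ι c J v A) ∨ ∃ A T j, A ⊆ ι ∧ a ∈ A ∧ v i0 ∈ A ∧ j ∈ J ∧ v j ∈ A ∧
        A.card ≤ 3 * g + 2 ∧ LongSystem S ι F c T A g ∧ ∑ t ∈ T, t = i0 - j ∧ (g = 0 ∨ j ≠ i0) := by
    intro g
    induction g with
    | zero =>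
      intro _
      refine .inr ⟨{a, v i0}, ∅, i0, ?_, by simp, by simp, hi0, by simp, ?_,
        ⟨by simp, ?_, by simp, by simp⟩, by simp, .inl rfl⟩
      · intro x hx
        simp only [Finset.mem_insert, Finset.mem_singleton] at hx
        rcases hx with hx | hx
        · rw [hx]; exact h.center_mem
        · rw [hx]; exact h.vertex_mem _ hi0
      · exact Finset.card_le_two
      · intro _ _ t ht
        simp at ht
    | succ g ih =>
      intro hg
      rcases ih (by omega) with ih | ⟨A, T, j, hA, haA, h0A, hj, hjA, hcard, hT, hsum, -⟩
      · exact .inl ih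
      by_cases hR : Rigid S Y ι c J v A
      · exact .inl ⟨A, haA, by omega, hR⟩
      refine .inr ?_
      have hvA : ∀ i, v i ∉ A → i ≠ j := by
        rintro i hi rfl; exact hi hjA
      have hv0 : ∀ i, v i ∉ A → i ≠ i0 := by
        rintro i hi rfl; exact hi h0A
      have first : ∀ i ∈ J, v i ∉ A → LongSystem S ι F c (insert (j - i) T) (insert (v i) A) g ∧
          ∑ t ∈ insert (j - i) T, t = (j - i) + ∑ t ∈ T, t := by
        intro i hi hiA
        refine hT.insert_of_coord hF (h.sub_mem j hj i hi (hvA i hiA).symm) (h.vertex_mem i hi) hiA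
          ?_ (Finset.subset_insert _ _) ?_ (.inl le_rfl)
        · rw [map_sub, h.coord_vertex_of_ne hi hj (hvA i hiA), zero_sub]
          exact neg_ne_zero.2 (h.coord_vertex i hi)
        · intro y hy hyA
          simp only [Finset.mem_insert, not_or] at hyA
          exact h.coord_sub hj hi hy (fun e => hyA.2 (e ▸ hjA)) hyA.1
      by_cases h1 : ∀ i ∈ J, ∀ j ∈ J, i ≠ j → v i ∉ A → v j ∉ A → ∀ f ∈ F, f ≠ 0 → i - j + f ∉ S
      · by_cases h2 : ∀ i ∈ J, ∀ j ∈ J, i ≠ j → v i ∉ A → v j ∉ A → ∀ q q' : V,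
          q - q' ∈ F → i + q ∈ S → i + q' ∈ S → j + q ∈ S → c (v i) q = 0 → c (v j) q = 0 →
            ∀ x ∈ ι, x ∉ A → x ≠ v i → x ≠ v j → c x q ≠ 0 → q = q'
        · exact absurd ⟨hA, h1, h2⟩ hR
        · push Not at h2
          obtain ⟨i, hi, j', hj', hij, hiA, hjA', q, q', hqq, hiq, hiq', hjq, hviq, hvjq, x, hx,
            hxA,
            hxi, hxj, hxq, hne⟩ := h2
          have hxa : x ≠ a := by rintro rfl; exact hxA haA
          have hxi0 : c x i = 0 := h.coord_other i hi x hx hxa hxi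
          have hxj0 : c x j' = 0 := h.coord_other j' hj' x hx hxa hxj
          have hvij : v i ≠ v j' := fun e => hij (h.inj i hi j' hj' e)
          obtain ⟨hT1, hs1⟩ := first i hi hiA
          have hviS : c (v i) (i + q) ≠ 0 := by
            rw [map_add, hviq, add_zero]; exact h.coord_vertex i hi
          have hvjS : c (v j') (j' + q) ≠ 0 := by
            rw [map_add, hvjq, add_zero]; exact h.coord_vertex j' hj'
          have hxiS : c x (i + q) ≠ 0 := by rw [map_add, hxi0, zero_add]; exact hxq
          have hxjS : c x (j' + q) ≠ 0 := by rw [map_add, hxj0, zero_add]; exact hxq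
          obtain ⟨hT2, hs2⟩ := hT1.insert_of_coord hF (p := i + q) (x := x)
            (A' := insert x (insert (v i) A)) (g' := g + 1) hiq hx (by simp [hxA, hxi]) hxiS
            (Finset.subset_insert _ _) (fun y hy hyA => by
              simp only [Finset.mem_insert, not_or] at hyA
              exact hF.eq_zero_of_ne hiq (h.vertex_mem i hi) hx hy hxi.symm hviS hxiS hyA.2.1 hyA.1)
            (.inr ⟨le_rfl, hiq, fun hm => hxiS (hF.coord_span x hx _ hm), q' - q,
              by rw [← neg_sub]; exact Submodule.neg_mem _ hqq, sub_ne_zero.2 hne.symm,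
              by convert hiq' using 1; abel⟩)
          obtain ⟨hT3, hs3⟩ := hT2.insert_of_coord hF (p := -(j' + q)) (x := v j')
            (A' := insert (v j') (insert x (insert (v i) A))) (g' := g + 1) (hS.neg_mem _ hjq)
            (h.vertex_mem j' hj') (by simp [hjA', hxj.symm, hvij.symm])
            (by rw [map_neg]; exact neg_ne_zero.2 hvjS)
            (Finset.subset_insert _ _) (fun y hy hyA => by
              simp only [Finset.mem_insert, not_or] at hyA
              rw [map_neg, hF.eq_zero_of_ne hjq (h.vertex_mem j' hj') hx hy hxj.symm hvjS hxjS hyA.1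
                hyA.2.1, neg_zero]) (.inl le_rfl)
          refine ⟨_, _, j', ?_, by simp [haA], by simp [h0A], hj', by simp, ?_, hT3, ?_,
            .inr (hv0 j' hjA')⟩
          · intro y hy
            simp only [Finset.mem_insert] at hy
            rcases hy with hy | hy | hy | hy
            · rw [hy]; exact h.vertex_mem _ hj'
            · rw [hy]; exact hx
            · rw [hy]; exact h.vertex_mem _ hi
            · exact hA hy
          · have e1 := Finset.card_insert_le (v j') (insert x (insert (v i) A))
            have e2 := Finset.card_insert_le x (insert (v i) A)
            have e3 := Finset.card_insert_le (v i) A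
            omega
          · rw [hs3, hs2, hs1, hsum]; abel
      · push Not at h1
        obtain ⟨i, hi, j', hj', hij, hiA, hjA', f, hf, hf0, hfS⟩ := h1
        have hvij : v i ≠ v j' := fun e => hij (h.inj i hi j' hj' e)
        obtain ⟨hT1, hs1⟩ := first i hi hiA
        have hvjS : c (v j') (i - j') ≠ 0 := by
          rw [map_sub, h.coord_vertex_of_ne hj' hi hij.symm, zero_sub]
          exact neg_ne_zero.2 (h.coord_vertex j' hj')
        obtain ⟨hT2, hs2⟩ := hT1.insert_of_coord hF (p := i - j') (x := v j')
          (A' := insert (v j') (insert (v i) A)) (g' := g + 1) (h.sub_mem i hi j' hj' hij)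
          (h.vertex_mem j' hj') (by simp [hjA', hvij.symm]) hvjS
          (Finset.subset_insert _ _) (fun y hy hyA => by
            simp only [Finset.mem_insert, not_or] at hyA
            exact h.coord_sub hi hj' hy hyA.2.1 hyA.1)
          (.inr ⟨le_rfl, h.sub_mem i hi j' hj' hij,
            fun hm => hvjS (hF.coord_span _ (h.vertex_mem j' hj') _ hm), f, hf, hf0, hfS⟩)
        refine ⟨_, _, j', ?_, by simp [haA], by simp [h0A], hj', by simp, ?_, hT2, ?_,
          .inr (hv0 j' hjA')⟩
        · intro y hy
          simp only [Finset.mem_insert] at hy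
          rcases hy with hy | hy | hy
          · rw [hy]; exact h.vertex_mem _ hj'
          · rw [hy]; exact h.vertex_mem _ hi
          · exact hA hy
        · have e2 := Finset.card_insert_le (v j') (insert (v i) A)
          have e3 := Finset.card_insert_le (v i) A
          omega
        · rw [hs2, hs1, hsum]; abel
  rcases key _ le_rfl with h1 | ⟨A, T, j, -, -, -, hj, -, -, hT, hsum, hj0⟩
  · exact h1
  exfalso
  have hne : j ≠ i0 := by
    rcases hj0 with hj0 | hj0
    · omega
    · exact hj0
  have h1 := hS.card_long_le hF.subset hT.subset hF.indep hT.indepMod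
    (h.sub_mem i0 hi0 j hj hne.symm) (by rw [hsum, sub_self]; exact Submodule.zero_mem _)
  have h2 := hT.le_card
  have h3 : (T.filter (Long S F)).card ≤ 6 * Y.card := by convert h1
  omega

end

section

open Module

variable {V : Type*} [AddCommGroup V] [Module ℚ V] [FiniteDimensional ℚ V]

/-- In the absence of gain, an element without parallel translates by `F` lies in at least
`finrank + 1` triangles outside `F`. -/
theorem exists_triangles_of_rigid {V : Type*} [AddCommGroup V] [Module ℚ V]
    {S : Finset V} {F : Submodule ℚ V} (hS : ThreeModular S)
    (hN : NoGain S) (hU : UniMod S F) {z : V} (hz : z ∈ S) (hzF : z ∉ F)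
    (hrigid : ∀ f ∈ F, f ≠ 0 → z + f ∉ S) :
    ∃ T ⊆ S, (∀ t ∈ T, t - z ∈ S) ∧ (∀ t ∈ T, t ∉ F ⊔ Submodule.span ℚ {z}) ∧
      (∀ t ∈ T, ∀ t' ∈ T, ∀ c : ℚ, t' - c • t ∈ Submodule.span ℚ {z} → t' = t) ∧
      finrank ℚ V + 1 ≤ T.card := by
  classical
  have hzz : z ∈ Submodule.span ℚ {z} := Submodule.mem_span_singleton_self z
  have hz0 := hS.ne_zero z hz
  set O := S.filter (· ∉ F ⊔ Submodule.span ℚ {z}) with hO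
  set E := S.filter (· ∈ F) with hE
  have hmem : ∀ x, x ∈ O ↔ x ∈ S ∧ x ∉ F ⊔ Submodule.span ℚ {z} := fun x => Finset.mem_filter
  have hmemE : ∀ x, x ∈ E ↔ x ∈ S ∧ x ∈ F := fun x => Finset.mem_filter
  have hFz : ∀ x ∈ F, x ∈ Submodule.span ℚ {z} → x = 0 := by
    intro x hx hxz
    obtain ⟨d, rfl⟩ := Submodule.mem_span_singleton.1 hxz
    by_cases hd : d = 0
    · simp [hd]
    · exact absurd ((Submodule.smul_mem_iff _ hd).1 hx) hzF
  obtain ⟨T, hTO, hTz, hTpar, hTcard⟩ := exists_triangles hN hz hz0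
    (O := O) (E := E) (e := 2) (Finset.filter_subset _ _) (Finset.filter_subset _ _)
    (fun u hu => by
      rw [hmem] at hu ⊢
      exact ⟨hS.neg_mem u hu.1, fun h => hu.2 (by simpa using Submodule.neg_mem _ h)⟩)
    (fun u hu => by
      rw [hmemE] at hu ⊢
      exact ⟨hS.neg_mem u hu.1, Submodule.neg_mem _ hu.2⟩)
    (fun u hu h => ((hmem u).1 hu).2 (Submodule.mem_sup_right h))
    (fun u hu h => hS.ne_zero u ((hmemE u).1 hu).1 (hFz u ((hmemE u).1 hu).2 h))
    (fun u hu v hv c hc => by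
      rw [hmem] at hu hv
      refine nonparallel_of_coord (fun h => hv.2 (Submodule.mem_sup_right h))
        (fun c d hcd => hU.coord_pair hu.1 hv.1 hz hzF hu.2 (by simp [hcd])) hc)
    (fun u hu v hv c hc => by
      rw [hmemE] at hu hv
      have h0 := hFz _ (Submodule.sub_mem _ hv.2 (Submodule.smul_mem _ c hu.2)) hc
      have hvc : v = c • u := sub_eq_zero.1 h0
      rcases hS.eq_or u hu.1 c (hvc ▸ hv.1) with h | h
      · left; rw [hvc, h, one_smul]
      · right; rw [hvc, h, neg_one_smul])
    (fun u hu v hv c hc => by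
      rw [hmem] at hu
      rw [hmemE] at hv
      have hcu : c • u ∈ F ⊔ Submodule.span ℚ {z} := by
        have := Submodule.sub_mem _ (Submodule.mem_sup_left hv.2 :
          v ∈ F ⊔ Submodule.span ℚ {z}) (Submodule.mem_sup_right hc)
        simpa using this
      by_cases h0 : c = 0
      · subst h0
        rw [zero_smul, sub_zero] at hc
        exact hS.ne_zero v hv.1 (hFz v hv.2 hc)
      · exact hu.2 ((Submodule.smul_mem_iff _ h0).1 hcu))
    (by
      have hsub : S ⊆ (O ∪ E) ∪ {z, -z} := by
        intro x hx
        by_cases hxW : x ∈ F ⊔ Submodule.span ℚ {z}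
        · obtain ⟨f, hf, g, hg, hfg⟩ := Submodule.mem_sup.1 hxW
          obtain ⟨d, rfl⟩ := Submodule.mem_span_singleton.1 hg
          by_cases hd : d = 0
          · have : x ∈ F := by rw [← hfg, hd]; simpa using hf
            simp [hE, hx, this]
          · have h1 := hU {z} id (by simpa using hz) (indepMod_singleton hzF) x hx (fun _ => d)
              (by simpa [← hfg] using hf) z (by simp)
            have hd1 : d = 1 ∨ d = -1 := by
              rcases h1 with h1 | h1 | h1
              · exact absurd h1 hd
              · exact .inl h1
              · exact .inr h1
            rcases hd1 with rfl | rfl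
            · have hf0 : f = 0 := by
                by_contra hf0
                refine hrigid f hf hf0 ?_
                have : z + f = x := by rw [← hfg, one_smul]; abel
                exact this ▸ hx
              have : x = z := by rw [← hfg, hf0]; simp
              simp [this]
            · have hf0 : f = 0 := by
                by_contra hf0
                refine hrigid (-f) (Submodule.neg_mem _ hf) (neg_ne_zero.2 hf0) ?_
                have : z + -f = -x := by rw [← hfg, neg_one_smul]; abel
                exact this ▸ hS.neg_mem x hx
              have : x = -z := by rw [← hfg, hf0]; simp
              simp [this]
        · simp [hO, hx, hxW]
      have h1 := Finset.card_le_card hsub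
      have h2 := Finset.card_union_le (O ∪ E) {z, -z}
      have h3 := Finset.card_union_le O E
      have h4 : ({z, -z} : Finset V).card ≤ 2 := Finset.card_le_two
      omega)
  exact ⟨T, fun t ht => ((hmem t).1 (hTO ht)).1, fun t ht => ((hmem _).1 (hTz t ht)).1,
    fun t ht => ((hmem t).1 (hTO ht)).2, hTpar, by omega⟩

open Classical in
/-- The common translates of two elements of a star. -/
noncomputable def commonTranslates (S : Finset V) (c : V → V →ₗ[ℚ] ℚ) (v : V → V) (i j : V) :
    Finset V :=
  (S.image (· - i)).filter fun q => j + q ∈ S ∧ c (v i) q = 0 ∧ c (v j) q = 0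

theorem mem_commonTranslates {V : Type*} [AddCommGroup V] [Module ℚ V]
    {S : Finset V} {c : V → V →ₗ[ℚ] ℚ} {v : V → V} {i j q : V} :
    q ∈ commonTranslates S c v i j ↔ i + q ∈ S ∧ j + q ∈ S ∧ c (v i) q = 0 ∧ c (v j) q = 0 := by
  classical
  simp only [commonTranslates, Finset.mem_filter, Finset.mem_image]
  refine and_congr_left fun _ => ⟨?_, fun h => ⟨i + q, h, by abel⟩⟩
  rintro ⟨x, hx, rfl⟩
  simpa using hx

theorem Rigid.le_card_commonTranslates {S Y ι J A : Finset V} {c : V → V →ₗ[ℚ] ℚ} {v : V → V}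
    {a : V} {ε : ℚ} (hS : ThreeModular S) (hN : NoGain S) (hF : Frame S Y ι c)
    (h : StarSystem S ι c J v a ε) (hR : Rigid S Y ι c J v A) {i j : V} (hi : i ∈ J) (hj : j ∈ J)
    (hij : i ≠ j) (hiA : v i ∉ A) (hjA : v j ∉ A) :
    finrank ℚ V + 1 ≤ (commonTranslates S c v i j).card := by
  classical
  have hU := hS.uniMod_of_hasBadCoord hF.subset hF.indep hF.bad
  have hz := h.sub_mem i hi j hj hij
  have hji0 := h.coord_vertex_of_ne hj hi hij.symm
  have hij0 := h.coord_vertex_of_ne hi hj hij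
  have hiz : c (v i) (i - j) = c (v i) i := by rw [map_sub, hij0, sub_zero]
  have hjz : c (v j) (i - j) = - c (v j) j := by rw [map_sub, hji0, zero_sub]
  have hiz0 : c (v i) (i - j) ≠ 0 := hiz ▸ h.coord_vertex i hi
  have hjz0 : c (v j) (i - j) ≠ 0 := hjz ▸ neg_ne_zero.2 (h.coord_vertex j hj)
  have hzF : i - j ∉ Submodule.span ℚ (Y : Set V) := fun hm =>
    hiz0 (hF.coord_span _ (h.vertex_mem i hi) _ hm)
  obtain ⟨T, hTS, hTz, hTF, hTpar, hTcard⟩ := exists_triangles_of_rigid hS hN hU hz hzF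
    (hR.sub_add_notMem i hi j hj hij hiA hjA)
  refine hTcard.trans ?_
  have hvij : v i ≠ v j := fun e => hij (h.inj i hi j hj e)
  have hcase := fun t (ht : t ∈ T) => hF.triangle hz (hTS ht)
    (by simpa using hS.neg_mem _ (hTz t ht)) (hTF t ht) (h.vertex_mem i hi) (h.vertex_mem j hj)
    hvij hiz0 hjz0
  have hzz := Submodule.mem_span_singleton_self (R := ℚ) (i - j)
  refine Finset.card_le_card_of_injOn (fun t => if c (v j) t = 0 then t - i else -j - t) ?_ ?_
  · intro t ht
    have ht : t ∈ T := ht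
    simp only [Finset.mem_coe, mem_commonTranslates]
    by_cases h0 : c (v j) t = 0
    · have h1 : c (v i) t = c (v i) (i - j) := by
        rcases hcase t ht with h1 | h1
        · exact h1.1
        · exact absurd (h1.2.symm.trans h0) hjz0
      rw [if_pos h0]
      refine ⟨by simpa using hTS ht, ?_, by rw [map_sub, h1, hiz, sub_self],
        by rw [map_sub, h0, hji0, sub_self]⟩
      convert hTz t ht using 1; abel
    · obtain ⟨h1, h2⟩ : c (v i) t = 0 ∧ c (v j) t = c (v j) (i - j) := by
        rcases hcase t ht with h1 | h1
        · exact absurd h1.2 h0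
        · exact h1
      rw [if_neg h0]
      refine ⟨?_, ?_, by rw [map_sub, map_neg, h1, hij0]; simp,
        by rw [map_sub, map_neg, h2, hjz]; simp⟩
      · convert hS.neg_mem _ (hTz t ht) using 1; abel
      · convert hS.neg_mem _ (hTS ht) using 1; abel
  · intro t ht t' ht' he
    have ht : t ∈ T := ht
    have ht' : t' ∈ T := ht'
    simp only at he
    split_ifs at he with h0 h1 h1
    · exact sub_left_injective he
    · have : t = t' := hTpar t' ht' t ht (-1) (by
        have : t - (-1 : ℚ) • t' = i - j := by
          rw [neg_one_smul, sub_neg_eq_add, ← sub_eq_zero]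
          rw [← sub_eq_zero] at he
          rw [← he]; abel
        rw [this]; exact hzz)
      exact absurd (this ▸ h0) h1
    · have : t = t' := hTpar t' ht' t ht (-1) (by
        have : t - (-1 : ℚ) • t' = i - j := by
          rw [neg_one_smul, sub_neg_eq_add, ← sub_eq_zero]
          rw [← sub_eq_zero] at he
          rw [← neg_eq_zero, ← he]; abel
        rw [this]; exact hzz)
      exact absurd (this ▸ h1) h0
    · exact sub_right_injective he

end

section

open Module

/-- A large family of small finite sets meeting pairwise in exactly one point has a common point. -/
theorem exists_common_mem {α β : Type*} [DecidableEq α] [DecidableEq β] {J : Finset α}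
    {Q : α → Finset β} {s : ℕ} (hs : ∀ i ∈ J, (Q i).card ≤ s)
    (h : ∀ i ∈ J, ∀ j ∈ J, i ≠ j → ∃ q, q ∈ Q i ∧ q ∈ Q j ∧ ∀ q', q' ∈ Q i → q' ∈ Q j → q' = q)
    (hJ : s * s + 2 ≤ J.card) : ∃ q, ∀ i ∈ J, q ∈ Q i := by
  obtain ⟨i0, hi0⟩ := Finset.card_pos.1 (by omega : 0 < J.card)
  have hg : ∀ i, ∃ q, (i ∈ J.erase i0 → q ∈ Q i0 ∧ q ∈ Q i) := by
    intro i
    by_cases hi : i ∈ J.erase i0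
    · obtain ⟨h1, h2⟩ := Finset.mem_erase.1 hi
      obtain ⟨q, hq, hq', -⟩ := h i0 hi0 i h2 h1.symm
      exact ⟨q, fun _ => ⟨hq, hq'⟩⟩
    · obtain ⟨j, hj⟩ := Finset.card_pos.1 (by rw [Finset.card_erase_of_mem hi0]; omega :
        0 < (J.erase i0).card)
      obtain ⟨h1, h2⟩ := Finset.mem_erase.1 hj
      obtain ⟨q, -⟩ := h i0 hi0 j h2 h1.symm
      exact ⟨q, fun hh => absurd hh hi⟩
  choose g hg using hg
  obtain ⟨q, hq, hlt⟩ := Finset.exists_lt_card_fiber_of_mul_lt_card_of_maps_to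
    (s := J.erase i0) (t := Q i0) (f := g) (n := s) (fun i hi => (hg i hi).1) (by
      rw [Finset.card_erase_of_mem hi0]
      have := Nat.mul_le_mul_right s (hs i0 hi0)
      omega)
  set A := (J.erase i0).filter fun i => g i = q with hA
  have hAJ : ∀ i ∈ A, i ∈ J ∧ q ∈ Q i := by
    intro i hi
    obtain ⟨h1, h2⟩ := Finset.mem_filter.1 hi
    exact ⟨Finset.mem_of_mem_erase h1, h2 ▸ (hg i h1).2⟩
  refine ⟨q, fun l hl => ?_⟩
  by_contra hql
  have hne : ∀ i ∈ A, i ≠ l := by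
    rintro i hi rfl
    exact hql (hAJ i hi).2
  have hp : ∀ i, ∃ p, (i ∈ A → p ∈ Q l ∧ p ∈ Q i) := by
    intro i
    by_cases hi : i ∈ A
    · obtain ⟨p, hp, hp', -⟩ := h l hl i (hAJ i hi).1 (hne i hi).symm
      exact ⟨p, fun _ => ⟨hp, hp'⟩⟩
    · exact ⟨q, fun hh => absurd hh hi⟩
  choose p hp using hp
  have := Finset.card_le_card_of_injOn p (s := A) (t := Q l) (fun i hi => (hp i hi).1) (by
    intro i hi j hj he
    by_contra hij
    obtain ⟨x, -, -, hx⟩ := h i (hAJ i hi).1 j (hAJ j hj).1 hij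
    have h1 := hx q (hAJ i hi).2 (hAJ j hj).2
    have h2 := hx (p i) (hp i hi).2 (he ▸ (hp j hj).2)
    exact hql (by rw [h1, ← h2]; exact (hp i hi).1))
  have := hs l hl
  omega

variable {V : Type*} [AddCommGroup V] [Module ℚ V] [FiniteDimensional ℚ V]

theorem Frame.mem_span_union {V : Type*} [AddCommGroup V] [Module ℚ V]
    [DecidableEq V] {S Y ι A : Finset V} {c : V → V →ₗ[ℚ] ℚ}
    (hF : Frame S Y ι c) (hA : A ⊆ ι) {q : V} (hq : ∀ x ∈ ι, x ∉ A → c x q = 0) :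
    q ∈ Submodule.span ℚ ((Y ∪ A : Finset V) : Set V) := by
  have h1 : q - ∑ a ∈ A, c a q • a ∈ Submodule.span ℚ (Y : Set V) := by
    apply hF.mem_span
    intro x hx
    rw [map_sub]
    by_cases hxA : x ∈ A
    · rw [hF.coord_sum hA (fun a => c a q) hxA, sub_self]
    · rw [hq x hx hxA, map_sum, Finset.sum_eq_zero, sub_zero]
      intro a ha
      have : x ≠ a := by rintro rfl; exact hxA ha
      rw [map_smul, hF.coord_ne x hx a (hA ha) this, smul_zero]
  rw [Finset.coe_union, Submodule.span_union]
  have h2 : ∑ a ∈ A, c a q • a ∈ Submodule.span ℚ (A : Set V) :=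
    Submodule.sum_mem _ fun a ha => Submodule.smul_mem _ _ (Submodule.subset_span ha)
  have := Submodule.add_mem _ (Submodule.mem_sup_left h1 :
    _ ∈ Submodule.span ℚ (Y : Set V) ⊔ Submodule.span ℚ (A : Set V)) (Submodule.mem_sup_right h2)
  simpa using this

/-- Many elements of a star have the same translates in the span of `Y ∪ A`. -/
theorem StarSystem.exists_same_translates {S Y ι J A : Finset V} {c : V → V →ₗ[ℚ] ℚ} {v : V → V}
    {a : V} {ε : ℚ} (hS : ThreeModular S) (hF : Frame S Y ι c) (h : StarSystem S ι c J v a ε)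
    (hA : A ⊆ ι) (hvA : ∀ i ∈ J, v i ∉ A) {N : ℕ}
    (hJ : 2 ^ (7 ^ (Y.card + A.card)) * N < J.card) :
    ∃ J' ⊆ J, N < J'.card ∧ ∃ P : Finset V, ∀ i ∈ J', ∀ q,
      q ∈ P ↔ i + q ∈ S ∧ ∀ x ∈ ι, x ∉ A → c x q = 0 := by
  classical
  have hYA : Disjoint Y A ∧ LinearIndepOn ℚ id ((Y ∪ A : Finset V) : Set V) :=
    LinearIndepOn.union_indepMod hF.indep (hF.indepMod.mono hA)
  have hcard : (Y ∪ A).card = Y.card + A.card := Finset.card_union_of_disjoint hYA.1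
  have hYAS : Y ∪ A ⊆ S := Finset.union_subset hF.subset (hA.trans hF.index_subset)
  have hJi : IndepMod (Submodule.span ℚ ((Y ∪ A : Finset V) : Set V)) J id := by
    intro b hb i hi
    have hle : Submodule.span ℚ ((Y ∪ A : Finset V) : Set V) ≤ LinearMap.ker (c (v i)) := by
      rw [Submodule.span_le]
      intro x hx
      rcases Finset.mem_union.1 hx with hx | hx
      · exact hF.coord_span _ (h.vertex_mem i hi) x (Submodule.subset_span hx)
      · refine hF.coord_ne _ (h.vertex_mem i hi) x (hA hx) ?_
        rintro rfl
        exact hvA i hi hx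
    have h0 : c (v i) (∑ t ∈ J, b t • id t) = 0 := hle hb
    rw [map_sum, Finset.sum_eq_single_of_mem i hi] at h0
    · simpa [h.coord_vertex i hi] using h0
    · intro j hj hji
      simp [h.coord_vertex_of_ne hi hj hji.symm]
  obtain ⟨d, hd, hdet⟩ := hS.exists_detMod hYAS h.subset hYA.2 hJi
  let ψ : ((Y ∪ A : Finset V) → ℤ) → V := fun g => ∑ s, ((g s : ℚ) / d) • (s : V)
  set Ω := (Fintype.piFinset fun _ : (Y ∪ A : Finset V) => Finset.Icc (-3 : ℤ) 3).image ψ with hΩ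
  have hΩcard : Ω.card ≤ 7 ^ (Y.card + A.card) := by
    refine Finset.card_image_le.trans ?_
    rw [Fintype.card_piFinset]
    simp [hcard]
  let P : V → Finset V := fun i =>
    (S.image (· - i)).filter fun q => ∀ x ∈ ι, x ∉ A → c x q = 0
  have hP : ∀ i q, q ∈ P i ↔ i + q ∈ S ∧ ∀ x ∈ ι, x ∉ A → c x q = 0 := by
    intro i q
    simp only [P, Finset.mem_filter, Finset.mem_image]
    refine and_congr_left fun _ => ⟨?_, fun h => ⟨i + q, h, by abel⟩⟩
    rintro ⟨x, hx, rfl⟩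
    simpa using hx
  have hPΩ : ∀ i ∈ J, P i ∈ Ω.powerset := by
    intro i hi
    rw [Finset.mem_powerset]
    intro q hq
    obtain ⟨hqS, hq⟩ := (hP i q).1 hq
    obtain ⟨b, -, hb⟩ := Submodule.mem_span_finset.1 (hF.mem_span_union hA hq)
    have h1 := (hdet id (fun t ht => h.subset ht) (by simp) _ hqS
      (fun t => if t = i then 1 else 0) b (by rw [hb]; simp [hi])).2
    have hex : ∀ s : (Y ∪ A : Finset V), ∃ k : ℤ, b s * d = k ∧ |k| ≤ 3 := fun s => h1 s s.2
    choose g hg hg3 using hex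
    rw [hΩ, Finset.mem_image]
    refine ⟨g, ?_, ?_⟩
    · rw [Fintype.mem_piFinset]
      intro s
      rw [Finset.mem_Icc]
      exact _root_.abs_le.1 (hg3 s)
    · rw [← hb, ← Finset.sum_coe_sort]
      refine Finset.sum_congr rfl fun s _ => ?_
      rw [← hg s, mul_div_assoc, div_self hd, mul_one]
  obtain ⟨P0, -, hlt⟩ := Finset.exists_lt_card_fiber_of_mul_lt_card_of_maps_to (n := N) hPΩ (by
    rw [Finset.card_powerset]
    exact lt_of_le_of_lt (Nat.mul_le_mul_right N (Nat.pow_le_pow_right (by norm_num) hΩcard)) hJ)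
  refine ⟨_, Finset.filter_subset _ _, hlt, P0, fun i hi q => ?_⟩
  rw [← (Finset.mem_filter.1 hi).2]
  exact hP i q

end

section

open Module

variable {V : Type*} [AddCommGroup V] [Module ℚ V] [FiniteDimensional ℚ V]

theorem Rigid.eq_of_coord_ne {V : Type*} [AddCommGroup V] [Module ℚ V]
    {S Y ι J A : Finset V} {c : V → V →ₗ[ℚ] ℚ} {v : V → V}
    {a : V} {ε : ℚ} (hF : Frame S Y ι c)
    (h : StarSystem S ι c J v a ε) (hU : UniMod S (Submodule.span ℚ (Y : Set V)))
    (haA : a ∈ A) {i x : V} (hi : i ∈ J) (hx : x ∈ ι) (hxA : x ∉ A)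
    (hxi : x ≠ v i) {q q' : V} (hq : i + q ∈ S) (hq' : i + q' ∈ S) (hqi : c (v i) q = 0)
    (hqi' : c (v i) q' = 0) (hxq : c x q ≠ 0) (hxq' : c x q' ≠ 0) :
    q - q' ∈ Submodule.span ℚ (Y : Set V) := by
  have hx0 : c x i = 0 := h.coord_other i hi x hx (by rintro rfl; exact hxA haA) hxi
  have h1 : ∀ q, c (v i) q = 0 → c (v i) (i + q) = c (v i) i := fun q hq => by
    rw [map_add, hq, add_zero]
  have h2 : ∀ q, c x (i + q) = c x q := fun q => by rw [map_add, hx0, zero_add]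
  have := hF.sub_mem hU hq hq' (h.vertex_mem i hi) hx hxi.symm
    (by rw [h1 q hqi]; exact h.coord_vertex i hi) (by rw [h1 q hqi, h1 q' hqi'])
    (by rw [h2]; exact hxq) (by rw [h2]; exact hxq')
  simpa using this

theorem Rigid.exists_cloneSystem {S Y ι J A : Finset V} {c : V → V →ₗ[ℚ] ℚ} {v : V → V}
    {a : V} {ε : ℚ} (hS : ThreeModular S) (hN : NoGain S) (hF : Frame S Y ι c)
    (h : StarSystem S ι c J v a ε) (hR : Rigid S Y ι c J v A) (haA : a ∈ A)
    (hvA : ∀ i ∈ J, v i ∉ A) {P : Finset V}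
    (hP : ∀ i ∈ J, ∀ q, q ∈ P ↔ i + q ∈ S ∧ ∀ x ∈ ι, x ∉ A → c x q = 0)
    (hJ : 7 ^ (Y.card + 1) * 7 ^ (Y.card + 1) + 2 ≤ J.card) :
    ∃ (Q : Finset V) (δ : V → V →ₗ[ℚ] ℚ), CloneSystem S J Q δ ∧
      finrank ℚ V + 3 ≤ Q.card + J.card := by
  classical
  have hU := hS.uniMod_of_hasBadCoord hF.subset hF.indep hF.bad
  have hJ4 : 4 ≤ J.card := by
    have : 7 ≤ 7 ^ (Y.card + 1) := Nat.le_self_pow (by omega) 7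
    nlinarith
  have hsq : ∀ i ∈ J, c (v i) i * c (v i) i = 1 := by
    intro i hi
    rcases hF.coord i (h.subset hi) _ (h.vertex_mem i hi) with h1 | h1 | h1
    · exact absurd h1 (h.coord_vertex i hi)
    · rw [h1]; norm_num
    · rw [h1]; norm_num
  let δ : V → V →ₗ[ℚ] ℚ := fun i => c (v i) i • c (v i)
  have hclone : ∀ Q : Finset V, (∀ i ∈ J, ∀ q ∈ Q, i + q ∈ S ∧ c (v i) q = 0) →
      CloneSystem S J Q δ := by
    intro Q hQ
    refine ⟨h.sub_mem, fun i hi q hq => (hQ i hi q hq).1, fun i hi => hsq i hi,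
      fun i hi j hj hij => ?_, fun i hi q hq => ?_⟩
    · simp [δ, h.coord_vertex_of_ne hi hj hij]
    · simp [δ, (hQ i hi q hq).2]
  have hPJ : ∀ i ∈ J, ∀ q ∈ P, i + q ∈ S ∧ c (v i) q = 0 := fun i hi q hq =>
    ⟨((hP i hi q).1 hq).1, ((hP i hi q).1 hq).2 _ (h.vertex_mem i hi) (hvA i hi)⟩
  have hPcard : P.card ≤ Y.card + A.card + 3 := by
    have h1 := ((hclone P hPJ).card_le hS hJ4).1
    obtain ⟨i, hi⟩ := Finset.card_pos.1 (by omega : 0 < J.card)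
    have h2 : vectorSpan ℚ (P : Set V) ≤ Submodule.span ℚ ((Y ∪ A : Finset V) : Set V) := by
      rw [vectorSpan_def, Submodule.span_le]
      intro x hx
      obtain ⟨q, hq, q', hq', rfl⟩ := Set.mem_vsub.1 hx
      exact Submodule.sub_mem _ (hF.mem_span_union hR.subset ((hP i hi q).1 hq).2)
        (hF.mem_span_union hR.subset ((hP i hi q').1 hq').2)
    have h3 := (Submodule.finrank_mono h2).trans (finrank_span_finset_le_card _)
    have h4 := Finset.card_union_le Y A
    omega
  have hAι := Finset.card_le_card hR.subset
  have hιA := Finset.card_sdiff_of_subset hR.subset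
  have hr := hF.card
  have pair : ∀ i ∈ J, ∀ j ∈ J, i ≠ j → Y.card + A.card + 3 ≤ P.card ∧
      ∀ x ∈ ι, x ∉ A → x ≠ v i → x ≠ v j → ∃ q ∈ commonTranslates S c v i j, c x q ≠ 0 ∧
        ∀ q' ∈ commonTranslates S c v i j, c x q' ≠ 0 → q' = q := by
    intro i hi j hj hij
    have hC := hR.le_card_commonTranslates hS hN hF h hi hj hij (hvA i hi) (hvA j hj)
    set C := commonTranslates S c v i j with hCdef
    have hmem : ∀ q, q ∈ C ↔ i + q ∈ S ∧ j + q ∈ S ∧ c (v i) q = 0 ∧ c (v j) q = 0 := fun q =>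
      mem_commonTranslates
    have hvij : v i ≠ v j := fun e => hij (h.inj i hi j hj e)
    set W := ((ι \ A).erase (v i)).erase (v j) with hW
    have hWmem : ∀ x, x ∈ W ↔ x ∈ ι ∧ x ∉ A ∧ x ≠ v i ∧ x ≠ v j := by
      intro x
      simp only [hW, Finset.mem_erase, Finset.mem_sdiff]
      tauto
    have hWcard : W.card + 2 = ι.card - A.card := by
      have hi' : v i ∈ ι \ A := Finset.mem_sdiff.2 ⟨h.vertex_mem i hi, hvA i hi⟩
      have hj' : v j ∈ (ι \ A).erase (v i) :=
        Finset.mem_erase.2 ⟨hvij.symm, Finset.mem_sdiff.2 ⟨h.vertex_mem j hj, hvA j hj⟩⟩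
      have h1 : ((ι \ A).erase (v i)).card = (ι \ A).card - 1 := Finset.card_erase_of_mem hi'
      have h2 : W.card = ((ι \ A).erase (v i)).card - 1 := Finset.card_erase_of_mem hj'
      have h3 := Finset.card_pos.2 ⟨_, hj'⟩
      have h4 := Finset.card_pos.2 ⟨_, hi'⟩
      omega
    have huniq : ∀ x ∈ W, ∀ q ∈ C, ∀ q' ∈ C, c x q ≠ 0 → c x q' ≠ 0 → q = q' := by
      intro x hx q hq q' hq' hxq hxq'
      obtain ⟨hx, hxA, hxi, hxj⟩ := (hWmem x).1 hx
      obtain ⟨h1, h2, h3, h4⟩ := (hmem q).1 hq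
      obtain ⟨h1', h2', h3', h4'⟩ := (hmem q').1 hq'
      exact hR.eq_of_sub_mem i hi j hj hij (hvA i hi) (hvA j hj) q q'
        (Rigid.eq_of_coord_ne hF h hU haA hi hx hxA hxi h1 h1' h3 h3' hxq hxq') h1 h1' h2 h3 h4 x
        hx hxA hxi hxj hxq
    have hocc : ∀ W' : Finset V, (∀ q ∈ C, q ∉ P → ∃ x ∈ W', c x q ≠ 0) → W' ⊆ W →
        C.card ≤ P.card + W'.card := by
      intro W' hW' hsub
      have h1 : C ⊆ P ∪ W'.biUnion fun x => C.filter fun q => c x q ≠ 0 := by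
        intro q hq
        by_cases hqP : q ∈ P
        · exact Finset.mem_union_left _ hqP
        · obtain ⟨x, hx, hxq⟩ := hW' q hq hqP
          exact Finset.mem_union_right _
            (Finset.mem_biUnion.2 ⟨x, hx, Finset.mem_filter.2 ⟨hq, hxq⟩⟩)
      refine (Finset.card_le_card h1).trans ((Finset.card_union_le _ _).trans ?_)
      have h2 := Finset.card_biUnion_le_card_mul W' (fun x => C.filter fun q => c x q ≠ 0) 1
        (fun x hx => Finset.card_le_one.2 fun q hq q' hq' => by
          obtain ⟨hq, hxq⟩ := Finset.mem_filter.1 hq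
          obtain ⟨hq', hxq'⟩ := Finset.mem_filter.1 hq'
          exact huniq x (hsub hx) q hq q' hq' hxq hxq')
      omega
    have hcov : ∀ q ∈ C, q ∉ P → ∃ x ∈ W, c x q ≠ 0 := by
      intro q hq hqP
      by_contra! hcon
      apply hqP
      obtain ⟨h1, -, h3, h4⟩ := (hmem q).1 hq
      refine (hP i hi q).2 ⟨h1, fun x hx hxA => ?_⟩
      by_cases hxi : x = v i
      · rw [hxi, h3]
      by_cases hxj : x = v j
      · rw [hxj, h4]
      exact hcon x ((hWmem x).2 ⟨hx, hxA, hxi, hxj⟩)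
    have hall := hocc W hcov subset_rfl
    refine ⟨by omega, fun x hx hxA hxi hxj => ?_⟩
    have hxW := (hWmem x).2 ⟨hx, hxA, hxi, hxj⟩
    by_contra! hcon
    have hno : ∀ q ∈ C, c x q = 0 := by
      intro q hq
      by_contra hxq
      obtain ⟨q', hq', hxq', hne⟩ := hcon q hq hxq
      exact hne (huniq x hxW q' hq' q hq hxq' hxq)
    have h1 := hocc (W.erase x) (fun q hq hqP => by
      obtain ⟨y, hy, hyq⟩ := hcov q hq hqP
      refine ⟨y, Finset.mem_erase.2 ⟨?_, hy⟩, hyq⟩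
      rintro rfl
      exact hyq (hno q hq)) (Finset.erase_subset _ _)
    have h2 := Finset.card_erase_of_mem hxW
    have h3 := Finset.card_pos.2 ⟨_, hxW⟩
    omega
  set X := (ι \ A) \ J.image v with hX
  have hXmem : ∀ x, x ∈ X ↔ x ∈ ι ∧ x ∉ A ∧ ∀ i ∈ J, x ≠ v i := by
    intro x
    simp only [hX, Finset.mem_sdiff, Finset.mem_image, not_exists, not_and, and_assoc]
    refine and_congr_right fun _ => and_congr_right fun _ => ?_
    exact forall₂_congr fun i _ => ne_comm
  have hXcard : X.card = ι.card - A.card - J.card ∧ J.card ≤ ι.card - A.card := by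
    have hsub : J.image v ⊆ ι \ A := by
      intro x hx
      obtain ⟨i, hi, rfl⟩ := Finset.mem_image.1 hx
      exact Finset.mem_sdiff.2 ⟨h.vertex_mem i hi, hvA i hi⟩
    have h1 : (J.image v).card = J.card := Finset.card_image_of_injOn fun i hi j hj =>
      h.inj i hi j hj
    have h2 := Finset.card_le_card hsub
    rw [hX, Finset.card_sdiff_of_subset hsub, h1, hιA]
    omega
  have hq : ∀ x, ∃ q, (x ∈ X → ∀ i ∈ J, i + q ∈ S ∧ c (v i) q = 0 ∧ c x q ≠ 0) := by
    intro x
    by_cases hx : x ∈ X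
    swap
    · exact ⟨0, fun hh => absurd hh hx⟩
    obtain ⟨hxι, hxA, hxJ⟩ := (hXmem x).1 hx
    let Q : V → Finset V := fun i => (S.image (· - i)).filter fun q => c (v i) q = 0 ∧ c x q ≠ 0
    have hQ : ∀ i q, q ∈ Q i ↔ i + q ∈ S ∧ c (v i) q = 0 ∧ c x q ≠ 0 := by
      intro i q
      simp only [Q, Finset.mem_filter, Finset.mem_image]
      refine and_congr_left fun _ => ⟨?_, fun h => ⟨i + q, h, by abel⟩⟩
      rintro ⟨x, hx, rfl⟩
      simpa using hx
    obtain ⟨q, hq⟩ := exists_common_mem (J := J) (Q := Q) (s := 7 ^ (Y.card + 1)) (by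
      intro i hi
      rcases (Q i).eq_empty_or_nonempty with he | ⟨q0, hq0⟩
      · rw [he]; simp
      obtain ⟨h0, h0i, h0x⟩ := (hQ i q0).1 hq0
      have hnot : i + q0 ∉ Submodule.span ℚ (Y : Set V) := by
        intro hm
        have := hF.coord_span _ (h.vertex_mem i hi) _ hm
        rw [map_add, h0i, add_zero] at this
        exact h.coord_vertex i hi this
      have := hS.card_le_of_subset_sup_span hF.subset (T := {i + q0}) (by simpa using h0) hF.indep
        (indepMod_singleton hnot) (W := (Q i).image fun q => i + q)
        (by
          intro w hw
          obtain ⟨q, hq, rfl⟩ := Finset.mem_image.1 hw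
          exact ((hQ i q).1 hq).1)
        (by
          intro w hw
          obtain ⟨q, hq, rfl⟩ := Finset.mem_image.1 hw
          obtain ⟨h1, h1i, h1x⟩ := (hQ i q).1 hq
          have hd := Rigid.eq_of_coord_ne hF h hU haA hi hxι hxA (hxJ i hi) h1 h0 h1i h0i h1x h0x
          have e : i + q = (q - q0) + (i + q0) := by abel
          rw [e]
          exact Submodule.add_mem _ (Submodule.mem_sup_left hd)
            (Submodule.mem_sup_right (Submodule.subset_span (by simp))))
      rw [Finset.card_image_of_injective _ (add_right_injective i), Finset.card_singleton] at this
      exact this) (by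
      intro i hi j hj hij
      obtain ⟨q, hq, hxq, hu⟩ := (pair i hi j hj hij).2 x hxι hxA (hxJ i hi) (hxJ j hj)
      obtain ⟨h1, h2, h3, h4⟩ := mem_commonTranslates.1 hq
      refine ⟨q, (hQ i q).2 ⟨h1, h3, hxq⟩, (hQ j q).2 ⟨h2, h4, hxq⟩, fun q' hq' hq'' => ?_⟩
      obtain ⟨h1', h3', hx'⟩ := (hQ i q').1 hq'
      obtain ⟨h2', h4', -⟩ := (hQ j q').1 hq''
      exact hu q' (mem_commonTranslates.2 ⟨h1', h2', h3', h4'⟩) hx') hJ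
    exact ⟨q, fun _ i hi => (hQ i q).1 (hq i hi)⟩
  choose qx hqx using hq
  obtain ⟨i0, hi0, j0, hj0, hij0⟩ := Finset.one_lt_card.1 (by omega : 1 < J.card)
  have hother : ∀ x ∈ X, ∀ y ∈ X, y ≠ x → c y (qx x) = 0 := by
    intro x hx y hy hyx
    obtain ⟨hxι, hxA, hxJ⟩ := (hXmem x).1 hx
    obtain ⟨hyι, hyA, hyJ⟩ := (hXmem y).1 hy
    obtain ⟨h1, h2, h3⟩ := hqx x hx i0 hi0
    have hc0 : ∀ y ∈ ι, y ∉ A → y ≠ v i0 → c y i0 = 0 := fun y hy hyA hyi =>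
      h.coord_other i0 hi0 y hy (by rintro rfl; exact hyA haA) hyi
    have := hF.eq_zero_of_ne h1 (h.vertex_mem i0 hi0) hxι hyι (hxJ i0 hi0).symm
      (by rw [map_add, h2, add_zero]; exact h.coord_vertex i0 hi0)
      (by rw [map_add, hc0 x hxι hxA (hxJ i0 hi0), zero_add]; exact h3) (hyJ i0 hi0) hyx
    rwa [map_add, hc0 y hyι hyA (hyJ i0 hi0), zero_add] at this
  have hinj : (X.image qx).card = X.card := Finset.card_image_of_injOn fun x hx y hy he => by
    by_contra hxy
    have h1 := hother y hy x hx hxy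
    have he : qx x = qx y := he
    rw [← he] at h1
    exact (hqx x hx i0 hi0).2.2 h1
  have hdisj : Disjoint P (X.image qx) := by
    rw [Finset.disjoint_left]
    intro q hqP hqX
    obtain ⟨x, hx, rfl⟩ := Finset.mem_image.1 hqX
    obtain ⟨hxι, hxA, -⟩ := (hXmem x).1 hx
    exact (hqx x hx i0 hi0).2.2 (((hP i0 hi0 _).1 hqP).2 x hxι hxA)
  refine ⟨P ∪ X.image qx, δ, hclone _ fun i hi q hq => ?_, ?_⟩
  · rcases Finset.mem_union.1 hq with hq | hq
    · exact hPJ i hi q hq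
    · obtain ⟨x, hx, rfl⟩ := Finset.mem_image.1 hq
      exact ⟨(hqx x hx i hi).1, (hqx x hx i hi).2.1⟩
  · have := (pair i0 hi0 j0 hj0 hij0).1
    rw [Finset.card_union_of_disjoint hdisj, hinj]
    omega

theorem StarSystem.mono {V : Type*} [AddCommGroup V] [Module ℚ V]
    {S ι J J' : Finset V} {c : V → V →ₗ[ℚ] ℚ} {v : V → V} {a : V} {ε : ℚ}
    (h : StarSystem S ι c J v a ε) (hJ : J' ⊆ J) : StarSystem S ι c J' v a ε :=
  ⟨hJ.trans h.subset, h.center_mem, fun u hu => h.vertex_mem u (hJ hu),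
    fun u hu => h.vertex_ne u (hJ hu), fun u hu u' hu' => h.inj u (hJ hu) u' (hJ hu'),
    fun u hu => h.coord_vertex u (hJ hu), fun u hu => h.coord_center u (hJ hu),
    fun u hu => h.coord_other u (hJ hu), fun u hu u' hu' => h.sub_mem u (hJ hu) u' (hJ hu')⟩

theorem Rigid.mono {V : Type*} [AddCommGroup V] [Module ℚ V]
    {S Y ι J J' A : Finset V} {c : V → V →ₗ[ℚ] ℚ} {v : V → V}
    (h : Rigid S Y ι c J v A) (hJ : J' ⊆ J) : Rigid S Y ι c J' v A :=
  ⟨h.subset, fun i hi j hj => h.sub_add_notMem i (hJ hi) j (hJ hj),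
    fun i hi j hj => h.eq_of_sub_mem i (hJ hi) j (hJ hj)⟩

/-- In large rank and in the absence of gain there is a clone system with many clones and the
largest possible number of translates. -/
theorem exists_cloneSystem (p : ℕ) : ∃ R : ℕ, ∀ {V : Type*} [AddCommGroup V] [Module ℚ V]
    [FiniteDimensional ℚ V] {S : Finset V}, ThreeModular S → NoGain S → R ≤ finrank ℚ V →
    ∃ (J Q : Finset V) (δ : V → V →ₗ[ℚ] ℚ), CloneSystem S J Q δ ∧ p ≤ J.card ∧
      finrank ℚ V + 3 ≤ Q.card + J.card := by
  classical
  obtain ⟨C, R0, hR0⟩ := ThreeModular.exists_frame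
  let N : ℕ → ℕ := fun k => 7 ^ (k + 1) * 7 ^ (k + 1) + 2 + p
  let M : ℕ → ℕ := fun k => 2 ^ (7 ^ (k + (3 * (6 * k) + 2))) * N k + (3 * (6 * k) + 2) + 1
  choose R1 hR1 using fun k => exists_star k (M k)
  refine ⟨R0 + ∑ k ∈ Finset.range (C + 1), R1 k, ?_⟩
  intro V _ _ _ S hS hN hr
  obtain ⟨Y, ι, c, hF, hY⟩ := hR0 hS hN (by omega)
  have hle : R1 Y.card ≤ ∑ k ∈ Finset.range (C + 1), R1 k :=
    Finset.single_le_sum (f := R1) (fun _ _ => Nat.zero_le _) (by simp; omega)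
  obtain ⟨J, v, a, ε, h, hJ⟩ := hR1 Y.card hS hN hF rfl (by omega)
  have hM : 2 ^ (7 ^ (Y.card + (3 * (6 * Y.card) + 2))) * N Y.card + (3 * (6 * Y.card) + 2) <
    J.card := by rw [hJ]; exact Nat.lt_succ_self _
  obtain ⟨A, haA, hAcard, hR⟩ := exists_rigid hS hF h (Finset.card_pos.1 (by omega))
  set J1 := J.filter fun i => v i ∉ A with hJ1
  have hJ1J : J1 ⊆ J := Finset.filter_subset _ _
  have hJ1card : J.card ≤ J1.card + A.card := by
    have h1 : J1.card + (J.filter fun i => ¬ v i ∉ A).card = J.card :=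
      Finset.card_filter_add_card_filter_not _
    have h2 : (J.filter fun i => ¬ v i ∉ A).card ≤ A.card := by
      refine Finset.card_le_card_of_injOn v (fun i hi => ?_) (fun i hi j hj => ?_)
      · simpa using (Finset.mem_filter.1 hi).2
      · exact h.inj i (Finset.mem_of_mem_filter _ hi) j (Finset.mem_of_mem_filter _ hj)
    omega
  have hpow : 2 ^ (7 ^ (Y.card + A.card)) ≤ 2 ^ (7 ^ (Y.card + (3 * (6 * Y.card) + 2))) :=
    Nat.pow_le_pow_right (by norm_num) (Nat.pow_le_pow_right (by norm_num) (by omega))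
  have hmul := Nat.mul_le_mul_right (N Y.card) hpow
  obtain ⟨J2, hJ2, hJ2card, P, hP⟩ := (h.mono hJ1J).exists_same_translates hS hF hR.subset
    (fun i hi => (Finset.mem_filter.1 hi).2) (N := N Y.card)
    (by
      generalize 2 ^ (7 ^ (Y.card + A.card)) * N Y.card = q1 at *
      generalize 2 ^ (7 ^ (Y.card + (3 * (6 * Y.card) + 2))) * N Y.card = q2 at *
      omega)
  have hN' : N Y.card = 7 ^ (Y.card + 1) * 7 ^ (Y.card + 1) + 2 + p := rfl
  obtain ⟨Q, δ, hQ, hcard⟩ := (hR.mono (hJ2.trans hJ1J)).exists_cloneSystem hS hN hF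
    (h.mono (hJ2.trans hJ1J)) haA (fun i hi => (Finset.mem_filter.1 (hJ2 hi)).2) hP (by
      generalize 7 ^ (Y.card + 1) * 7 ^ (Y.card + 1) = q at *
      omega)
  refine ⟨J2, Q, δ, hQ, ?_, hcard⟩
  generalize 7 ^ (Y.card + 1) * 7 ^ (Y.card + 1) = q at *
  omega

end

section

open Module

section QuotientForm

variable {V : Type*} [AddCommGroup V] [Module ℚ V] [FiniteDimensional ℚ V]

theorem ThreeModular.exists_quotient_form {S : Finset V} (hS : ThreeModular S) (n : ℕ)
    {K : Submodule ℚ V} (hK : K ≤ Submodule.span ℚ ((S : Set V) ∩ K))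
    (hn : finrank ℚ K + n = finrank ℚ V) :
    ∃ D : V [⋀^Fin n]→ₗ[ℚ] ℚ,
      (∀ u : Fin n → V, K ⊔ Submodule.span ℚ (Set.range u) = ⊤ → D u ≠ 0) ∧
      (∀ v, (∀ i, v i ∈ S) → ∃ k : ℤ, D v = k ∧ |k| ≤ 3) ∧
      ∀ v w, (∀ i, v i - w i ∈ K) → D v = D w := by
  classical
  have hspan : Submodule.span ℚ ((S : Set V) ∩ K) = K :=
    le_antisymm (Submodule.span_le.2 Set.inter_subset_right) hK
  obtain ⟨b, hb, hbs, hbi⟩ := exists_linearIndependent ℚ ((S : Set V) ∩ K)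
  have hfin : b.Finite := hbi.setFinite
  have := hfin.fintype
  rw [hspan] at hbs
  have hcard : Fintype.card b = finrank ℚ K := by
    rw [← hbs, ← Set.toFinset_card]
    exact (finrank_span_set_eq_card hbi).symm
  have hι : Fintype.card (Fin n ⊕ b) = finrank ℚ V := by
    rw [Fintype.card_sum, Fintype.card_fin, hcard, add_comm, hn]
  obtain ⟨D, hD0, hD⟩ := hS.exists_form hι
  refine ⟨D.fixRight (fun t : b => (t : V)), ?_, ?_, ?_⟩
  · intro u hu
    rw [AlternatingMap.fixRight_apply]
    refine hD0 _ (linearIndependent_of_top_le_span_of_card_eq_finrank ?_ hι)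
    rw [Set.Sum.elim_range, Submodule.span_union, Subtype.range_coe, hbs, sup_comm, hu]
  · intro v hv
    rw [AlternatingMap.fixRight_apply]
    exact hD _ (by rintro (i | t); exacts [hv i, (hb t.2).1])
  · intro v w hvw
    rw [AlternatingMap.fixRight_apply, AlternatingMap.fixRight_apply]
    have h := D.map_add_shift (Sum.elim w (fun t : b => (t : V))) (Sum.elim (v - w) 0)
      (Set.range Sum.inr) (by rintro _ ⟨t, rfl⟩; rfl) (by
        rintro (i | t) hi
        · have e : Sum.elim w (fun t : b => (t : V)) '' Set.range Sum.inr = b := by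
            rw [← Set.range_comp]
            simp
          rw [e, hbs]
          exact hvw i
        · exact absurd ⟨t, rfl⟩ hi)
    rw [← h]
    congr 1
    ext (i | t) <;> simp

theorem ThreeModular.exists_int_of_sub_mem {S : Finset V} (hS : ThreeModular S)
    {K : Submodule ℚ V} (hK : K ≤ Submodule.span ℚ ((S : Set V) ∩ K))
    (hn : finrank ℚ K + 1 ≤ finrank ℚ V) {x u u' y z : V} {g : ℤ} {c : ℚ}
    (htop : K ⊔ Submodule.span ℚ {x} = ⊤) (hu : u ∈ S) (hu' : u' ∈ S) (hx : x = u - u')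
    (hy : y ∈ S) (hyx : y - (g : ℚ) • x ∈ K) (hg : 2 ≤ |g|) (hz : z ∈ S) (hzx : z - c • x ∈ K) :
    ∃ k : ℤ, c = k ∧ |k| ≤ 3 := by
  have h1 := Submodule.finrank_add_le_finrank_add_finrank K (Submodule.span ℚ {x})
  rw [htop, finrank_top] at h1
  have h2 : finrank ℚ (Submodule.span ℚ {x}) ≤ 1 := by
    have := finrank_span_finset_le_card (R := ℚ) ({x} : Finset V)
    rwa [Finset.coe_singleton, Finset.card_singleton] at this
  obtain ⟨D, hD0, hD, hDK⟩ := hS.exists_quotient_form 1 hK (by omega)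
  have hne : D ![x] ≠ 0 := hD0 _ (by simpa using htop)
  have hsmul : ∀ (c : ℚ) v, D ![c • v] = c * D ![v] := by
    intro c v
    have := D.map_update_smul ![v] 0 c v
    have e : ∀ a, Function.update ![v] 0 a = ![a] := by
      intro a; ext i; fin_cases i; simp
    rwa [e, e] at this
  have hmod : ∀ {v : V} {c : ℚ}, v - c • x ∈ K → D ![v] = c * D ![x] := by
    intro v c h
    rw [← hsmul]
    exact hDK _ _ (by simpa using h)
  have h_int : ∀ v ∈ S, ∃ k : ℤ, D ![v] = k ∧ |k| ≤ 3 := fun v hv => hD _ (by simpa using hv)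
  obtain ⟨a, ha, -⟩ := h_int u hu
  obtain ⟨a', ha', -⟩ := h_int u' hu'
  obtain ⟨b, hb, hb3⟩ := h_int y hy
  obtain ⟨k, hk, hk3⟩ := h_int z hz
  have hadd : D ![u] = D ![x] + D ![u'] := by
    have := D.map_update_add ![u] 0 x u'
    have e : ∀ a, Function.update ![u] 0 a = ![a] := by
      intro a; ext i; fin_cases i; simp
    rwa [e, e, e, show x + u' = u by rw [hx]; abel] at this
  have hd : D ![x] = ((a - a' : ℤ) : ℚ) := by push_cast; rw [← ha, ← ha', hadd]; ring
  rw [hmod hyx, hd] at hb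
  rw [hmod hzx, hd] at hk
  rw [hd] at hne
  generalize a - a' = d at *
  have hd0 : d ≠ 0 := by exact_mod_cast hne
  have hb' : g * d = b := by exact_mod_cast hb
  have hd1 : |d| = 1 := by
    have h3 : |g| * |d| ≤ 3 := by rw [← abs_mul, hb']; exact hb3
    have h4 : 1 ≤ |d| := Int.one_le_abs hd0
    nlinarith
  rcases (abs_eq (by norm_num)).1 hd1 with rfl | rfl
  · exact ⟨k, by simpa using hk, hk3⟩
  · refine ⟨-k, ?_, by rwa [abs_neg]⟩
    push_cast at hk ⊢
    linarith

theorem ThreeModular.eq_zero_or_of_sub_mem {S : Finset V} (hS : ThreeModular S)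
    {K : Submodule ℚ V} (hK : K ≤ Submodule.span ℚ ((S : Set V) ∩ K))
    (hn : finrank ℚ K + 2 ≤ finrank ℚ V) {x u u' y z m : V} {g : ℤ} {c e : ℚ}
    (htop : K ⊔ Submodule.span ℚ {x, m} = ⊤) (hu : u ∈ S) (hu' : u' ∈ S) (hx : x = u - u')
    (hy : y ∈ S) (hyx : y - (g : ℚ) • x ∈ K) (hg : 2 ≤ |g|) (hm : m ∈ S) (hz : z ∈ S)
    (hzx : z - (c • m + e • x) ∈ K) : ∃ k : ℤ, c = k ∧ |k| ≤ 1 := by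
  classical
  have h1 := Submodule.finrank_add_le_finrank_add_finrank K (Submodule.span ℚ {x, m})
  rw [htop, finrank_top] at h1
  have h2 : finrank ℚ (Submodule.span ℚ {x, m}) ≤ 2 := by
    have := (finrank_span_finset_le_card (R := ℚ) ({x, m} : Finset V))
    rw [Finset.coe_insert, Finset.coe_singleton] at this
    exact this.trans Finset.card_le_two
  obtain ⟨D, hD0, hD, hDK⟩ := hS.exists_quotient_form 2 hK (by omega)
  have hne : D ![x, m] ≠ 0 := hD0 _ (by rwa [Matrix.range_cons_cons_empty])
  have h_int : ∀ v ∈ S, ∀ w ∈ S, ∃ k : ℤ, D ![v, w] = k ∧ |k| ≤ 3 := fun v hv w hw =>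
    hD _ (by intro i; fin_cases i <;> assumption)
  have hsmulL : ∀ (c : ℚ) v w, D ![c • v, w] = c * D ![v, w] := by
    intro c v w
    have := D.map_update_smul ![v, w] 0 c v
    have e : ∀ a, Function.update ![v, w] 0 a = ![a, w] := by
      intro a; ext i; fin_cases i <;> simp
    simpa only [e, smul_eq_mul] using this
  have hsmulR : ∀ (c : ℚ) v w, D ![v, c • w] = c * D ![v, w] := by
    intro c v w
    have := D.map_update_smul ![v, w] 1 c w
    have e : ∀ a, Function.update ![v, w] 1 a = ![v, a] := by
      intro a; ext i; fin_cases i <;> simp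
    simpa [e] using this
  have haddR : ∀ v w w', D ![v, w + w'] = D ![v, w] + D ![v, w'] := by
    intro v w w'
    have := D.map_update_add ![v, w] 1 w w'
    have e : ∀ a, Function.update ![v, w] 1 a = ![v, a] := by
      intro a; ext i; fin_cases i <;> simp
    simpa [e] using this
  have haddL : ∀ v v' w, D ![v + v', w] = D ![v, w] + D ![v', w] := by
    intro v v' w
    have := D.map_update_add ![v, w] 0 v v'
    have e : ∀ a, Function.update ![v, w] 0 a = ![a, w] := by
      intro a; ext i; fin_cases i <;> simp
    simpa only [e] using this
  have hself : ∀ v, D ![v, v] = 0 := fun v =>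
    D.map_eq_zero_of_eq ![v, v] (i := 0) (j := 1) rfl (by decide)
  have hz' : D ![x, z] = c * D ![x, m] := by
    rw [hDK ![x, z] ![x, c • m + e • x] (by intro i; fin_cases i <;> simp [hzx]), haddR,
      hsmulR, hsmulR, hself]
    ring
  have hy' : ∀ w, D ![y, w] = g * D ![x, w] := by
    intro w
    rw [← hsmulL]
    exact hDK _ _ (by intro i; fin_cases i <;> simp [hyx])
  have hux : ∀ w, D ![x, w] = D ![u, w] - D ![u', w] := by
    intro w
    rw [show u = x + u' by rw [hx]; abel, haddL]
    ring
  have hintx : ∀ w ∈ S, ∃ k : ℤ, D ![x, w] = k := by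
    intro w hw
    obtain ⟨a, ha, -⟩ := h_int u hu w hw
    obtain ⟨a', ha', -⟩ := h_int u' hu' w hw
    exact ⟨a - a', by rw [hux, ha, ha']; push_cast; ring⟩
  obtain ⟨d, hd⟩ := hintx m hm
  obtain ⟨f, hf⟩ := hintx z hz
  have small : ∀ w ∈ S, ∀ k : ℤ, D ![x, w] = k → |k| ≤ 1 := by
    intro w hw k hk
    obtain ⟨b, hb, hb3⟩ := h_int y hy w hw
    rw [hy', hk] at hb
    have hb' : g * k = b := by exact_mod_cast hb
    have h3 : |g| * |k| ≤ 3 := by rw [← abs_mul, hb']; exact hb3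
    have := abs_nonneg k
    by_contra hcon
    push Not at hcon
    nlinarith
  have hd1 := small m hm d hd
  have hf1 := small z hz f hf
  rw [hd] at hne hz'
  have hd0 : d ≠ 0 := by exact_mod_cast hne
  have hd1' : |d| = 1 := le_antisymm hd1 (Int.one_le_abs hd0)
  rw [hf] at hz'
  rcases (abs_eq (by norm_num)).1 hd1' with rfl | rfl
  · exact ⟨f, by simpa using hz'.symm, hf1⟩
  · refine ⟨-f, ?_, by rwa [abs_neg]⟩
    push_cast at hz' ⊢
    linarith

end QuotientForm

section UnitSums

variable {ι : Type*} [Fintype ι] [DecidableEq ι]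

/-- An integer weight of total `0` whose sum is in `{-1, 0, 1}` on every set separating two pairs
of elements of a fixed set of size at least `6` is zero or a difference of two unit weights. -/
theorem eq_zero_or_single_sub_single {I : Finset ι} (hI : 6 ≤ I.card) (F : ι → ℚ)
    (hF : ∑ a, F a = 0)
    (h : ∀ s : Finset ι, 2 ≤ (s ∩ I).card → 2 ≤ (I \ s).card →
      ∃ k : ℤ, ∑ a ∈ s, F a = k ∧ |k| ≤ 1) :
    F = 0 ∨ ∃ a b, a ≠ b ∧ F = Pi.single a 1 - Pi.single b 1 := by
  have sep : ∀ s t : Finset ι, s ∩ I ⊆ t → t ⊆ s → 2 ≤ t.card → t ⊆ I → t.card + 2 ≤ I.card →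
      ∃ k : ℤ, ∑ a ∈ s, F a = k ∧ |k| ≤ 1 := by
    intro s t hst hts ht htI hcard
    have e : s ∩ I = t := subset_antisymm hst (Finset.subset_inter hts htI)
    refine h s (by rw [e]; exact ht) ?_
    have h1 := Finset.card_sdiff_add_card_inter I s
    rw [Finset.inter_comm, e] at h1
    omega
  have h_int : ∀ v, ∃ k : ℤ, F v = k := by
    intro v
    obtain ⟨t, ht, htc⟩ := Finset.exists_subset_card_eq (s := I.erase v) (n := 2)
      (by have := Finset.pred_card_le_card_erase (s := I) (a := v); omega)
    have hvt : v ∉ t := fun hv => by simpa using ht hv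
    have htI : t ⊆ I := ht.trans (Finset.erase_subset _ _)
    obtain ⟨k, hk, -⟩ := h t (by rw [Finset.inter_eq_left.2 htI]; omega)
      (by rw [Finset.card_sdiff_of_subset htI]; omega)
    obtain ⟨l, hl, -⟩ := h (insert v t)
      (by
        refine htc.symm.le.trans (Finset.card_le_card ?_)
        exact Finset.subset_inter (Finset.subset_insert _ _) htI)
      (by
        have h1 := Finset.le_card_sdiff (insert v t) I
        rw [Finset.card_insert_of_notMem hvt] at h1
        omega)
    refine ⟨l - k, ?_⟩
    rw [Finset.sum_insert hvt, hk] at hl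
    push_cast
    linarith
  choose f hf using h_int
  have hfsum : ∀ s : Finset ι, ∑ a ∈ s, F a = ((∑ a ∈ s, f a : ℤ) : ℚ) := by
    intro s; push_cast; exact Finset.sum_congr rfl fun a _ => hf a
  have h' : ∀ s : Finset ι, 2 ≤ (s ∩ I).card → 2 ≤ (I \ s).card → |∑ a ∈ s, f a| ≤ 1 := by
    intro s h1 h2
    obtain ⟨k, hk, hk1⟩ := h s h1 h2
    rw [hfsum] at hk
    have : ∑ a ∈ s, f a = k := by exact_mod_cast hk
    rw [this]; exact hk1
  have hf0 : ∑ a, f a = 0 := by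
    have := hfsum Finset.univ
    rw [hF] at this
    exact_mod_cast this.symm
  have hpair : ∀ t : Finset ι, t ⊆ I → t.card = 2 → |∑ a ∈ t, f a| ≤ 1 := by
    intro t htI htc
    exact h' t (by rw [Finset.inter_eq_left.2 htI]; omega)
      (by rw [Finset.card_sdiff_of_subset htI]; omega)
  have hpos : (I.filter fun a => 0 < f a).card ≤ 1 := by
    by_contra hcon
    obtain ⟨t, ht, htc⟩ := Finset.exists_subset_card_eq (s := I.filter fun a => 0 < f a) (n := 2)
      (by omega)
    have h1 := hpair t (ht.trans (Finset.filter_subset _ _)) htc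
    have h2 : t.card • (1 : ℤ) ≤ ∑ a ∈ t, f a :=
      Finset.card_nsmul_le_sum _ _ _ fun a ha => (Finset.mem_filter.1 (ht ha)).2
    rw [htc] at h2
    simp only [nsmul_eq_mul, mul_one] at h2
    have := (_root_.abs_le.1 h1).2
    push_cast at h2
    omega
  have hneg : (I.filter fun a => f a < 0).card ≤ 1 := by
    by_contra hcon
    obtain ⟨t, ht, htc⟩ := Finset.exists_subset_card_eq (s := I.filter fun a => f a < 0) (n := 2)
      (by omega)
    have h1 := hpair t (ht.trans (Finset.filter_subset _ _)) htc
    have h2 : ∑ a ∈ t, f a ≤ t.card • (-1 : ℤ) :=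
      Finset.sum_le_card_nsmul _ _ _ fun a ha => by
        have := (Finset.mem_filter.1 (ht ha)).2
        omega
    rw [htc] at h2
    have := (_root_.abs_le.1 h1).1
    norm_num at h2
    omega
  have hzero : 4 ≤ (I.filter fun a => f a = 0).card := by
    have : I ⊆ (I.filter fun a => f a = 0) ∪ ((I.filter fun a => 0 < f a) ∪
        (I.filter fun a => f a < 0)) := by
      intro a ha
      simp only [Finset.mem_union, Finset.mem_filter, ha, true_and]
      omega
    have h1 := Finset.card_le_card this
    have h2 := Finset.card_union_le (I.filter fun a => f a = 0) ((I.filter fun a => 0 < f a) ∪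
        (I.filter fun a => f a < 0))
    have h3 := Finset.card_union_le (I.filter fun a => 0 < f a) (I.filter fun a => f a < 0)
    omega
  obtain ⟨Z, hZ, hZc⟩ := Finset.exists_subset_card_eq hzero
  obtain ⟨Z1, hZ1, hZ1c⟩ := Finset.exists_subset_card_eq (s := Z) (n := 2) (by omega)
  have hZ0 : ∀ a ∈ Z, a ∈ I ∧ f a = 0 := fun a ha => Finset.mem_filter.1 (hZ ha)
  have key : ∀ P : Finset ι, (∀ a ∈ P, f a ≠ 0) → |∑ a ∈ P, f a| ≤ 1 := by
    intro P hP
    have hd : Disjoint P Z1 := Finset.disjoint_left.2 fun a ha hz => hP a ha (hZ0 a (hZ1 hz)).2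
    have h1 := h' (P ∪ Z1)
      (by
        rw [← hZ1c]
        exact Finset.card_le_card (Finset.subset_inter Finset.subset_union_right
          fun a ha => (hZ0 a (hZ1 ha)).1))
      (by
        have h2 : (Z \ Z1).card = 2 := by rw [Finset.card_sdiff_of_subset hZ1]; omega
        rw [← h2]
        refine Finset.card_le_card fun a ha => ?_
        obtain ⟨ha, ha1⟩ := Finset.mem_sdiff.1 ha
        refine Finset.mem_sdiff.2 ⟨(hZ0 a ha).1, fun h3 => ?_⟩
        rcases Finset.mem_union.1 h3 with h3 | h3
        · exact hP a h3 (hZ0 a ha).2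
        · exact ha1 h3)
    rwa [Finset.sum_union hd, Finset.sum_eq_zero fun a ha => (hZ0 a (hZ1 ha)).2, add_zero] at h1
  by_cases hall : ∀ a, f a = 0
  · left
    ext a
    simp [hf, hall]
  · right
    push Not at hall
    have ex : ∀ (ε : ℤ), ε = 1 ∨ ε = -1 → ∃ a, 0 < ε * f a := by
      intro ε hε
      by_contra hcon
      push Not at hcon
      have h0 : ∑ a, ε * f a = 0 := by rw [← Finset.mul_sum, hf0, mul_zero]
      have := (Finset.sum_eq_zero_iff_of_nonpos fun a _ => hcon a).1 h0
      obtain ⟨a, ha⟩ := hall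
      have h1 := this a (Finset.mem_univ a)
      rcases hε with rfl | rfl <;> simp at h1 <;> exact ha h1
    have uniq : ∀ (ε : ℤ), ε = 1 ∨ ε = -1 → ∀ a, 0 < ε * f a → ε * f a = 1 ∧
        ∀ b, 0 < ε * f b → b = a := by
      intro ε hε a ha
      have habs : ∀ k : ℤ, |ε * k| = |k| := by rcases hε with rfl | rfl <;> simp
      constructor
      · have := key {a} (by
          intro b hb; rw [Finset.mem_singleton.1 hb]; rintro h0; simp [h0] at ha)
        rw [Finset.sum_singleton, ← habs, abs_of_pos ha] at this
        omega
      · intro b hb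
        by_contra hne
        have := key {b, a} (by
          intro d hd
          simp only [Finset.mem_insert, Finset.mem_singleton] at hd
          rcases hd with rfl | rfl <;> (intro h0; simp [h0] at ha hb))
        rw [Finset.sum_pair hne, ← habs, mul_add] at this
        have := (_root_.abs_le.1 this).2
        omega
    obtain ⟨a, ha⟩ := ex 1 (.inl rfl)
    obtain ⟨b, hb⟩ := ex (-1) (.inr rfl)
    obtain ⟨ha1, hau⟩ := uniq 1 (.inl rfl) a ha
    obtain ⟨hb1, hbu⟩ := uniq (-1) (.inr rfl) b hb
    have hab : a ≠ b := by rintro rfl; omega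
    refine ⟨a, b, hab, ?_⟩
    ext d
    simp only [Pi.sub_apply, hf]
    by_cases hda : d = a
    · subst hda
      rw [Pi.single_eq_same, Pi.single_eq_of_ne hab]
      have : f d = 1 := by omega
      simp [this]
    · by_cases hdb : d = b
      · subst hdb
        rw [Pi.single_eq_same, Pi.single_eq_of_ne hda]
        have : f d = -1 := by omega
        simp [this]
      · rw [Pi.single_eq_of_ne hda, Pi.single_eq_of_ne hdb]
        have h1 : ¬ 0 < 1 * f d := fun h1 => hda (hau d h1)
        have h2 : ¬ 0 < -1 * f d := fun h2 => hdb (hbu d h2)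
        have : f d = 0 := by omega
        simp [this]

end UnitSums

end

section

open Module

section ChainSystems

variable {V : Type*} [AddCommGroup V] [Module ℚ V] {ι : Type*} [Fintype ι]

/-- Vectors `ν a`, one for each `a : ι`, generating `V` by their differences together with `x`, such
that `ν i - ν a + k • x ∈ S` whenever `i ∈ I` and `k ≤ α a`, where the weights `α` vanish on `I` and
have total `3`. -/
structure ChainSystem (S : Finset V) (I : Finset ι) (ν : ι → V) (α : ι → ℕ) (x : V) : Prop where
  card_eq : Fintype.card ι = finrank ℚ V
  weight_eq_zero : ∀ i ∈ I, α i = 0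
  sum_weight : ∑ a, α a = 3
  mem : ∀ i ∈ I, ∀ a, a ≠ i → ∀ k : ℕ, k ≤ α a → ν i - ν a + (k : ℚ) • x ∈ S
  exists_eq : ∀ z, ∃ (F : ι → ℚ) (γ : ℚ), ∑ a, F a = 0 ∧ z = ∑ a, F a • ν a + γ • x

variable {S : Finset V} {I : Finset ι} {ν : ι → V} {α : ι → ℕ} {x : V}

theorem ChainSystem.exists_sub_eq (h : ChainSystem S I ν α x) (hI : I.Nonempty) :
    ∃ u ∈ S, ∃ u' ∈ S, x = u - u' := by
  obtain ⟨i, hi⟩ := hI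
  obtain ⟨a, -, ha⟩ : ∃ a ∈ Finset.univ, α a ≠ 0 := by
    refine Finset.exists_ne_zero_of_sum_ne_zero ?_
    rw [h.sum_weight]
    norm_num
  have hai : a ≠ i := by rintro rfl; exact ha (h.weight_eq_zero _ hi)
  refine ⟨_, h.mem i hi a hai 1 (by omega), _, h.mem i hi a hai 0 (Nat.zero_le _), ?_⟩
  push_cast
  module

theorem sum_smul_gauge (F θ : ι → ℚ) (γ : ℚ) (ν : ι → V) (x : V) :
    ∑ a, F a • ν a + γ • x =
      ∑ a, F a • (ν a + θ a • x) + (γ - ∑ a, F a * θ a) • x := by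
  simp only [smul_add, Finset.sum_add_distrib, smul_smul, ← Finset.sum_smul]
  module

variable [FiniteDimensional ℚ V]

/-- Weights along a spanning tree, given through its potential `θ`. -/
theorem ChainSystem.exists_int_of_potential (hS : ThreeModular S) (h : ChainSystem S I ν α x)
    (hI : I.Nonempty) (θ : ι → ℤ) (i : ι) {X : Set V} (hX : X ⊆ S)
    (hXK : ∀ v ∈ X, ∃ a b, v = (ν a + (θ a : ℚ) • x) - (ν b + (θ b : ℚ) • x))
    (hθ : ∀ a, (ν i + (θ i : ℚ) • x) - (ν a + (θ a : ℚ) • x) ∈ Submodule.span ℚ X)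
    {y : V} (hy : y ∈ S) {a b : ι} {g : ℤ} (hg : 2 ≤ |g|)
    (hyx : y = (ν a + (θ a : ℚ) • x) - (ν b + (θ b : ℚ) • x) + (g : ℚ) • x)
    {F : ι → ℚ} {γ : ℚ} (hF : ∑ a, F a = 0) (hz : ∑ a, F a • ν a + γ • x ∈ S) :
    ∃ k : ℤ, γ - ∑ a, F a * θ a = k ∧ |k| ≤ 3 := by
  classical
  set μ : ι → V := fun a => ν a + (θ a : ℚ) • x with hμ
  set K := Submodule.span ℚ (Set.range fun a => μ i - μ a) with hKdef
  have hgen : ∀ a, μ i - μ a ∈ K := fun a => Submodule.subset_span ⟨a, rfl⟩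
  have hdiff : ∀ a b, μ a - μ b ∈ K := fun a b => by
    have := Submodule.sub_mem _ (hgen b) (hgen a)
    rwa [sub_sub_sub_cancel_left] at this
  have hK : K ≤ Submodule.span ℚ ((S : Set V) ∩ K) := by
    rw [hKdef, Submodule.span_le]
    rintro _ ⟨a, rfl⟩
    refine Submodule.span_mono ?_ (hθ a)
    intro v hv
    obtain ⟨a, b, e⟩ := hXK v hv
    exact ⟨hX hv, by rw [e]; exact hdiff a b⟩
  have hn : finrank ℚ K + 1 ≤ finrank ℚ V := by
    have h1 : K ≤ Submodule.span ℚ (((Finset.univ.erase i).image fun a => μ i - μ a : Finset V) :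
        Set V) := by
      rw [hKdef, Submodule.span_le]
      rintro _ ⟨a, rfl⟩
      by_cases ha : a = i
      · subst ha; simp
      · exact Submodule.subset_span (Finset.mem_coe.2 (Finset.mem_image_of_mem _
          (Finset.mem_erase.2 ⟨ha, Finset.mem_univ _⟩)))
    have h2 := (Submodule.finrank_mono h1).trans (finrank_span_finset_le_card _)
    have h3 := h2.trans Finset.card_image_le
    rw [Finset.card_erase_of_mem (Finset.mem_univ _), Finset.card_univ, h.card_eq] at h3
    have := Fintype.card_pos_iff.2 ⟨i⟩
    rw [h.card_eq] at this
    omega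
  have hsumK : ∀ F : ι → ℚ, ∑ a, F a = 0 → ∑ a, F a • μ a ∈ K := by
    intro F hF
    have e : ∑ a, F a • μ a = -∑ a, F a • (μ i - μ a) := by
      simp only [smul_sub, Finset.sum_sub_distrib, ← Finset.sum_smul, hF]
      simp
    rw [e]
    exact Submodule.neg_mem _ (Submodule.sum_mem _ fun a _ => Submodule.smul_mem _ _ (hgen a))
  obtain ⟨u, hu, u', hu', hx⟩ := h.exists_sub_eq hI
  refine hS.exists_int_of_sub_mem hK hn ?_ hu hu' hx hy ?_ hg hz ?_
  · rw [eq_top_iff]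
    intro z _
    obtain ⟨F, γ, hF, rfl⟩ := h.exists_eq z
    rw [sum_smul_gauge F (fun a => (θ a : ℚ))]
    exact Submodule.add_mem_sup (hsumK F hF)
      (Submodule.smul_mem _ _ (Submodule.mem_span_singleton_self x))
  · rw [hyx, add_sub_cancel_right]
    exact hdiff a b
  · rw [sum_smul_gauge F (fun a => (θ a : ℚ)), add_sub_cancel_right]
    exact hsumK F hF

theorem ChainSystem.cut_of_potential [DecidableEq ι] (hS : ThreeModular S)
    (h : ChainSystem S I ν α x)
    (hI : I.Nonempty) (θ : ι → ℤ) {s : Finset ι} {i j : ι} (hi : i ∈ s) (hj : j ∉ s) {X : Set V}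
    (hX : X ⊆ S)
    (hXK : ∀ v ∈ X, ∃ a b, (a ∈ s ↔ b ∈ s) ∧
      v = (ν a + (θ a : ℚ) • x) - (ν b + (θ b : ℚ) • x))
    (hθi : ∀ a ∈ s, (ν i + (θ i : ℚ) • x) - (ν a + (θ a : ℚ) • x) ∈ Submodule.span ℚ X)
    (hθj : ∀ a, a ∉ s → (ν j + (θ j : ℚ) • x) - (ν a + (θ a : ℚ) • x) ∈ Submodule.span ℚ X)
    (hm : (ν i + (θ i : ℚ) • x) - (ν j + (θ j : ℚ) • x) ∈ S)
    {y : V} (hy : y ∈ S) {a b : ι} {g : ℤ} (hg : 2 ≤ |g|) (hab : a ∈ s ↔ b ∈ s)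
    (hyx : y = (ν a + (θ a : ℚ) • x) - (ν b + (θ b : ℚ) • x) + (g : ℚ) • x)
    {F : ι → ℚ} {γ : ℚ} (hF : ∑ a, F a = 0) (hz : ∑ a, F a • ν a + γ • x ∈ S) :
    ∃ k : ℤ, ∑ a ∈ s, F a = k ∧ |k| ≤ 1 := by
  classical
  set μ : ι → V := fun a => ν a + (θ a : ℚ) • x with hμ
  let c : ι → ι := fun a => if a ∈ s then i else j
  set K := Submodule.span ℚ (Set.range fun a => μ (c a) - μ a) with hKdef
  have hgen : ∀ a, μ (c a) - μ a ∈ K := fun a => Submodule.subset_span ⟨a, rfl⟩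
  have hdiff : ∀ a b, (a ∈ s ↔ b ∈ s) → μ a - μ b ∈ K := fun a b hab => by
    have := Submodule.sub_mem _ (hgen b) (hgen a)
    have e : c a = c b := by simp only [c, hab]
    rwa [e, sub_sub_sub_cancel_left] at this
  have hK : K ≤ Submodule.span ℚ ((S : Set V) ∩ K) := by
    rw [hKdef, Submodule.span_le]
    have hXle : X ⊆ (S : Set V) ∩ K := by
      intro v hv
      obtain ⟨a, b, hab, e⟩ := hXK v hv
      exact ⟨hX hv, by rw [e]; exact hdiff a b hab⟩
    rintro _ ⟨a, rfl⟩
    refine Submodule.span_mono hXle ?_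
    by_cases ha : a ∈ s
    · simpa only [c, if_pos ha] using hθi a ha
    · simpa only [c, if_neg ha] using hθj a ha
  have hij : i ≠ j := by rintro rfl; exact hj hi
  have hn : finrank ℚ K + 2 ≤ finrank ℚ V := by
    have h1 : K ≤ Submodule.span ℚ ((((Finset.univ.erase i).erase j).image
        fun a => μ (c a) - μ a : Finset V) : Set V) := by
      rw [hKdef, Submodule.span_le]
      rintro _ ⟨a, rfl⟩
      by_cases ha : a = i
      · subst ha; simp [c, hi]
      · by_cases haj : a = j
        · subst haj; simp [c, hj]
        · exact Submodule.subset_span (Finset.mem_coe.2 (Finset.mem_image_of_mem _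
            (Finset.mem_erase.2 ⟨haj, Finset.mem_erase.2 ⟨ha, Finset.mem_univ _⟩⟩)))
    have h2 := (Submodule.finrank_mono h1).trans (finrank_span_finset_le_card _)
    have h3 := h2.trans Finset.card_image_le
    have hj' : j ∈ Finset.univ.erase i := Finset.mem_erase.2 ⟨hij.symm, Finset.mem_univ _⟩
    have h4 := Finset.card_pos.2 ⟨_, hj'⟩
    rw [Finset.card_erase_of_mem hj'] at h3
    rw [Finset.card_erase_of_mem (Finset.mem_univ _), Finset.card_univ, h.card_eq] at h3 h4
    omega
  have hsumK : ∀ F : ι → ℚ, ∑ a, F a = 0 →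
      ∑ a, F a • μ a - (∑ a ∈ s, F a) • (μ i - μ j) ∈ K := by
    intro F hF
    have e1 : ∑ a, F a • μ (c a) = (∑ a ∈ s, F a) • (μ i - μ j) := by
      rw [← Finset.sum_add_sum_compl s] at hF ⊢
      have e2 : ∑ a ∈ s, F a • μ (c a) = (∑ a ∈ s, F a) • μ i := by
        rw [Finset.sum_smul]
        exact Finset.sum_congr rfl fun a ha => by simp only [c, if_pos ha]
      have e3 : ∑ a ∈ sᶜ, F a • μ (c a) = (∑ a ∈ sᶜ, F a) • μ j := by
        rw [Finset.sum_smul]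
        exact Finset.sum_congr rfl fun a ha => by
          simp only [c, if_neg (Finset.mem_compl.1 ha)]
      rw [e2, e3, eq_neg_of_add_eq_zero_right hF]
      module
    rw [← e1, ← Finset.sum_sub_distrib]
    refine Submodule.sum_mem _ fun a _ => ?_
    rw [← smul_sub, ← neg_sub, smul_neg]
    exact Submodule.neg_mem _ (Submodule.smul_mem _ _ (hgen a))
  obtain ⟨u, hu, u', hu', hx⟩ := h.exists_sub_eq hI
  refine hS.eq_zero_or_of_sub_mem hK hn (m := μ i - μ j) (e := γ - ∑ a, F a * θ a) ?_ hu hu' hx hy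
    ?_ hg hm hz ?_
  · rw [eq_top_iff]
    intro z _
    obtain ⟨F, γ, hF, rfl⟩ := h.exists_eq z
    rw [sum_smul_gauge F (fun a => (θ a : ℚ))]
    have e : ∑ a, F a • (ν a + (θ a : ℚ) • x) + (γ - ∑ a, F a * θ a) • x =
        (∑ a, F a • μ a - (∑ a ∈ s, F a) • (μ i - μ j)) +
          ((γ - ∑ a, F a * θ a) • x + (∑ a ∈ s, F a) • (μ i - μ j)) := by
      simp only [hμ]
      abel
    rw [e]
    exact Submodule.add_mem_sup (hsumK F hF) (Submodule.add_mem _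
      (Submodule.smul_mem _ _ (Submodule.subset_span (by simp)))
      (Submodule.smul_mem _ _ (Submodule.subset_span (by simp))))
  · rw [hyx, add_sub_cancel_right]
    exact hdiff a b hab
  · rw [sum_smul_gauge F (fun a => (θ a : ℚ)), add_sub_add_right_eq_sub]
    exact hsumK F hF

end ChainSystems

end

section

open Module

section ChainSystems

variable {V : Type*} [AddCommGroup V] [Module ℚ V] {ι : Type*} [Fintype ι]
variable {S : Finset V} {I : Finset ι} {ν : ι → V} {α : ι → ℕ} {x : V}

theorem ChainSystem.gauge_mem (h : ChainSystem S I ν α x) (θ : ι → ℤ) {i a : ι} (hi : i ∈ I)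
    (ha : a ≠ i) (g : ℤ) (h0 : 0 ≤ θ i - θ a + g) (h1 : θ i - θ a + g ≤ α a) :
    (ν i + (θ i : ℚ) • x) - (ν a + (θ a : ℚ) • x) + (g : ℚ) • x ∈ S := by
  have := h.mem i hi a ha (θ i - θ a + g).toNat (by omega)
  have e : (((θ i - θ a + g).toNat : ℕ) : ℚ) = θ i - θ a + g := by
    have h2 : (((θ i - θ a + g).toNat : ℕ) : ℤ) = θ i - θ a + g := Int.toNat_of_nonneg h0
    exact_mod_cast h2
  rw [e] at this
  convert this using 1
  module

theorem ChainSystem.gauge_mem_zero (h : ChainSystem S I ν α x) (θ : ι → ℤ) {i a : ι} (hi : i ∈ I)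
    (ha : a ≠ i) (h0 : 0 ≤ θ i - θ a) (h1 : θ i - θ a ≤ α a) :
    (ν i + (θ i : ℚ) • x) - (ν a + (θ a : ℚ) • x) ∈ S := by
  simpa using h.gauge_mem θ hi ha 0 (by simpa using h0) (by simpa using h1)

variable [FiniteDimensional ℚ V] [DecidableEq ι]

theorem ChainSystem.cut_of_two_le_weight (hS : ThreeModular S) (h : ChainSystem S I ν α x)
    {F : ι → ℚ} {γ : ℚ} (hF : ∑ a, F a = 0) (hz : ∑ a, F a • ν a + γ • x ∈ S) {s : Finset ι}
    (hs : 2 ≤ (s ∩ I).card) (hs' : (I \ s).Nonempty) (hα : 2 ≤ ∑ a ∈ s, α a) :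
    ∃ k : ℤ, ∑ a ∈ s, F a = k ∧ |k| ≤ 1 := by
  obtain ⟨i, hi, i', hi', hii⟩ := Finset.one_lt_card.1 hs
  obtain ⟨j, hj⟩ := hs'
  obtain ⟨his, hiI⟩ := Finset.mem_inter.1 hi
  obtain ⟨his', hiI'⟩ := Finset.mem_inter.1 hi'
  obtain ⟨hjI, hjs⟩ := Finset.mem_sdiff.1 hj
  have hij : i ≠ j := by rintro rfl; exact hjs his
  have hne : ∀ v, α v ≠ 0 → ∀ i ∈ I, v ≠ i := by
    rintro v hv i hi rfl; exact hv (h.weight_eq_zero _ hi)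
  by_cases hv : ∃ v ∈ s, 2 ≤ α v
  · obtain ⟨v, hvs, hv⟩ := hv
    have hvi := hne v (by omega) i hiI
    refine h.cut_of_potential hS ⟨i, hiI⟩ (fun _ => 0) his hjs
      (X := {v | v ∈ S ∧ ∃ a b, (a ∈ s ↔ b ∈ s) ∧
        v = (ν a + ((0 : ℤ) : ℚ) • x) - (ν b + ((0 : ℤ) : ℚ) • x)})
      (fun v hv => hv.1) (fun v hv => hv.2) ?_ ?_ ?_
      (h.gauge_mem (fun _ => 0) hiI hvi 2 (by norm_num) (by norm_num; exact_mod_cast hv))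
      (g := 2) (by norm_num) (by tauto) rfl hF hz
    · intro a ha
      by_cases hai : a = i
      · subst hai; rw [sub_self]; exact Submodule.zero_mem _
      · exact Submodule.subset_span ⟨h.gauge_mem_zero (fun _ => 0) hiI hai (by simp) (by simp),
          i, a, by tauto, rfl⟩
    · intro a ha
      by_cases haj : a = j
      · subst haj; rw [sub_self]; exact Submodule.zero_mem _
      · exact Submodule.subset_span ⟨h.gauge_mem_zero (fun _ => 0) hjI haj (by simp) (by simp),
          j, a, by tauto, rfl⟩
    · exact h.gauge_mem_zero (fun _ => 0) hiI hij.symm (by simp) (by simp)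
  · push Not at hv
    have hcard : 2 ≤ (s.filter fun a => α a ≠ 0).card := by
      refine hα.trans ?_
      rw [← Finset.sum_filter_ne_zero, Finset.card_eq_sum_ones]
      exact Finset.sum_le_sum fun a ha => by
        have := hv a (Finset.mem_filter.1 ha).1
        omega
    obtain ⟨v, hv1, w, hw1, hvw⟩ := Finset.one_lt_card.1 hcard
    obtain ⟨hvs, hv0⟩ := Finset.mem_filter.1 hv1
    obtain ⟨hws, hw0⟩ := Finset.mem_filter.1 hw1
    let θ : ι → ℤ := fun a => if a = w ∨ a = i' then -1 else 0
    have hθ : ∀ a, a ≠ w → a ≠ i' → θ a = 0 := fun a h1 h2 => if_neg (by tauto)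
    have hθw : θ w = -1 := if_pos (.inl rfl)
    have hθi' : θ i' = -1 := if_pos (.inr rfl)
    have hθi : θ i = 0 := hθ i (hne w hw0 i hiI).symm hii
    have hθj : θ j = 0 := hθ j (hne w hw0 j hjI).symm (by rintro rfl; exact hjs his')
    have hθv : θ v = 0 := hθ v hvw (hne v hv0 i' hiI')
    have hα1 : ∀ a, α a ≠ 0 → (1 : ℤ) ≤ α a := fun a ha => by omega
    refine h.cut_of_potential hS ⟨i, hiI⟩ θ his hjs
      (X := {v | v ∈ S ∧ ∃ a b, (a ∈ s ↔ b ∈ s) ∧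
        v = (ν a + (θ a : ℚ) • x) - (ν b + (θ b : ℚ) • x)})
      (fun v hv => hv.1) (fun v hv => hv.2) ?_ ?_ ?_
      (h.gauge_mem θ hiI' (hne v hv0 i' hiI') 2 (by omega) (by have := hα1 v hv0; omega))
      (g := 2) (by norm_num) (by tauto) rfl hF hz
    · have hgen : ∀ a ∈ s, a ≠ i → a ≠ i' → (ν i + (θ i : ℚ) • x) - (ν a + (θ a : ℚ) • x) ∈
          Submodule.span ℚ {v | v ∈ S ∧ ∃ a b, (a ∈ s ↔ b ∈ s) ∧
            v = (ν a + (θ a : ℚ) • x) - (ν b + (θ b : ℚ) • x)} := by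
        intro a ha hai hai'
        refine Submodule.subset_span ⟨?_, i, a, by tauto, rfl⟩
        by_cases haw : a = w
        · subst haw
          exact h.gauge_mem_zero θ hiI hai (by omega) (by have := hα1 a hw0; omega)
        · have := hθ a haw hai'
          exact h.gauge_mem_zero θ hiI hai (by omega) (by omega)
      intro a ha
      by_cases hai : a = i
      · subst hai; rw [sub_self]; exact Submodule.zero_mem _
      by_cases hai' : a = i'
      · subst hai'
        have h1 := hgen w hws (hne w hw0 i hiI) (hne w hw0 a hiI')
        have h2 := Submodule.subset_span (R := ℚ)
          (s := {v | v ∈ S ∧ ∃ a b, (a ∈ s ↔ b ∈ s) ∧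
            v = (ν a + (θ a : ℚ) • x) - (ν b + (θ b : ℚ) • x)})
          ⟨h.gauge_mem_zero θ hiI' (hne w hw0 a hiI') (by omega) (by omega), a, w, by tauto, rfl⟩
        have h3 := Submodule.sub_mem _ h1 h2
        rwa [sub_sub_sub_cancel_right] at h3
      · exact hgen a ha hai hai'
    · intro a ha
      by_cases haj : a = j
      · subst haj; rw [sub_self]; exact Submodule.zero_mem _
      · have : θ a = 0 := hθ a (by rintro rfl; exact ha hws) (by rintro rfl; exact ha his')
        exact Submodule.subset_span ⟨h.gauge_mem_zero θ hjI haj (by omega) (by omega),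
          j, a, by tauto, rfl⟩
    · exact h.gauge_mem_zero θ hiI hij.symm (by omega) (by omega)

theorem ChainSystem.eq_zero_or_single (hS : ThreeModular S) (h : ChainSystem S I ν α x)
    (hI : 6 ≤ I.card) {F : ι → ℚ} {γ : ℚ} (hF : ∑ a, F a = 0)
    (hz : ∑ a, F a • ν a + γ • x ∈ S) :
    F = 0 ∨ ∃ a b, a ≠ b ∧ F = Pi.single a 1 - Pi.single b 1 := by
  refine eq_zero_or_single_sub_single hI F hF fun s hs hs' => ?_
  have hsum := Finset.sum_add_sum_compl s α
  rw [h.sum_weight] at hsum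
  by_cases hα : 2 ≤ ∑ a ∈ s, α a
  · exact h.cut_of_two_le_weight hS hF hz hs (Finset.card_pos.1 (by omega)) hα
  · have hs1 : sᶜ ∩ I = I \ s := by ext a; simp [and_comm]
    have hs2 : I \ sᶜ = s ∩ I := by ext a; simp [and_comm]
    obtain ⟨k, hk, hk1⟩ := h.cut_of_two_le_weight hS hF hz (s := sᶜ) (by rw [hs1]; exact hs')
      (by rw [hs2]; exact Finset.card_pos.1 (by omega)) (by omega)
    refine ⟨-k, ?_, by rwa [abs_neg]⟩
    have := Finset.sum_add_sum_compl s F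
    rw [hF, hk] at this
    push_cast
    linarith

/-- Vertices can be placed at consecutive heights so that the intervals `[θ a, θ a + α a]` tile
an interval. -/
theorem exists_tiling {ι : Type*} [DecidableEq ι] (α : ι → ℕ) (W : Finset ι) : ∃ θ : ι → ℤ,
    (∀ a ∈ W, 0 ≤ θ a ∧ θ a + α a ≤ ∑ b ∈ W, α b) ∧
    ∀ l : ℕ, l < ∑ b ∈ W, α b → ∃ a ∈ W, θ a ≤ l ∧ l + 1 ≤ θ a + α a := by
  induction W using Finset.induction_on with
  | empty => exact ⟨0, by simp, by simp⟩
  | insert w W hw ih =>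
    obtain ⟨θ, h1, h2⟩ := ih
    refine ⟨Function.update θ w (∑ b ∈ W, α b : ℕ), ?_, ?_⟩
    · intro a ha
      rw [Finset.sum_insert hw]
      rcases Finset.mem_insert.1 ha with rfl | haW
      · rw [Function.update_self]
        push_cast
        exact ⟨by positivity, by linarith⟩
      · rw [Function.update_of_ne (by rintro rfl; exact hw haW)]
        have := h1 a haW
        push_cast at this ⊢
        exact ⟨this.1, by linarith [this.2, Int.natCast_nonneg (α w)]⟩
    · intro l hl
      rw [Finset.sum_insert hw] at hl
      by_cases hl' : l < ∑ b ∈ W, α b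
      · obtain ⟨a, ha, h3⟩ := h2 l hl'
        refine ⟨a, Finset.mem_insert_of_mem ha, ?_⟩
        rwa [Function.update_of_ne (by rintro rfl; exact hw ha)]
      · refine ⟨w, Finset.mem_insert_self _ _, ?_⟩
        rw [Function.update_self]
        omega

end ChainSystems

end

section

open Module

section ChainSystems

variable {V : Type*} [AddCommGroup V] [Module ℚ V] [FiniteDimensional ℚ V] {ι : Type*} [Fintype ι]
variable {S : Finset V} {I : Finset ι} {ν : ι → V} {α : ι → ℕ} {x : V}

theorem ChainSystem.exists_int_le (hS : ThreeModular S) (h : ChainSystem S I ν α x)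
    (hI : 6 ≤ I.card) {a b : ι} (hab : a ≠ b) {γ : ℚ} (hz : ν a - ν b + γ • x ∈ S) :
    ∃ k : ℤ, γ = k ∧ k ≤ α b := by
  classical
  obtain ⟨C, hC, hCc⟩ := Finset.exists_subset_card_eq (s := (I.erase a).erase b) (n := 4) (by
    have h1 := Finset.pred_card_le_card_erase (s := I) (a := a)
    have h2 := Finset.pred_card_le_card_erase (s := I.erase a) (a := b)
    omega)
  have hCI : ∀ v ∈ C, v ∈ I ∧ v ≠ a ∧ v ≠ b := by
    intro v hv
    have := hC hv
    simp only [Finset.mem_erase] at this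
    tauto
  have haC : a ∉ C := fun h => (hCI a h).2.1 rfl
  have hbC : b ∉ C := fun h => (hCI b h).2.2 rfl
  let e := C.equivFinOfCardEq hCc
  let c : Fin 4 → ι := fun l => e.symm l
  have hcC : ∀ l, c l ∈ C := fun l => (e.symm l).2
  have hcinj : Function.Injective c := fun l m hlm => e.symm.injective (Subtype.ext hlm)
  obtain ⟨θ₀, hθ₀, htile⟩ := exists_tiling α (insert a (insert b C))ᶜ
  set s := ∑ v ∈ (insert a (insert b C))ᶜ, α v with hs
  have hsum : α a + α b + s = 3 := by
    have h1 := Finset.sum_add_sum_compl (insert a (insert b C)) α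
    rw [h.sum_weight, Finset.sum_insert (by simp [hab, haC]), Finset.sum_insert hbC,
      Finset.sum_eq_zero fun v hv => h.weight_eq_zero v (hCI v hv).1] at h1
    omega
  let lev : ι → ℕ := fun v => if hv : v ∈ C then e ⟨v, hv⟩ else 0
  have hlev : ∀ l, lev (c l) = l := by
    intro l
    simp only [lev, hcC l, dif_pos]
    simp [c]
  let θ : ι → ℤ := fun v => if v = a then -α a else if v = b then s else
    if v ∈ C then ((min (lev v) s : ℕ) : ℤ) else θ₀ v
  have hθa : θ a = -α a := if_pos rfl
  have hθb : θ b = s := by simp [θ, hab.symm]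
  have hθc : ∀ l, θ (c l) = ((min (l : ℕ) s : ℕ) : ℤ) := by
    intro l
    have := hCI _ (hcC l)
    simp only [θ, if_neg this.2.1, if_neg this.2.2, if_pos (hcC l), hlev]
  have hθw : ∀ v, v ≠ a → v ≠ b → v ∉ C → θ v = θ₀ v := by
    intro v h1 h2 h3
    simp only [θ, if_neg h1, if_neg h2, if_neg h3]
  have hmemW : ∀ v, v ∈ (insert a (insert b C))ᶜ ↔ v ≠ a ∧ v ≠ b ∧ v ∉ C := by
    intro v; simp
  let μ : ι → V := fun v => ν v + (θ v : ℚ) • x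
  let X : Set V := {v | v ∈ S ∧ ∃ a b, v = μ a - μ b}
  have edge : ∀ i ∈ I, ∀ v, v ≠ i → 0 ≤ θ i - θ v → θ i - θ v ≤ α v →
      μ i - μ v ∈ Submodule.span ℚ X := fun i hi v hv h0 h1 =>
    Submodule.subset_span ⟨h.gauge_mem_zero θ hi hv h0 h1, i, v, rfl⟩
  let R : ι → Prop := fun v => μ (c 0) - μ v ∈ Submodule.span ℚ X
  have right : ∀ i ∈ I, ∀ v, v ≠ i → 0 ≤ θ i - θ v → θ i - θ v ≤ α v → R i → R v := by
    intro i hi v hv h0 h1 hR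
    have := Submodule.add_mem _ hR (edge i hi v hv h0 h1)
    rwa [sub_add_sub_cancel] at this
  have left : ∀ i ∈ I, ∀ v, v ≠ i → 0 ≤ θ i - θ v → θ i - θ v ≤ α v → R v → R i := by
    intro i hi v hv h0 h1 hR
    have := Submodule.sub_mem _ hR (edge i hi v hv h0 h1)
    rwa [sub_sub_sub_cancel_right] at this
  have hcI : ∀ l, c l ∈ I := fun l => (hCI _ (hcC l)).1
  have hRc : ∀ l (hl : l < 4), R (c ⟨l, hl⟩) := by
    intro l
    induction l with
    | zero =>
      intro _
      change μ (c 0) - μ (c 0) ∈ _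
      rw [sub_self]
      exact Submodule.zero_mem _
    | succ l ih =>
      intro hl
      have hR := ih (by omega)
      have h1 := hθc ⟨l, by omega⟩
      have h2 := hθc ⟨l + 1, hl⟩
      simp only at h1 h2
      by_cases hls : l < s
      · obtain ⟨w, hw, h3, h4⟩ := htile l hls
        obtain ⟨hwa, hwb, hwC⟩ := (hmemW w).1 hw
        have h5 := hθw w hwa hwb hwC
        refine left _ (hcI _) w (fun e => hwC (e ▸ hcC _)) (by omega) (by omega)
          (right _ (hcI _) w (fun e => hwC (e ▸ hcC _)) (by omega) (by omega) hR)
      · refine right _ (hcI _) _ (fun e => ?_) (by omega) (by omega) hR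
        have := hcinj e
        simp at this
  have hR : ∀ v, R v := by
    intro v
    by_cases hva : v = a
    · subst hva
      have h1 := hθc 0
      simp only [Fin.val_zero] at h1
      exact right _ (hcI 0) _ (fun e => haC (e ▸ hcC 0)) (by omega) (by omega) (hRc 0 (by norm_num))
    by_cases hvb : v = b
    · subst hvb
      have h1 := hθc ⟨3, by norm_num⟩
      simp only at h1
      exact right _ (hcI _) _ (fun e => hbC (e ▸ hcC _)) (by omega) (by omega)
        (hRc 3 (by norm_num))
    by_cases hvC : v ∈ C
    · have h1 : c (e ⟨v, hvC⟩) = v := by simp [c]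
      rw [← h1]
      exact hRc _ (e ⟨v, hvC⟩).2
    · have h1 := hθw v hva hvb hvC
      obtain ⟨h2, h3⟩ := hθ₀ v ((hmemW v).2 ⟨hva, hvb, hvC⟩)
      have hlt : (θ v).toNat < 4 := by omega
      have h4 := hθc ⟨(θ v).toNat, hlt⟩
      simp only at h4
      exact right _ (hcI _) _ (fun e => hvC (e ▸ hcC _)) (by omega) (by omega) (hRc _ hlt)
  have hF : ∑ v, (Pi.single a 1 - Pi.single b 1 : ι → ℚ) v = 0 := by simp
  have hFν : ∑ v, (Pi.single a 1 - Pi.single b 1 : ι → ℚ) v • ν v = ν a - ν b := by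
    simp only [Pi.sub_apply, sub_smul, Finset.sum_sub_distrib, Pi.single_apply, ite_smul, one_smul,
      zero_smul, Finset.sum_ite_eq', Finset.mem_univ, if_true]
  have hFθ : ∑ v, (Pi.single a 1 - Pi.single b 1 : ι → ℚ) v * θ v = θ a - θ b := by
    simp only [Pi.sub_apply, sub_mul, Finset.sum_sub_distrib, Pi.single_apply, ite_mul, one_mul,
      zero_mul, Finset.sum_ite_eq', Finset.mem_univ, if_true]
  rw [← hFν] at hz
  have hIne : I.Nonempty := ⟨_, hcI 0⟩
  obtain ⟨k, hk, hk3⟩ : ∃ k : ℤ, γ - ∑ v, (Pi.single a 1 - Pi.single b 1 : ι → ℚ) v * θ v = k ∧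
      |k| ≤ 3 := by
    by_cases hcase : 2 ≤ s + α b
    · have h1 := hθc 0
      simp only [Fin.val_zero] at h1
      exact h.exists_int_of_potential hS hIne θ (c 0) (X := X) (fun v hv => hv.1)
        (fun v hv => hv.2) hR
        (h.gauge_mem θ (hcI 0) (a := b) (fun e => hbC (e ▸ hcC 0)) (s + α b) (by omega) (by omega))
        (by rw [_root_.abs_of_nonneg (by omega)]; omega) rfl hF hz
    · have h1 := hθc 3
      have h2 : ((3 : Fin 4) : ℕ) = 3 := rfl
      rw [h2] at h1
      exact h.exists_int_of_potential hS hIne θ (c 0) (X := X) (fun v hv => hv.1)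
        (fun v hv => hv.2) hR
        (h.gauge_mem θ (hcI 3) (a := a) (fun e => haC (e ▸ hcC 3)) (-(s + α a)) (by omega)
          (by omega))
        (by rw [abs_neg, _root_.abs_of_nonneg (by omega)]; omega) rfl hF hz
  rw [hFθ, hθa, hθb] at hk
  refine ⟨k - α a - s, ?_, ?_⟩
  · push_cast at hk ⊢
    linarith
  · have := (_root_.abs_le.1 hk3).2
    omega

theorem ChainSystem.card_le (hS : ThreeModular S) (h : ChainSystem S I ν α x) (hI : 6 ≤ I.card) :
    S.card ≤ finrank ℚ V * (finrank ℚ V + 1) + 4 * (finrank ℚ V - 1) := by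
  classical
  set L := S.filter fun v => ∃ γ : ℚ, v = γ • x with hL
  let W : ι × ι → Finset V := fun p =>
    (Finset.Icc (-(α p.1 : ℤ)) (α p.2)).image fun g : ℤ => ν p.1 - ν p.2 + (g : ℚ) • x
  have hsub : S ⊆ L ∪ (Finset.univ : Finset ι).offDiag.biUnion W := by
    intro z hz
    obtain ⟨F, γ, hF, rfl⟩ := h.exists_eq z
    rcases h.eq_zero_or_single hS hI hF hz with rfl | ⟨a, b, hab, rfl⟩
    · exact Finset.mem_union_left _ (Finset.mem_filter.2 ⟨hz, γ, by simp⟩)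
    · have hFν : ∑ v, (Pi.single a 1 - Pi.single b 1 : ι → ℚ) v • ν v = ν a - ν b := by
        simp only [Pi.sub_apply, sub_smul, Finset.sum_sub_distrib, Pi.single_apply, ite_smul,
          one_smul, zero_smul, Finset.sum_ite_eq', Finset.mem_univ, if_true]
      rw [hFν] at hz ⊢
      obtain ⟨k, hk, hkb⟩ := h.exists_int_le hS hI hab hz
      have hz' := hS.neg_mem _ hz
      rw [show -(ν a - ν b + γ • x) = ν b - ν a + (-γ) • x by module] at hz'
      obtain ⟨l, hl, hla⟩ := h.exists_int_le hS hI hab.symm hz'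
      have hkl : -k = l := by
        rw [hk] at hl
        exact_mod_cast hl
      refine Finset.mem_union_right _ (Finset.mem_biUnion.2 ⟨(a, b), by simp [hab], ?_⟩)
      exact Finset.mem_image.2 ⟨k, Finset.mem_Icc.2 ⟨by simp only; omega, hkb⟩, by rw [hk]⟩
  have hLcard : L.card ≤ 2 := by
    rcases L.eq_empty_or_nonempty with hLe | ⟨v, hv⟩
    · simp [hLe]
    · have : L ⊆ {v, -v} := by
        intro w hw
        obtain ⟨hvS, γ, hγ⟩ := Finset.mem_filter.1 hv
        obtain ⟨hwS, η, hη⟩ := Finset.mem_filter.1 hw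
        have hγ0 : γ ≠ 0 := by
          rintro rfl
          exact hS.ne_zero v hvS (by simp [hγ])
        have hw' : w = (η / γ) • v := by rw [hη, hγ, smul_smul, div_mul_cancel₀ _ hγ0]
        rw [hw'] at hwS
        rcases hS.eq_or v hvS _ hwS with e | e <;> simp [hw', e]
      exact (Finset.card_le_card this).trans Finset.card_le_two
  have hW : ∀ p, (W p).card ≤ 1 + α p.1 + α p.2 := by
    intro p
    refine Finset.card_image_le.trans ?_
    rw [Int.card_Icc]
    omega
  have hsum : ∑ p ∈ (Finset.univ : Finset ι).offDiag, (1 + α p.1 + α p.2) +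
      (Fintype.card ι + 6) = Fintype.card ι * Fintype.card ι + 6 * Fintype.card ι := by
    have h1 : ∑ p ∈ (Finset.univ : Finset ι).diag, (1 + α p.1 + α p.2) = Fintype.card ι + 6 := by
      rw [Finset.sum_diag]
      simp only [Finset.sum_add_distrib, h.sum_weight]
      simp
    have h2 : ∑ p : ι × ι, (1 + α p.1 + α p.2) =
        Fintype.card ι * Fintype.card ι + 6 * Fintype.card ι := by
      rw [Fintype.sum_prod_type]
      simp only [Finset.sum_add_distrib, h.sum_weight, Finset.sum_const, Finset.card_univ,
        smul_eq_mul, ← Finset.mul_sum]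
      ring
    rw [← h1, ← h2, add_comm, ← Finset.sum_union (Finset.disjoint_diag_offDiag _),
      Finset.diag_union_offDiag, Finset.univ_product_univ]
  have hcard := (Finset.card_le_card hsub).trans (Finset.card_union_le _ _)
  have hbi : ((Finset.univ : Finset ι).offDiag.biUnion W).card ≤
      ∑ p ∈ (Finset.univ : Finset ι).offDiag, (1 + α p.1 + α p.2) :=
    Finset.card_biUnion_le.trans (Finset.sum_le_sum fun p _ => hW p)
  have hIι : 6 ≤ Fintype.card ι := hI.trans (Finset.card_le_univ I)
  rw [h.card_eq] at hsum hIι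
  generalize finrank ℚ V = r at *
  obtain ⟨r, rfl⟩ := Nat.exists_eq_add_of_le hIι
  have : 6 + r - 1 = 5 + r := by omega
  rw [this]
  nlinarith

end ChainSystems

end

section

open Module

section CloneToChain

variable {V : Type*} [AddCommGroup V] [Module ℚ V] [FiniteDimensional ℚ V]

theorem finrank_add_card_le_of_dual {J : Finset V} {δ : V → V →ₗ[ℚ] ℚ} {U W : Submodule ℚ V}
    (hUW : U ≤ W) (hU : ∀ i ∈ J, ∀ u ∈ U, δ i u = 0) (f : V → V) (hf : ∀ j ∈ J, f j ∈ W)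
    (h1 : ∀ i ∈ J, δ i (f i) = 1) (h0 : ∀ i ∈ J, ∀ j ∈ J, i ≠ j → δ i (f j) = 0) :
    finrank ℚ U + J.card ≤ finrank ℚ W := by
  classical
  let Φ : W →ₗ[ℚ] (J → ℚ) := LinearMap.pi fun i => (δ i).comp W.subtype
  have hrange : LinearMap.range Φ = ⊤ := by
    rw [eq_top_iff]
    intro g _
    refine ⟨∑ j : J, g j • ⟨f j, hf j j.2⟩, ?_⟩
    rw [map_sum]
    ext i
    rw [Finset.sum_apply, Finset.sum_eq_single i]
    · simp [Φ, h1 i i.2]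
    · intro j _ hj
      have : δ i (f j) = 0 := h0 i i.2 j j.2 fun e => hj (Subtype.ext e.symm)
      simp [Φ, this]
    · simp
  have hker : U.comap W.subtype ≤ LinearMap.ker Φ := by
    intro w hw
    rw [LinearMap.mem_ker]
    ext i
    exact hU i i.2 _ hw
  have h2 := Φ.finrank_range_add_finrank_ker
  have h3 := Submodule.finrank_mono hker
  rw [(Submodule.comapSubtypeEquivOfLe hUW).finrank_eq] at h3
  rw [hrange, finrank_top, Module.finrank_fintype_fun_eq_card, Fintype.card_coe] at h2
  omega

theorem exists_chain_base {V : Type*} [AddCommGroup V] [Module ℚ V]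
    {Q E : Finset V} {x : V} (hx : x ≠ 0) (hE : ∀ e ∈ E, e - x ∈ Q) :
    ∀ q ∈ Q, ∃ k : ℕ, q - (k : ℚ) • x ∉ E ∧ ∀ j : ℕ, j ≤ k → q - (j : ℚ) • x ∈ Q := by
  classical
  intro q hq
  have hex : ∃ k : ℕ, q - (k : ℚ) • x ∉ E := by
    by_contra hcon
    push Not at hcon
    have hinj : Function.Injective fun k : ℕ => q - (k : ℚ) • x := by
      intro k l hkl
      have h1 : (k : ℚ) • x = (l : ℚ) • x := sub_right_injective hkl
      exact_mod_cast smul_left_injective ℚ hx h1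
    exact Set.infinite_range_of_injective hinj (E.finite_toSet.subset (by
      rintro _ ⟨k, rfl⟩; exact hcon k))
  refine ⟨Nat.find hex, Nat.find_spec hex, fun j => ?_⟩
  induction j with
  | zero => intro _; simpa using hq
  | succ j _ =>
    intro hj
    have h1 := hE _ (not_not.1 (Nat.find_min hex (m := j) (by omega)))
    convert h1 using 1
    push_cast
    module

theorem CloneSystem.exists_chainSystem {S J Q : Finset V} {δ : V → V →ₗ[ℚ] ℚ}
    (hS : ThreeModular S) (h : CloneSystem S J Q δ) (hJ : 4 ≤ J.card)
    (hcard : finrank ℚ V + 3 ≤ Q.card + J.card) :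
    ∃ (H : Finset V) (α : J ⊕ H → ℕ) (x : V),
      ChainSystem S ((Finset.univ : Finset J).map Function.Embedding.inl)
        (Sum.elim (fun i : J => (i : V)) fun t : H => -(t : V)) α x := by
  classical
  have hQd := h.card_le hS hJ
  set d := finrank ℚ (vectorSpan ℚ (Q : Set V)) with hd
  have hδU : ∀ i ∈ J, ∀ u ∈ vectorSpan ℚ (Q : Set V), δ i u = 0 := fun i hi u hu =>
    h.coord_vectorSpan hi hu
  have hdJ : d + J.card ≤ finrank ℚ V := by
    have := finrank_add_card_le_of_dual (U := vectorSpan ℚ (Q : Set V)) (W := ⊤) le_top hδU id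
      (fun _ _ => trivial) h.coord_self h.coord_ne
    rwa [finrank_top] at this
  have hQcard : Q.card = d + 3 := by omega
  obtain ⟨x, hx, E, hEQ, hEc, hEx⟩ := hQd.2 hQcard.ge
  choose! n hn hnQ using exists_chain_base hx hEx
  have hHmem : ∀ q ∈ Q, q - (n q : ℚ) • x ∈ Q \ E := fun q hq =>
    Finset.mem_sdiff.2 ⟨hnQ q hq _ le_rfl, hn q hq⟩
  let A : V → Finset V := fun t => E.filter fun e => e - (n e : ℚ) • x = t
  have hA : ∀ t ∈ Q \ E, ∀ k : ℕ, k ≤ (A t).card → t + (k : ℚ) • x ∈ Q := by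
    intro t ht k hk
    rcases Nat.eq_zero_or_pos k with rfl | hk0
    · simpa using (Finset.mem_sdiff.1 ht).1
    obtain ⟨e, he, hke⟩ : ∃ e ∈ A t, k ≤ n e := by
      by_contra hcon
      push Not at hcon
      have hle := Finset.card_le_card_of_injOn n (s := A t) (t := Finset.Ico 1 k) (fun e he => by
          obtain ⟨heE, -⟩ := Finset.mem_filter.1 he
          have h0 : n e ≠ 0 := fun h0 => hn e (hEQ heE) (by simpa [h0] using heE)
          exact Finset.mem_coe.2 (Finset.mem_Ico.2 ⟨by omega, hcon e he⟩))
        (fun e he e' he' hee => by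
          have h1 := (Finset.mem_filter.1 he).2
          have h2 := (Finset.mem_filter.1 he').2
          rw [← h2, hee] at h1
          exact sub_left_injective h1)
      rw [Nat.card_Ico] at hle
      omega
    obtain ⟨heE, het⟩ := Finset.mem_filter.1 he
    have := hnQ e (hEQ heE) (n e - k) (Nat.sub_le _ _)
    rw [Nat.cast_sub hke] at this
    rw [← het]
    convert this using 1
    module
  have hHc : (Q \ E).card = d := by rw [Finset.card_sdiff_of_subset hEQ]; omega
  obtain ⟨i₀, hi₀⟩ := Finset.card_pos.1 (show 0 < J.card by omega)
  obtain ⟨q₀, hq₀⟩ := Finset.card_pos.1 (show 0 < Q.card by omega)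
  let ν : J ⊕ (Q \ E : Finset V) → V := Sum.elim (fun i => (i : V)) fun t => -(t : V)
  let α : J ⊕ (Q \ E : Finset V) → ℕ := Sum.elim (fun _ => 0) fun t => (A t).card
  have hle : d + J.card = finrank ℚ V := by omega
  refine ⟨Q \ E, α, x, ?_, ?_, ?_, ?_, ?_⟩
  · rw [Fintype.card_sum, Fintype.card_coe, Fintype.card_coe, hHc]
    omega
  · intro i hi
    obtain ⟨i, -, rfl⟩ := Finset.mem_map.1 hi
    rfl
  · rw [Fintype.sum_sum_type]
    simp only [α, Sum.elim_inl, Sum.elim_inr, Finset.sum_const_zero, zero_add]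
    rw [Finset.sum_coe_sort (Q \ E) fun t => (A t).card, ← hEc]
    exact (Finset.card_eq_sum_card_fiberwise fun e he => hHmem e (hEQ he)).symm
  · intro i hi a hai k hk
    obtain ⟨i, -, rfl⟩ := Finset.mem_map.1 hi
    rcases a with j | t
    · have hk0 : k = 0 := Nat.le_zero.1 hk
      subst hk0
      have : (i : V) ≠ j := fun e => hai (by rw [Subtype.ext e]; rfl)
      simpa using h.sub_mem i i.2 j j.2 this
    · have := h.add_mem i i.2 _ (hA t t.2 k hk)
      convert this using 1
      simp only [Sum.elim_inr]
      change (i : V) - -(t : V) + _ = _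
      abel
  · let W : Submodule ℚ V :=
      { carrier := {z | ∃ (F : J ⊕ (Q \ E : Finset V) → ℚ) (γ : ℚ), ∑ a, F a = 0 ∧
          z = ∑ a, F a • ν a + γ • x}
        zero_mem' := ⟨0, 0, by simp, by simp⟩
        add_mem' := by
          rintro _ _ ⟨F, γ, hF, rfl⟩ ⟨G, η, hG, rfl⟩
          refine ⟨F + G, γ + η, ?_, ?_⟩
          · simp only [Pi.add_apply, Finset.sum_add_distrib, hF, hG, add_zero]
          · simp only [Pi.add_apply, add_smul, Finset.sum_add_distrib]
            abel
        smul_mem' := by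
          rintro c _ ⟨F, γ, hF, rfl⟩
          refine ⟨c • F, c * γ, ?_, ?_⟩
          · simp only [Pi.smul_apply, smul_eq_mul, ← Finset.mul_sum, hF, mul_zero]
          · simp only [Pi.smul_apply, smul_eq_mul, mul_smul, smul_add, Finset.smul_sum] }
    have hxW : x ∈ W := ⟨0, 1, by simp, by simp⟩
    have hνW : ∀ a b, ν a - ν b ∈ W := by
      intro a b
      refine ⟨Pi.single a 1 - Pi.single b 1, 0, by simp, ?_⟩
      simp only [Pi.sub_apply, sub_smul, Finset.sum_sub_distrib, Pi.single_apply, ite_smul,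
        one_smul, zero_smul, Finset.sum_ite_eq', Finset.mem_univ, if_true, add_zero]
    have hiq : ∀ i ∈ J, ∀ q ∈ Q, i + q ∈ W := by
      intro i hi q hq
      have := W.add_mem (hνW (.inl ⟨i, hi⟩) (.inr ⟨_, hHmem q hq⟩)) (W.smul_mem (n q : ℚ) hxW)
      convert this using 1
      simp only [ν, Sum.elim_inl, Sum.elim_inr]
      module
    have hUW : vectorSpan ℚ (Q : Set V) ≤ W := by
      rw [vectorSpan_def, Submodule.span_le]
      intro y hy
      obtain ⟨q, hq, q', hq', rfl⟩ := Set.mem_vsub.1 hy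
      have := W.sub_mem (hiq i₀ hi₀ q hq) (hiq i₀ hi₀ q' hq')
      rwa [add_sub_add_left_eq_sub] at this
    have hfin := finrank_add_card_le_of_dual hUW hδU (fun i => i + q₀)
      (fun i hi => hiq i hi q₀ hq₀)
      (fun i hi => by rw [map_add, h.coord_self i hi, h.coord_eq_zero i hi q₀ hq₀, add_zero])
      (fun i hi j hj hij => by
        rw [map_add, h.coord_ne i hi j hj hij, h.coord_eq_zero i hi q₀ hq₀, add_zero])
    have hWtop : W = ⊤ := Submodule.eq_top_of_finrank_eq
      (le_antisymm (Submodule.finrank_le W) (by omega))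
    intro z
    have hz : z ∈ W := hWtop ▸ trivial
    exact hz

theorem CloneSystem.card_le_of_finrank_le {S J Q : Finset V} {δ : V → V →ₗ[ℚ] ℚ}
    (hS : ThreeModular S) (h : CloneSystem S J Q δ) (hJ : 6 ≤ J.card)
    (hcard : finrank ℚ V + 3 ≤ Q.card + J.card) :
    S.card ≤ finrank ℚ V * (finrank ℚ V + 1) + 4 * (finrank ℚ V - 1) := by
  obtain ⟨H, α, x, hc⟩ := h.exists_chainSystem hS (by omega) hcard
  exact hc.card_le hS (by simpa using hJ)

end CloneToChain

theorem ThreeModular.exists_card_le : ∃ R : ℕ, ∀ (V : Type) [AddCommGroup V] [Module ℚ V]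
    [FiniteDimensional ℚ V] (S : Finset V), ThreeModular S → R ≤ finrank ℚ V →
      S.card ≤ finrank ℚ V * (finrank ℚ V + 1) + 4 * (finrank ℚ V - 1) := by
  obtain ⟨R, hR⟩ := exists_cloneSystem 6
  refine ⟨R + 1 + 7 ^ (R + 1), fun V _ _ _ S hS hr => ?_⟩
  refine card_le_of_noGain_bound (r₁ := R + 1) (by omega) ?_ V S hS hr
  intro V _ _ _ S hS hN hr
  obtain ⟨J, Q, δ, h, hJ, hcard⟩ := hR hS hN (by omega)
  exact h.card_le_of_finrank_le hS hJ hcard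

end

section

open Module

section Matrices

variable {r n : ℕ}

theorem DeltaModular.exists_det_eq {A : Matrix (Fin r) (Fin n) ℤ} (hA : DeltaModular A 3)
    (v : Fin r → Fin r → ℚ)
    (hv : ∀ i, ∃ j, ∃ ε : ℤ, (ε = 1 ∨ ε = -1) ∧ v i = (ε : ℚ) • fun k => (A k j : ℚ)) :
    ∃ k : ℤ, Matrix.det (Matrix.of v) = k ∧ |k| ≤ 3 := by
  choose f ε hε hfv using hv
  have hdet : Matrix.det (Matrix.of v) =
      (((∏ i, ε i) * (A.submatrix id f).det : ℤ) : ℚ) := by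
    have h1 := Matrix.det_mul_column ε (A.submatrix id f).transpose
    rw [Matrix.det_transpose] at h1
    rw [← h1, Int.cast_det]
    congr 1
    ext i k
    simp [hfv]
  refine ⟨_, hdet, ?_⟩
  have hprod : |∏ i, ε i| = 1 := by
    rw [Finset.abs_prod]
    exact Finset.prod_eq_one fun i _ => by rcases hε i with h | h <;> simp [h]
  rw [abs_mul, hprod, one_mul]
  by_cases hf : Function.Injective f
  · exact hA f hf
  · rw [Function.not_injective_iff] at hf
    obtain ⟨i, j, hij, hne⟩ := hf
    rw [Matrix.det_zero_of_column_eq hne fun k => by simp [hij]]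
    norm_num

theorem exists_threeModular_of_columns {A : Matrix (Fin r) (Fin n) ℤ}
    (hrank : (A.map (fun z : ℤ => (z : ℚ))).rank = r) (hA : DeltaModular A 3)
    {T : Finset (Fin n)} (h0 : ∀ i ∈ T, (fun k => A k i) ≠ 0)
    (hT : ∀ i ∈ T, ∀ j ∈ T, i ≠ j → ¬ IntParallel (fun k => A k i) (fun k => A k j)) :
    ∃ S : Finset (Fin r → ℚ), ThreeModular S ∧ 2 * T.card ≤ S.card := by
  classical
  let c : Fin n → Fin r → ℚ := fun j k => (A k j : ℚ)
  have hc0 : ∀ j, (fun k => A k j) ≠ 0 ↔ c j ≠ 0 := by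
    intro j
    rw [not_iff_not, funext_iff, funext_iff]
    simp [c]
  let P : Finset (Fin n) → Prop := fun T => (∀ i ∈ T, c i ≠ 0) ∧
    ∀ i ∈ T, ∀ j ∈ T, i ≠ j → LinearIndependent ℚ ![c i, c j]
  have hP : P T := ⟨fun i hi => (hc0 i).1 (h0 i hi),
    fun i hi j hj hij => not_not.1 (hT i hi j hj hij)⟩
  obtain ⟨M, hTM, hM⟩ := Finite.exists_le_maximal hP
  obtain ⟨hM0, hMind⟩ := hM.prop
  have hpar : ∀ i ∈ M, ∀ j ∈ M, ∀ a b : ℚ, a ≠ 0 → a • c i = b • c j → i = j := by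
    intro i hi j hj a b ha hab
    by_contra hij
    have := LinearIndependent.pair_iff.1 (hMind i hi j hj hij) a (-b) (by
      rw [hab, neg_smul, add_neg_cancel])
    exact ha this.1
  have hspan : ∀ j, c j ∈ Submodule.span ℚ (c '' M) := by
    intro j
    by_cases hj : j ∈ M
    · exact Submodule.subset_span ⟨j, hj, rfl⟩
    by_cases hj0 : c j = 0
    · rw [hj0]; exact Submodule.zero_mem _
    have hnP : ¬ P (insert j M) := fun h => hj (hM.le_of_ge h (Finset.subset_insert _ _)
      (Finset.mem_insert_self _ _))
    obtain ⟨i, hi, hdep⟩ : ∃ i ∈ M, ¬ LinearIndependent ℚ ![c i, c j] := by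
      by_contra hcon
      push Not at hcon
      refine hnP ⟨?_, ?_⟩
      · intro i hi
        rcases Finset.mem_insert.1 hi with h | h
        · rwa [h]
        · exact hM0 i h
      · intro i hi l hl hil
        rcases Finset.mem_insert.1 hi with h | h <;> rcases Finset.mem_insert.1 hl with h' | h'
        · exact absurd (h.trans h'.symm) hil
        · rw [h]
          exact LinearIndependent.pair_symm_iff.1 (hcon l h')
        · rw [h']
          exact hcon i h
        · exact hMind i h l h' hil
    rw [LinearIndependent.pair_iff] at hdep
    push Not at hdep
    obtain ⟨s, t, hst, hne⟩ := hdep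
    have ht : t ≠ 0 := by
      rintro rfl
      rw [zero_smul, add_zero] at hst
      rcases smul_eq_zero.1 hst with h | h
      · exact hne h rfl
      · exact hM0 i hi h
    have : c j = (-(s / t)) • c i := by
      have h1 : t • c j = -(s • c i) := eq_neg_of_add_eq_zero_right hst
      rw [← inv_smul_smul₀ ht (c j), h1, smul_neg, smul_smul, neg_smul]
      congr 2
      field_simp
    rw [this]
    exact Submodule.smul_mem _ _ (Submodule.subset_span ⟨i, hi, rfl⟩)
  set S : Finset (Fin r → ℚ) := M.image c ∪ M.image fun j => -c j with hSdef
  have hS : ∀ v, v ∈ S ↔ ∃ j ∈ M, ∃ ε : ℤ, (ε = 1 ∨ ε = -1) ∧ v = (ε : ℚ) • c j := by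
    intro v
    simp only [hSdef, Finset.mem_union, Finset.mem_image]
    constructor
    · rintro (⟨j, hj, rfl⟩ | ⟨j, hj, rfl⟩)
      · exact ⟨j, hj, 1, .inl rfl, by simp⟩
      · exact ⟨j, hj, -1, .inr rfl, by simp⟩
    · rintro ⟨j, hj, ε, rfl | rfl, rfl⟩
      · exact .inl ⟨j, hj, by simp⟩
      · exact .inr ⟨j, hj, by simp⟩
  have hεne : ∀ ε : ℤ, ε = 1 ∨ ε = -1 → (ε : ℚ) ≠ 0 := by
    rintro ε (rfl | rfl) <;> norm_num
  refine ⟨S, ⟨?_, ?_, ?_, ?_, ?_⟩, ?_⟩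
  · intro v hv
    obtain ⟨j, hj, ε, hε, rfl⟩ := (hS v).1 hv
    exact smul_ne_zero (hεne ε hε) (hM0 j hj)
  · intro v hv
    obtain ⟨j, hj, ε, hε, rfl⟩ := (hS v).1 hv
    exact (hS _).2 ⟨j, hj, -ε, by omega, by push_cast; rw [neg_smul]⟩
  · intro v hv a hav
    obtain ⟨j, hj, ε, hε, rfl⟩ := (hS v).1 hv
    obtain ⟨i, hi, η, hη, e⟩ := (hS _).1 hav
    rw [smul_smul] at e
    have hij := hpar i hi j hj η (a * ε) (hεne η hη) e.symm
    subst hij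
    have h1 : a * ε = η := smul_left_injective ℚ (hM0 i hi) e
    rcases hε with rfl | rfl <;> rcases hη with rfl | rfl <;> push_cast at h1
    · left; linarith
    · right; linarith
    · right; linarith
    · left; linarith
  · rw [eq_top_iff]
    have htop : Submodule.span ℚ (Set.range c) = ⊤ := by
      refine Submodule.eq_top_of_finrank_eq ?_
      rw [Matrix.rank_eq_finrank_span_cols] at hrank
      rw [Module.finrank_fin_fun]
      exact hrank
    rw [← htop, Submodule.span_le]
    rintro _ ⟨j, rfl⟩
    refine Submodule.span_mono ?_ (hspan j)
    rintro _ ⟨i, hi, rfl⟩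
    exact (hS _).2 ⟨i, hi, 1, .inl rfl, by simp⟩
  · have e : Fin r ≃ Fin (finrank ℚ (Fin r → ℚ)) := finCongr (by simp)
    refine ⟨Matrix.detRowAlternating.domDomCongr e, ?_, ?_⟩
    · intro h
      have h1 := congrArg (fun D => D fun i => (1 : Matrix (Fin r) (Fin r) ℚ) (e.symm i)) h
      simp only [AlternatingMap.domDomCongr_apply, AlternatingMap.zero_apply] at h1
      have h2 : Matrix.det (1 : Matrix (Fin r) (Fin r) ℚ) = 0 := by
        rw [← h1]
        refine congrArg Matrix.det (funext fun i => ?_)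
        exact congrArg (1 : Matrix (Fin r) (Fin r) ℚ) (e.symm_apply_apply i).symm
      rw [Matrix.det_one] at h2
      exact one_ne_zero h2
    · intro v hv
      rw [AlternatingMap.domDomCongr_apply]
      exact hA.exists_det_eq _ fun i => by
        obtain ⟨j, -, ε, hε, h⟩ := (hS _).1 (hv (e i))
        exact ⟨j, ε, hε, h⟩
  · have hinj : Set.InjOn c M := fun i hi j hj hij =>
      hpar i hi j hj 1 1 one_ne_zero (by rw [hij])
    have hinj' : Set.InjOn (fun j => -c j) M := fun i hi j hj hij =>
      hinj hi hj (neg_injective hij)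
    have hdisj : Disjoint (M.image c) (M.image fun j => -c j) := by
      rw [Finset.disjoint_left]
      intro v hv hv'
      obtain ⟨i, hi, rfl⟩ := Finset.mem_image.1 hv
      obtain ⟨j, hj, e⟩ := Finset.mem_image.1 hv'
      have hij := hpar i hi j hj 1 (-1) one_ne_zero (by rw [← e]; simp)
      subst hij
      exact hM0 i hi (self_eq_neg.1 e.symm)
    rw [hSdef, Finset.card_union_of_disjoint hdisj, Finset.card_image_of_injOn hinj,
      Finset.card_image_of_injOn hinj']
    have := Finset.card_le_card hTM
    omega

end Matrices

end

/-- There is an `r₀` such that for all `r ≥ r₀`, any rank-`r` `3`-modular integer matrix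
with `r` rows has at most `binom (r+1) 2 + 2 (r-1)` pairwise non-parallel columns:
any set of column indices whose columns are nonzero and pairwise non-parallel has
cardinality at most this bound. -/
theorem three_modular_column_bound :
    ∃ r₀ : ℤ, ∀ r : ℕ, r₀ ≤ (r : ℤ) →
      ∀ (n : ℕ) (A : Matrix (Fin r) (Fin n) ℤ),
        (A.map (fun z : ℤ => (z : ℚ))).rank = r →
        DeltaModular A 3 →
        ∀ T : Finset (Fin n),
          (∀ i ∈ T, (fun k => A k i) ≠ 0) →
          (∀ i ∈ T, ∀ j ∈ T, i ≠ j →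
            ¬ IntParallel (fun k => A k i) (fun k => A k j)) →
          T.card ≤ (r + 1).choose 2 + 2 * (r - 1) := by
  obtain ⟨R, hR⟩ := ThreeModular.exists_card_le
  refine ⟨R, fun r hr n A hrank hA T h0 hT => ?_⟩
  obtain ⟨S, hS, hTS⟩ := exists_threeModular_of_columns hrank hA h0 hT
  have h1 := hR (Fin r → ℚ) S hS (by rw [Module.finrank_fin_fun]; exact_mod_cast hr)
  rw [Module.finrank_fin_fun] at h1
  have h2 : (r + 1).choose 2 * 2 = r * (r + 1) := by
    rw [Nat.choose_two_right, Nat.add_sub_cancel, mul_comm r,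
      Nat.div_mul_cancel (by rw [mul_comm]; exact (Nat.even_mul_succ_self r).two_dvd)]
  omega
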